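/- Assume (H1) and (H2), and let δ ∈ (1/3, 2/5). Then there exists a constant C > 0 such that for all λ > 1: (1/2π) ∫_ℍ (1 - C/(b(m)+1)^{(2-5δ)/2}) b(m) Σ_{k=0}^∞ [λ(1 - Cλ^{1-3δ}) - 1/4 - (2k+1)b(m)]₊⁰ dv(m) ≤ N(λ; q_A) ≤ (1/2π) ∫_ℍ (1 + C/(b(m)+1)^{(2-5δ)/2}) b(m) Σ_{k=0}^∞ [λ(1 + Cλ^{1-3δ}) - 1/4 - (2k+1)b(m)]₊⁰ dv(m), where [ρ]₊⁰ = 1 if ρ > 0 and [ρ]₊⁰ = 0 if ρ ≤ 0. -/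

import Mathlib

open MeasureTheory Real Filter

noncomputable section

/-- The upper half-plane ℍ as a subset of ℝ². -/
def UHP : Set (ℝ × ℝ) := {p : ℝ × ℝ | 0 < p.2}

/-- The hyperbolic measure `dv = y⁻² dx dy` on ℍ. -/
def volH : Measure (ℝ × ℝ) :=
  (volume.restrict UHP).withDensity fun p => ENNReal.ofReal ((p.2 ^ 2)⁻¹)

/-- x-derivative of a complex function on ℝ². -/
def dX (f : ℝ × ℝ → ℂ) (p : ℝ × ℝ) : ℂ := fderiv ℝ f p (1, 0)

/-- y-derivative of a complex function on ℝ². -/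
def dY (f : ℝ × ℝ → ℂ) (p : ℝ × ℝ) : ℂ := fderiv ℝ f p (0, 1)

/-- x-derivative of a real function on ℝ². -/
def dXr (f : ℝ × ℝ → ℝ) (p : ℝ × ℝ) : ℝ := fderiv ℝ f p (1, 0)

/-- y-derivative of a real function on ℝ². -/
def dYr (f : ℝ × ℝ → ℝ) (p : ℝ × ℝ) : ℝ := fderiv ℝ f p (0, 1)

/-- The magnetic field `b̃ = y² (∂ₓA₂ - ∂_yA₁)`. -/
def fieldB (A₁ A₂ : ℝ × ℝ → ℝ) (p : ℝ × ℝ) : ℝ := p.2 ^ 2 * (dXr A₂ p - dYr A₁ p)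

/-- The magnetic intensity `b = |b̃|`. -/
def intenB (A₁ A₂ : ℝ × ℝ → ℝ) (p : ℝ × ℝ) : ℝ := |fieldB A₁ A₂ p|

/-- Smooth compactly supported test functions with support inside a set `Ω`. -/
def IsTestOn (Ω : Set (ℝ × ℝ)) (f : ℝ × ℝ → ℂ) : Prop :=
  ContDiff ℝ (⊤ : ℕ∞) f ∧ HasCompactSupport f ∧ tsupport f ⊆ Ω

/-- The quadratic form of the magnetic Laplacian on ℍ. -/
def qA (A₁ A₂ : ℝ × ℝ → ℝ) (f : ℝ × ℝ → ℂ) : ℝ :=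
  ∫ p, p.2 ^ 2 * (‖-Complex.I * dX f p - (A₁ p : ℂ) * f p‖ ^ 2 +
    ‖-Complex.I * dY f p - (A₂ p : ℂ) * f p‖ ^ 2) ∂volH

/-- hyperbolic distance from `(x,y)` to `(0,1)`. -/
def hDist (p : ℝ × ℝ) : ℝ :=
  2 * Real.arsinh (Real.sqrt (p.1 ^ 2 + (p.2 - 1) ^ 2) / (2 * Real.sqrt p.2))

/-- (H1) : the magnetic intensity tends to +∞ at infinity. -/
def H1 (A₁ A₂ : ℝ × ℝ → ℝ) : Prop :=
  ∀ M : ℝ, ∃ R : ℝ, ∀ p ∈ UHP, R ≤ hDist p → M ≤ intenB A₁ A₂ p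

/-- (H2) : control of the derivative of the magnetic field. -/
def H2 (C₀ : ℝ) (A₁ A₂ : ℝ × ℝ → ℝ) : Prop :=
  ∀ p ∈ UHP, p.2 * Real.sqrt ((dXr (fieldB A₁ A₂) p) ^ 2 + (dYr (fieldB A₁ A₂) p) ^ 2)
    ≤ C₀ * (intenB A₁ A₂ p + 1)

/-- Counting function of a quadratic form `q` with form domain `dom` and squared
norm `nsq`, via Glazman's lemma. -/
def NN (q : (ℝ × ℝ → ℂ) → ℝ) (dom : Set (ℝ × ℝ → ℂ)) (nsq : (ℝ × ℝ → ℂ) → ℝ)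
    (lam : ℝ) : ℕ :=
  sSup {n : ℕ | ∃ V : Submodule ℂ (ℝ × ℝ → ℂ), (V : Set (ℝ × ℝ → ℂ)) ⊆ dom ∧
    Module.finrank ℂ V = n ∧ ∀ u ∈ V, u ≠ 0 → q u < lam * nsq u}

/-- Heaviside function `[ρ]₊⁰`. -/
def heav (ρ : ℝ) : ℝ := if 0 < ρ then 1 else 0


/-- The eigenvalue counting function of the magnetic Laplacian `-Δ_A` on `L²(ℍ,dv)`. -/
def NH (A₁ A₂ : ℝ × ℝ → ℝ) (lam : ℝ) : ℕ :=
  NN (qA A₁ A₂) {f | IsTestOn UHP f} (fun f => ∫ p, ‖f p‖ ^ 2 ∂volH) lam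

local notation "Rp" => ℝ × ℝ
local notation "Sm" => ContDiff ℝ (⊤ : ℕ∞)
local notation "Cd" => ContDiffOn ℝ 2
local notation "Hc" => HasCompactSupport
local notation "Ii" => Complex.I
abbrev mll := @mul_le_mul_of_nonneg_left
abbrev mlr := @mul_le_mul_of_nonneg_right
abbrev icc := @Continuous.integrable_of_hasCompactSupport
abbrev icm := @integral_const_mul
abbrev evf := @Eventually.of_forall
abbrev nea := @Real.norm_eq_abs
abbrev izt := @image_eq_zero_of_notMem_tsupport
def hP : ℕ → Polynomial ℝ
  | 0 => 1
  | k + 1 => 2 * Polynomial.X * hP k - Polynomial.derivative (hP k)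
def hG (k : ℕ) (y : ℝ) : ℝ := (hP k).eval y * exp (-y ^ 2 / 2)
lemma hP_deriv (k : ℕ) : Polynomial.derivative (hP (k + 1)) = 2 * ((k : Polynomial ℝ) + 1) * hP k := by
  induction k with
  | zero => simp [hP]
  | succ k ih =>
    rw [hP, Polynomial.derivative_sub, ih]
    simp only [Polynomial.derivative_mul, Polynomial.derivative_X, Polynomial.derivative_ofNat,
      Polynomial.derivative_add, Polynomial.derivative_natCast, Polynomial.derivative_one, ih]
    rw [show hP (k+1) = 2 * Polynomial.X * hP k - Polynomial.derivative (hP k) from rfl]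
    push_cast
    ring
lemma hG_cont (k : ℕ) : Continuous (hG k) := by
  unfold hG
  fun_prop
lemma hG_deriv (k : ℕ) (y : ℝ) : HasDerivAt (hG k) (y * hG k y - hG (k + 1) y) y := by
  have h1 : HasDerivAt (fun y : ℝ => exp (-y ^ 2 / 2)) (-y * exp (-y ^ 2 / 2)) y := by
    have := (((hasDerivAt_pow 2 y)).fun_neg.div_const 2).exp
    grind
  have := ((hP k).hasDerivAt y).mul h1
  refine HasDerivAt.congr_deriv (f := hG k) this ?_
  simp only [hG]
  rw [show hP (k + 1) = 2 * Polynomial.X * hP k - Polynomial.derivative (hP k) from rfl]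
  simp
  ring
lemma hG_lower (k : ℕ) (y : ℝ) : 2 * y * hG (k + 1) y = hG (k + 2) y + 2 * (k + 1) * hG k y := by
  simp only [hG]
  rw [show hP (k + 2) = 2 * Polynomial.X * hP (k+1) - Polynomial.derivative (hP (k+1)) from rfl,
    hP_deriv]
  simp
  ring
lemma poly_int (p : Polynomial ℝ) {b : ℝ} (hb : 0 < b) :
    Integrable (fun y : ℝ => p.eval y * exp (-b * y ^ 2)) := by
  induction p using Polynomial.induction_on' with
  | add p q hp hq => exact (hp.add hq).congr (evf fun y => by simp [add_mul])
  | monomial n c =>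
    have := (integrable_rpow_mul_exp_neg_mul_sq hb (s := (n : ℝ)) (by
      linarith)).const_mul c
    simpa [mul_assoc] using this
lemma hG_mul_int (p : Polynomial ℝ) (j k : ℕ) : Integrable (fun y => p.eval y * (hG j y * hG k y)) := by
  have := poly_int (p * hP j * hP k) one_pos
  refine this.congr (evf fun y => ?_)
  simp only [hG, Polynomial.eval_mul]
  have : exp (-1 * y ^ 2) = exp (-y ^ 2 / 2) * exp (-y ^ 2 / 2) := by rw [← exp_add]; ring_nf
  rw [this]; ring
lemma hG_int2 (j k : ℕ) : Integrable (fun y => hG j y * hG k y) := by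
  simpa using hG_mul_int 1 j k
lemma hG_rec (j k : ℕ) : ∫ y, hG (j + 1) y * hG k y = ∫ y, hG j y * (2 * y * hG k y - hG (k + 1) y) := by
  have h := integral_mul_deriv_eq_deriv_mul_of_integrable (u := hG j) (v := hG k)
    (fun x _ => hG_deriv j x) (fun x _ => hG_deriv k x)
    (by
      refine ((hG_mul_int Polynomial.X j k).sub (hG_int2 j (k+1))).congr (evf fun y => ?_)
      simp; ring)
    (by
      refine ((hG_mul_int Polynomial.X j k).sub (hG_int2 (j+1) k)).congr (evf fun y => ?_)
      simp; ring) (hG_int2 j k)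
  have e1 : ∫ y, (y * hG j y - hG (j + 1) y) * hG k y
      = (∫ y, y * (hG j y * hG k y)) - ∫ y, hG (j+1) y * hG k y := by
    rw [← integral_sub (by simpa using hG_mul_int Polynomial.X j k) (hG_int2 _ _)]
    grind
  have e2 : ∫ y, hG j y * (2 * y * hG k y - hG (k + 1) y)
      = (∫ y, y * (hG j y * hG k y)) + ∫ y, hG j y * (y * hG k y - hG (k + 1) y) := by
    rw [← integral_add (by simpa using hG_mul_int Polynomial.X j k)]
    · grind
    · refine ((hG_mul_int Polynomial.X j k).sub (hG_int2 j (k+1))).congr (evf fun y => ?_)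
      simp; ring
  linarith
lemma hG_orth (j k : ℕ) : ∫ y, hG j y * hG k y = if j = k then 2 ^ k * (k.factorial : ℝ) * √π else 0 := by
  induction j generalizing k with
  | zero =>
    cases k with
    | zero =>
      have := integral_gaussian 1
      simp at this
      simp only [hG, hP, Polynomial.eval_one, one_mul, pow_zero, Nat.factorial_zero, Nat.cast_one]
      rw [← this]
      congr 1; ext y; rw [← exp_add]; ring_nf
    | succ k =>
      have := hG_rec k 0
      simp_rw [show ∀ y, 2 * y * hG 0 y - hG (0+1) y = 0 by intro y; simp [hG, hP]] at this
      simp only [mul_zero, integral_zero] at this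
      grind
  | succ j ih =>
    rw [hG_rec]
    cases k with
    | zero =>
      simp_rw [show ∀ y, 2 * y * hG 0 y - hG (0+1) y = 0 by intro y; simp [hG, hP]]
      simp
    | succ k =>
      simp_rw [hG_lower]
      have : ∀ y, hG j y * (hG (k + 2) y + 2 * ((k:ℝ) + 1) * hG k y - hG (k + 1 + 1) y)
        = (2 * ((k:ℝ) + 1)) * (hG j y * hG k y) := by grind
      simp_rw [this]
      rw [icm, ih]
      by_cases h : j = k
      · subst h; simp [Nat.factorial_succ]; ring
      · simp [h]
def hC (k : ℕ) : ℝ := (√(2 ^ k * (k.factorial : ℝ) * √π))⁻¹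
def hF (k : ℕ) (y : ℝ) : ℝ := hC k * hG k y
lemma hC_pos (k : ℕ) : 0 < hC k := by unfold hC; positivity
lemma hF_cont (k : ℕ) : Continuous (hF k) := (hG_cont k).const_mul _
lemma hF_int2 (j k : ℕ) : Integrable (fun y => hF j y * hF k y) := by
  refine ((hG_int2 j k).const_mul (hC j * hC k)).congr (evf fun y => ?_)
  simp [hF]; ring
lemma hF_orth (j k : ℕ) : ∫ y, hF j y * hF k y = if j = k then 1 else 0 := by
  have : ∀ y, hF j y * hF k y = (hC j * hC k) * (hG j y * hG k y) := by intro y; simp [hF]; ring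
  simp_rw [this]
  rw [icm, hG_orth]
  split_ifs with h
  · subst h
    have : 0 < 2 ^ j * (j.factorial : ℝ) * √π := by positivity
    rw [hC, ← mul_inv, Real.mul_self_sqrt this.le, inv_mul_cancel₀ this.ne']
  · simp
def hF' (k : ℕ) (y : ℝ) : ℝ := hC k * (y * hG k y - hG (k + 1) y)
lemma hF_deriv (k : ℕ) (y : ℝ) : HasDerivAt (hF k) (hF' k y) y := (hG_deriv k y).const_mul _
lemma hF'_deriv (k : ℕ) (y : ℝ) : HasDerivAt (hF' k) ((y ^ 2 - (2 * k + 1)) * hF k y) y := by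
  have h1 := (((hasDerivAt_id y).mul (hG_deriv k y)).sub (hG_deriv (k+1) y)).const_mul (hC k)
  refine h1.congr_deriv ?_
  cases k with
  | zero => simp [hF, hG, hP]; ring
  | succ k =>
    have h2 := hG_lower (k+1) y
    simp only [hF, id] at *
    grind
lemma hF'_cont (k : ℕ) : Continuous (hF' k) := by
  unfold hF'
  have := hG_cont k
  have := hG_cont (k+1)
  fun_prop
lemma hF_smooth (k : ℕ) : Sm (hF k) := by
  refine contDiff_const.mul (ContDiff.mul ?_ ?_)
  · have := (hP k).contDiff_aeval (R := ℝ) (𝕜 := ℝ) (⊤ : ℕ∞)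
    simpa using this
  · fun_prop
lemma hF_raise (k : ℕ) (y : ℝ) : y * hF k y - hF' k y = √(2 * (k + 1)) * hF (k + 1) y := by
  have : hC k = √(2 * (k + 1)) * hC (k + 1) := by
    have h0 : (0:ℝ) < 2 * (k+1) := by positivity
    have h1 : √(2 * ((k:ℝ) + 1)) ≠ 0 := by positivity
    unfold hC
    rw [show 2 ^ (k+1) * ((k+1).factorial : ℝ) * √π = (2 * (k+1)) * (2 ^ k * (k.factorial : ℝ) * √π) by
      rw [Nat.factorial_succ]; push_cast; ring, Real.sqrt_mul h0.le, mul_inv, ← mul_assoc,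
      mul_inv_cancel₀ h1, one_mul]
  simp only [hF, hF']
  rw [this]; ring
open FourierTransform in
lemma fourier_inj {F : ℝ → ℂ} (hF : Integrable F) (h : ∀ t : ℝ, 𝓕 F t = 0) : ∀ᵐ x, F x = 0 := by
  apply ae_eq_zero_of_integral_contDiff_smul_eq_zero hF.locallyIntegrable
  intro g hg hgc
  have hg' := Complex.ofRealCLM.contDiff.comp hg
  have hgc' := hgc.comp_left Complex.ofReal_zero
  set G : SchwartzMap ℝ ℂ := hgc'.toSchwartzMap hg' with hG
  have key := VectorFourier.integral_fourierIntegral_smul_eq_flip (L := innerₗ ℝ) (μ := volume)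
    (ν := volume) Real.continuous_fourierChar continuous_inner (𝓕⁻ G).integrable hF
  have e1 : ∀ ξ, VectorFourier.fourierIntegral 𝐞 volume (innerₗ ℝ) ((𝓕⁻ G : SchwartzMap ℝ ℂ) : ℝ → ℂ) ξ = (g ξ : ℂ) := by
    intro ξ
    have : 𝓕 (𝓕⁻ G) = G := FourierTransform.fourier_fourierInv_eq G
    have h2 := congrArg (fun s : SchwartzMap ℝ ℂ => s ξ) this
    exact h2
  have e2 : ∀ x, VectorFourier.fourierIntegral 𝐞 volume (innerₗ ℝ).flip F x = 0 := by
    intro x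
    rw [← h x]
    simp
    rfl
  simp only [e1, e2, smul_zero] at key
  simpa using key
lemma gaus_memLp (p : Polynomial ℝ) : MemLp (fun y : ℝ => p.eval y * exp (-y ^ 2 / 2)) 2 := by
  have hc : Continuous (fun y : ℝ => p.eval y * exp (-y ^ 2 / 2)) := p.continuous.mul (by fun_prop)
  rw [memLp_two_iff_integrable_sq hc.aestronglyMeasurable]
  refine (poly_int (p * p) one_pos).congr (evf fun y => ?_)
  simp only [Polynomial.eval_mul]
  have : exp (-1 * y ^ 2) = exp (-y ^ 2 / 2) * exp (-y ^ 2 / 2) := by rw [← exp_add]; ring_nf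
  rw [this]; ring
lemma hG_memLp (k : ℕ) : MemLp (hG k) 2 := gaus_memLp _
lemma int_mul_of_memLp {g : ℝ → ℝ} {f : ℝ → ℂ} (hg : MemLp g 2) (hf : MemLp f 2) :
    Integrable (fun y => (g y : ℂ) * f y) := by
  have : MemLp (fun y => (g y : ℂ)) 2 := hg.ofReal
  exact this.integrable_mul hf
lemma exp_memLp (c : ℝ) : MemLp (fun y : ℝ => exp (c * |y|) * exp (-y ^ 2 / 2)) 2 := by
  rw [memLp_two_iff_integrable_sq (Continuous.aestronglyMeasurable (by fun_prop))]
  have h := (integrable_exp_neg_mul_sq (b := 1/2) (by norm_num)).const_mul (exp (2 * c ^ 2))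
  refine h.mono' (Continuous.aestronglyMeasurable (by fun_prop)) (evf fun y => ?_)
  rw [Real.norm_of_nonneg (by positivity), ← exp_add, ← exp_add, ← Real.exp_nat_mul]
  apply exp_le_exp.2
  nlinarith [sq_nonneg (2 * c - |y|), sq_abs y]
lemma hG_moment {f : ℝ → ℂ} (hf : MemLp f 2) (h : ∀ k, ∫ y, (hG k y : ℂ) * f y = 0) (n k : ℕ) :
    ∫ y, ((y ^ n * hG k y : ℝ) : ℂ) * f y = 0 := by
  induction n generalizing k with
  | zero => simpa using h k
  | succ n ih =>
    have hi : ∀ k, Integrable (fun y => ((y ^ n * hG k y : ℝ) : ℂ) * f y) := by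
      intro k
      refine int_mul_of_memLp ?_ hf
      have := gaus_memLp (Polynomial.X ^ n * hP k)
      simpa [hG, mul_assoc] using this
    cases k with
    | zero =>
      have e : ∀ y, ((y ^ (n+1) * hG 0 y : ℝ) : ℂ) * f y = (1/2) * (((y ^ n * hG 1 y : ℝ) : ℂ) * f y) := by
        intro y
        have : y * hG 0 y = hG 1 y / 2 := by simp [hG, hP]; ring
        rw [pow_succ, mul_assoc, this]; push_cast; ring
      simp_rw [e]
      rw [icm, ih, mul_zero]
    | succ k =>
      have e : ∀ y, ((y ^ (n+1) * hG (k+1) y : ℝ) : ℂ) * f y = (1/2) * (((y ^ n * hG (k+2) y : ℝ) : ℂ) * f y)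
          + (k+1) * (((y ^ n * hG k y : ℝ) : ℂ) * f y) := by
        intro y
        have : y * hG (k+1) y = hG (k+2) y / 2 + (k+1) * hG k y := by
          have := hG_lower k y; linarith
        rw [pow_succ, mul_assoc, this]; push_cast; ring
      simp_rw [e]
      rw [integral_add ((hi _).const_mul _) ((hi _).const_mul _), icm, icm,
        ih, ih]; simp
lemma hG_complete {f : ℝ → ℂ} (hf : MemLp f 2) (h : ∀ k, ∫ y, (hG k y : ℂ) * f y = 0) :
    f =ᵐ[volume] 0 := by
  have hm := hG_moment hf h
  have hF : Integrable (fun y => ((exp (-y ^ 2 / 2) : ℝ) : ℂ) * f y) := by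
    have := gaus_memLp 1
    exact int_mul_of_memLp (by simpa using this) hf
  have := fourier_inj hF ?_
  · filter_upwards [this] with y hy
    simpa [Complex.exp_ne_zero] using hy
  intro t
  rw [Real.fourier_real_eq_integral_exp_smul]
  set c : ℂ := ((-2 * π * t : ℝ) : ℂ) * Ii with hc
  have hs := hasSum_integral_of_dominated_convergence (μ := volume)
    (F := fun n y => (c ^ n / (n.factorial : ℂ)) * (((y ^ n * hG 0 y : ℝ) : ℂ) * f y))
    (f := fun y => Complex.exp (↑(-2 * π * y * t) * Ii) • (((exp (-y ^ 2 / 2) : ℝ) : ℂ) * f y))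
    (fun n y => (‖c‖ * |y|) ^ n / (n.factorial : ℝ) * (exp (-y ^ 2 / 2) * ‖f y‖)) ?_ ?_ ?_ ?_ ?_
  · have h0 : (fun n : ℕ => ∫ y, (c ^ n / (n.factorial : ℂ)) * (((y ^ n * hG 0 y : ℝ) : ℂ) * f y)) = fun _ => 0 := by
      ext n; rw [icm, hm, mul_zero]
    rw [h0] at hs
    exact hs.unique hasSum_zero
  · intro n
    have := hG_cont 0
    refine (Continuous.aestronglyMeasurable (by fun_prop)).mul (((Continuous.aestronglyMeasurable ?_)).mul hf.1)
    fun_prop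
  · intro n
    refine evf fun y => le_of_eq ?_
    simp only [norm_mul, norm_div, norm_pow, Complex.norm_natCast, Complex.norm_real, hG, hP,
      Polynomial.eval_one, one_mul, nea, abs_exp]
    ring
  · refine evf fun y => ?_
    exact (Real.summable_pow_div_factorial _).mul_right _
  · have e : ∀ y, (∑' n : ℕ, (‖c‖ * |y|) ^ n / (n.factorial : ℝ) * (exp (-y ^ 2 / 2) * ‖f y‖))
      = exp (‖c‖ * |y|) * exp (-y ^ 2 / 2) * ‖f y‖ := by
      intro y
      rw [tsum_mul_right, Real.exp_eq_exp_ℝ, NormedSpace.exp_eq_tsum_div]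
      ring
    simp_rw [e]
    exact (exp_memLp ‖c‖).integrable_mul hf.norm
  · refine evf fun y => ?_
    have := (NormedSpace.expSeries_div_hasSum_exp (𝔸 := ℂ) (c * y)).mul_right (((exp (-y ^ 2 / 2) : ℝ) : ℂ) * f y)
    rw [← Complex.exp_eq_exp_ℂ] at this
    have e : Complex.exp (↑(-2 * π * y * t) * Ii) • (↑(rexp (-y ^ 2 / 2)) * f y) =
        Complex.exp (c * ↑y) * (↑(rexp (-y ^ 2 / 2)) * f y) := by
      rw [smul_eq_mul, hc]; push_cast; ring_nf
    rw [e]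
    have e2 : (fun n : ℕ => (c ^ n / (n.factorial : ℂ)) * (((y ^ n * hG 0 y : ℝ) : ℂ) * f y)) =
        fun n => (c * ↑y) ^ n / ↑n.factorial * (↑(rexp (-y ^ 2 / 2)) * f y) := by
      ext n
      simp only [hG, hP, Polynomial.eval_one, mul_pow]; push_cast; ring
    grind
lemma hF_memLp (k : ℕ) : MemLp (hF k) 2 := (hG_memLp k).const_mul _
def hE (k : ℕ) : Lp ℂ 2 (volume : Measure ℝ) := ((hF_memLp k).ofReal (K := ℂ)).toLp _
lemma hE_inner {f : ℝ → ℂ} (hf : MemLp f 2) (k : ℕ) :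
    inner ℂ (hE k) (hf.toLp f) = ∫ y, (hF k y : ℂ) * f y := by
  apply integral_congr_ae
  filter_upwards [((hF_memLp k).ofReal (K := ℂ)).coeFn_toLp, hf.coeFn_toLp] with y h1 h2
  rw [hE, h1, h2]
  simp [mul_comm]
lemma hE_orth : Orthonormal ℂ hE := by
  rw [orthonormal_iff_ite]
  intro j k
  rw [show hE k = ((hF_memLp k).ofReal (K := ℂ)).toLp _ from rfl, hE_inner]
  have := hF_orth j k
  have e : ∀ y, (hF j y : ℂ) * ((hF k y : ℝ) : ℂ) = ((hF j y * hF k y : ℝ) : ℂ) := by simp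
  refine (integral_congr_ae (evf e)).trans ?_
  rw [integral_complex_ofReal, this]
  split_ifs <;> simp
lemma hE_bot : (Submodule.span ℂ (Set.range hE))ᗮ = ⊥ := by
  rw [Submodule.eq_bot_iff]
  intro f hf
  have h0 := fun k =>
    Submodule.inner_right_of_mem_orthogonal (Submodule.subset_span (Set.mem_range_self k)) hf
  have hm := Lp.memLp f
  have h1 : ∀ k, ∫ y, (hF k y : ℂ) * f y = 0 := by
    intro k
    rw [← hE_inner hm, Lp.toLp_coeFn, h0]
  rw [Lp.eq_zero_iff_ae_eq_zero]
  apply hG_complete hm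
  intro k
  have := h1 k
  simp only [hF, Complex.ofReal_mul, mul_assoc] at this
  rw [icm] at this
  exact (mul_eq_zero.1 this).resolve_left (by exact_mod_cast (hC_pos k).ne')
lemma parseval {f : ℝ → ℂ} (hf : MemLp f 2) :
    HasSum (fun k => ‖∫ y, (hF k y : ℂ) * f y‖ ^ 2) (∫ y, ‖f y‖ ^ 2) := by
  let b := HilbertBasis.mkOfOrthogonalEqBot hE_orth hE_bot
  have hb : ∀ k, b k = hE k := by
    intro k; simp [b]
  have := b.hasSum_inner_mul_inner (hf.toLp f) (hf.toLp f)
  simp only [hb] at this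
  have h2 := Complex.reCLM.hasSum this
  convert h2 using 1
  · ext k
    rw [← inner_conj_symm, hE_inner hf, Complex.conj_mul']
    norm_cast
  · rw [inner_self_eq_norm_sq_to_K, Lp.norm_toLp]
    have : (((eLpNorm f 2 volume).toReal : ℂ) ^ 2).re = (eLpNorm f 2 volume).toReal ^ 2 := by norm_cast
    refine Eq.trans ?_ this.symm
    rw [hf.eLpNorm_eq_integral_rpow_norm (by norm_num) (by norm_num)]
    rw [ENNReal.toReal_ofReal (by positivity), ← Real.rpow_natCast, ← Real.rpow_mul (by positivity)]
    norm_num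
lemma cc_memLp {f : ℝ → ℂ} (hf : Continuous f) (hc : Hc f) : MemLp f 2 :=
  hf.memLp_of_hasCompactSupport hc
lemma osc_base {f : ℝ → ℂ} (hf : ContDiff ℝ 1 f) (hc : Hc f) (L : ℝ) (K : ℕ)
    (hK : L ≤ 2 * K + 1) :
    L * (∫ y, ‖f y‖ ^ 2) - (∫ y, (‖deriv f y‖ ^ 2 + y ^ 2 * ‖f y‖ ^ 2)) ≤
      ∑ k ∈ Finset.range K, (L - (2 * k + 1)) * ‖∫ y, (hF k y : ℂ) * f y‖ ^ 2 := by
  have hfc : Continuous f := hf.continuous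
  have hdc : Continuous (deriv f) := hf.continuous_deriv le_rfl
  have hds : Hc (deriv f) := hc.deriv
  have hd : ∀ y, HasDerivAt f (deriv f y) y := fun y => (hf.differentiable one_ne_zero y).hasDerivAt
  set c : ℕ → ℝ := fun k => ‖∫ y, (hF k y : ℂ) * f y‖ ^ 2 with hcdef
  have p1 : HasSum c (∫ y, ‖f y‖ ^ 2) := parseval (cc_memLp hfc hc)
  let g : ℝ → ℂ := fun y => deriv f y + y * f y
  have hgc : Continuous g := by fun_prop
  have hgs : Hc g := hds.add (hc.mul_left)
  have p2 := parseval (cc_memLp hgc hgs)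
  have c1 : ∀ k, ∫ y, (hF k y : ℂ) * g y = √(2 * (k + 1)) * ∫ y, (hF (k+1) y : ℂ) * f y := by
    intro k
    have ck := hF_cont k
    have ck' := hF'_cont k
    have ibp := integral_mul_deriv_eq_deriv_mul_of_integrable (u := fun y => (hF k y : ℂ))
      (fun y _ => (hF_deriv k y).ofReal_comp) (fun y _ => hd y)
      (icc (by fun_prop) hds.mul_left)
      (icc (by fun_prop) hc.mul_left)
      (icc (by fun_prop) hc.mul_left)
    have i1 : Integrable (fun y => (hF k y : ℂ) * deriv f y) :=
      (icc (by fun_prop) hds.mul_left)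
    have i2 : Integrable (fun y => (y * hF k y : ℂ) * f y) :=
      (icc (by fun_prop) hc.mul_left)
    have i3 : Integrable (fun y => (hF' k y : ℂ) * f y) :=
      (icc (by fun_prop) hc.mul_left)
    calc ∫ y, (hF k y : ℂ) * g y = (∫ y, (hF k y : ℂ) * deriv f y) + ∫ y, (y * hF k y : ℂ) * f y := by
          rw [← integral_add i1 i2]; grind
      _ = ∫ y, ((y * hF k y : ℂ) * f y - (hF' k y : ℂ) * f y) := by
          rw [ibp, integral_sub i2 i3]; ring
      _ = _ := by
          rw [← icm]; congr 1; ext y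
          have := congrArg (fun r : ℝ => (r : ℂ)) (hF_raise k y)
          push_cast at this
          linear_combination (f y) * this
  have p3 : HasSum (fun k : ℕ => 2 * ((k : ℝ) + 1) * c (k + 1)) (∫ y, ‖g y‖ ^ 2) := by
    convert p2 using 1
    ext k
    rw [c1, norm_mul, mul_pow]
    simp only [Complex.norm_real, nea, sq_abs]
    rw [Real.sq_sqrt (by positivity)]
  have p4 : HasSum (fun k : ℕ => 2 * (k : ℝ) * c k) (∫ y, ‖g y‖ ^ 2) := by
    rw [← hasSum_nat_add_iff' 1]
    simpa using p3
  have hg2 : ∫ y, ‖g y‖ ^ 2 = (∫ y, (‖deriv f y‖ ^ 2 + y ^ 2 * ‖f y‖ ^ 2)) - ∫ y, ‖f y‖ ^ 2 := by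
    have hn : ∀ y, HasDerivAt (fun y => ‖f y‖ ^ 2) (2 * inner ℝ (f y) (deriv f y)) y :=
      fun y => (hd y).norm_sq
    have hs2 : Hc (fun y => ‖f y‖ ^ 2) := by
      refine hc.comp_left (g := fun z : ℂ => ‖z‖ ^ 2) (by simp)
    have hs3 : Hc (fun y => 2 * inner ℝ (f y) (deriv f y)) := by
      refine hc.mono ?_
      intro y hy
      contrapose! hy
      simp at *
      simp [hy]
    have hs4 : Hc (fun y => ‖deriv f y‖ ^ 2) := by
      refine hds.comp_left (g := fun z : ℂ => ‖z‖ ^ 2) (by simp)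
    have ibp := integral_mul_deriv_eq_deriv_mul_of_integrable (u := fun y => y)
      (fun y _ => hasDerivAt_id y) (fun y _ => hn y)
      (icc (by fun_prop) hs3.mul_left)
      (icc (by fun_prop) hs2.mul_left)
      (icc (by fun_prop) hs2.mul_left)
    have i1 : Integrable (fun y => ‖deriv f y‖ ^ 2 + y ^ 2 * ‖f y‖ ^ 2) :=
      (icc (by fun_prop) (hs4.add hs2.mul_left))
    have i2 : Integrable (fun y => y * (2 * inner ℝ (f y) (deriv f y))) :=
      (icc (by fun_prop) hs3.mul_left)
    have e : ∀ y, ‖g y‖ ^ 2 = (‖deriv f y‖ ^ 2 + y ^ 2 * ‖f y‖ ^ 2) + y * (2 * inner ℝ (f y) (deriv f y)) := by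
      intro y
      rw [@norm_add_sq_real, real_inner_comm, show (y : ℂ) * f y = y • f y from rfl, inner_smul_left, norm_smul,
        mul_pow, nea, sq_abs]
      simp
      ring
    simp_rw [e]
    rw [integral_add i1 i2, ibp]
    grind
  have p5 : HasSum (fun k : ℕ => (L - (2 * k + 1)) * c k)
      (L * (∫ y, ‖f y‖ ^ 2) - (∫ y, (‖deriv f y‖ ^ 2 + y ^ 2 * ‖f y‖ ^ 2))) := by
    have := (p1.mul_left (L - 1)).sub p4
    rw [hg2] at this
    have e1 : (fun k : ℕ => (L - (2 * k + 1)) * c k) = fun b : ℕ => (L - 1) * c b - 2 * ↑b * c b := by grind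
    grind
  have := sum_le_hasSum (Finset.range K) (fun k hk => ?_) p5.neg
  · rw [Finset.sum_neg_distrib] at this
    linarith
  · simp at hk
    have : (K : ℝ) ≤ k := by exact_mod_cast hk
    have h2 : 0 ≤ c k := by positivity
    nlinarith
lemma chg_var {E : Type*} [NormedAddCommGroup E] [NormedSpace ℝ E] (F : ℝ → E) (c : ℝ) {s : ℝ} (hs : 0 < s) :
    ∫ t, F (c + s⁻¹ * t) = s • ∫ y, F y := by
  rw [Measure.integral_comp_mul_left (fun t => F (c + t)) s⁻¹, integral_add_left_eq_self]
  grind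
def sH (β c : ℝ) (k : ℕ) (y : ℝ) : ℝ := √(√β) * hF k (√β * (y - c))
lemma osc_scaled {f : ℝ → ℂ} (hf : ContDiff ℝ 1 f) (hc : Hc f) {β : ℝ} (hβ : 0 < β)
    (c L : ℝ) (K : ℕ) (hK : L ≤ (2 * K + 1) * β) :
    L * (∫ y, ‖f y‖ ^ 2) - (∫ y, (‖deriv f y‖ ^ 2 + β ^ 2 * (y - c) ^ 2 * ‖f y‖ ^ 2)) ≤
      ∑ k ∈ Finset.range K, (L - (2 * k + 1) * β) * ‖∫ y, (sH β c k y : ℂ) * f y‖ ^ 2 := by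
  set s := √β with hs
  have hs0 : 0 < s := Real.sqrt_pos.2 hβ
  have hss : s ^ 2 = β := Real.sq_sqrt hβ.le
  have hsn := hs0.ne'
  let F : ℝ → ℂ := fun t => f (c + s⁻¹ * t)
  have hF1 : ContDiff ℝ 1 F := hf.comp (by fun_prop)
  have hFc : Hc F := by
    have : F = f ∘ (((Homeomorph.mulLeft₀ s⁻¹ (inv_ne_zero hsn)).trans (Homeomorph.addLeft c))) := by
      ext t; simp [F]
    rw [this]
    exact hc.comp_homeomorph _
  have hdF : ∀ t, deriv F t = s⁻¹ • deriv f (c + s⁻¹ * t) := by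
    intro t
    have h1 : HasDerivAt f (deriv f (c + s⁻¹ * t)) (c + s⁻¹ * t) := (hf.differentiable one_ne_zero _).hasDerivAt
    have h2 : HasDerivAt (fun t : ℝ => c + s⁻¹ * t) s⁻¹ t := by
      simpa using ((hasDerivAt_id t).const_mul s⁻¹).const_add c
    exact (h1.scomp t h2).deriv
  have base := osc_base hF1 hFc (L / β) K (by rwa [div_le_iff₀ hβ])
  have e1 : ∫ t, ‖F t‖ ^ 2 = s * ∫ y, ‖f y‖ ^ 2 := chg_var (fun y => ‖f y‖ ^ 2) c hs0
  have e2 : ∫ t, (‖deriv F t‖ ^ 2 + t ^ 2 * ‖F t‖ ^ 2) =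
      s * ∫ y, β⁻¹ * (‖deriv f y‖ ^ 2 + β ^ 2 * (y - c) ^ 2 * ‖f y‖ ^ 2) := by
    rw [← smul_eq_mul, ← chg_var (fun y => β⁻¹ * (‖deriv f y‖ ^ 2 + β ^ 2 * (y - c) ^ 2 * ‖f y‖ ^ 2)) c hs0]
    congr 1; ext t
    rw [hdF, norm_smul, mul_pow, nea, sq_abs, inv_pow, hss, ← hss]
    grind
  have e3 : ∀ k, ‖∫ t, (hF k t : ℂ) * F t‖ ^ 2 = s * ‖∫ y, (sH β c k y : ℂ) * f y‖ ^ 2 := by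
    intro k
    have : ∫ t, (hF k t : ℂ) * F t = ((√s : ℝ) : ℂ) * ∫ y, (sH β c k y : ℂ) * f y := by
      have h := chg_var (fun y => (hF k (s * (y - c)) : ℂ) * f y) c hs0
      have h' : ∀ t, s * (c + s⁻¹ * t - c) = t := by grind
      simp only [h'] at h
      rw [show ∫ t, (hF k t : ℂ) * F t = _ from h]
      simp only [sH]
      rw [← hs]
      simp_rw [Complex.ofReal_mul, mul_assoc]
      rw [icm, ← mul_assoc, ← Complex.ofReal_mul, Real.mul_self_sqrt hs0.le]
      simp
    rw [this, norm_mul, mul_pow, Complex.norm_real, nea, sq_abs, Real.sq_sqrt hs0.le]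
  simp only [e1, e2, e3] at base
  rw [icm] at base
  have h3 := mll base (show 0 ≤ β / s by positivity)
  rw [Finset.mul_sum] at h3
  calc _ = β / s * (L / β * (s * ∫ y, ‖f y‖ ^ 2) -
        s * (β⁻¹ * ∫ y, (‖deriv f y‖ ^ 2 + β ^ 2 * (y - c) ^ 2 * ‖f y‖ ^ 2))) := by field_simp
    _ ≤ _ := h3
    _ = _ := by
      grind
lemma slice_x {v : Rp → ℂ} (hv : Differentiable ℝ v) (x y : ℝ) :
    HasDerivAt (fun x => v (x, y)) (dX v (x, y)) x :=
  (hv (x, y)).hasFDerivAt.comp_hasDerivAt x ((hasDerivAt_id x).prodMk (hasDerivAt_const x y))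
lemma slice_y {v : Rp → ℂ} (hv : Differentiable ℝ v) (x y : ℝ) :
    HasDerivAt (fun y => v (x, y)) (dY v (x, y)) y :=
  (hv (x, y)).hasFDerivAt.comp_hasDerivAt y ((hasDerivAt_const y x).prodMk (hasDerivAt_id y))
lemma sm_diff {E : Type*} [NormedAddCommGroup E] [NormedSpace ℝ E] {v : Rp → E} (hv : Sm v) : Differentiable ℝ v :=
  hv.differentiable (by simp)
lemma sm_fd {E : Type*} [NormedAddCommGroup E] [NormedSpace ℝ E] {v : Rp → E} (hv : Sm v) (e : Rp) :
    Sm (fun p => fderiv ℝ v p e) :=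
  (hv.fderiv_right (m := (⊤ : ℕ∞)) (by norm_cast)).clm_apply contDiff_const
lemma sm_dX {v : Rp → ℂ} (hv : Sm v) : Sm (dX v) := sm_fd hv _
lemma sm_dY {v : Rp → ℂ} (hv : Sm v) : Sm (dY v) := sm_fd hv _
lemma cs_fd {E : Type*} [NormedAddCommGroup E] [NormedSpace ℝ E] {v : Rp → E} (hc : Hc v) (e : Rp) :
    Hc (fun p => fderiv ℝ v p e) := hc.fderiv_apply ℝ e
lemma cs_dX {v : Rp → ℂ} (hc : Hc v) : Hc (dX v) := cs_fd hc _
lemma cs_dY {v : Rp → ℂ} (hc : Hc v) : Hc (dY v) := cs_fd hc _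
lemma cs_slice_x {E : Type*} [Zero E] [TopologicalSpace E] {v : Rp → E} (hc : Hc v) (y : ℝ) :
    Hc (fun x => v (x, y)) :=
  hc.comp_isClosedEmbedding ⟨isEmbedding_prodMkLeft y, by
    have : Set.range (fun x : ℝ => (x, y)) = {p : Rp | p.2 = y} := by
      grind
    rw [this]; exact isClosed_eq continuous_snd continuous_const⟩
lemma cs_box {v : Rp → ℂ} (hc : Hc v) :
    ∃ R > 0, ∀ x y, (R < |x| ∨ R < |y|) → v (x, y) = 0 := by
  obtain ⟨R, hR0, hR⟩ := hc.isCompact.isBounded.subset_closedBall_lt 0 (0 : Rp)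
  refine ⟨R, hR0, fun x y h => ?_⟩
  by_contra hne
  have := hR (subset_tsupport v (Function.mem_support.2 hne))
  rw [mem_closedBall_zero_iff, Prod.norm_def, sup_le_iff] at this
  simp only [nea] at this
  rcases h with h | h <;> linarith [this.1, this.2]
def xh (w : Rp → ℂ) (p : Rp) : ℂ :=
  ∫ x : ℝ, Complex.exp (↑(-2 * π * x * p.1) * Ii) * w (x, p.2)
open FourierTransform in
lemma xh_eq (w : Rp → ℂ) (ζ y : ℝ) : xh w (ζ, y) = 𝓕 (fun x => w (x, y)) ζ := by
  rw [Real.fourier_real_eq_integral_exp_smul]; rfl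
lemma xh_box {w : Rp → ℂ} (hc : Hc w) : ∃ R > 0,
    (∀ x y, (R < |x| ∨ R < |y|) → w (x, y) = 0) ∧
    ∀ p, xh w p = ∫ x in Set.Icc (-R) R, Complex.exp (↑(-2 * π * x * p.1) * Ii) * w (x, p.2) := by
  obtain ⟨R, hR0, hR⟩ := cs_box hc
  refine ⟨R, hR0, hR, fun p => ?_⟩
  rw [xh, setIntegral_eq_integral_of_forall_compl_eq_zero]
  grind
lemma xh_cont {w : Rp → ℂ} (hw : Continuous w) (hc : Hc w) : Continuous (xh w) := by
  obtain ⟨R, hR0, hR, h⟩ := xh_box hc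
  rw [funext h]
  apply continuous_parametric_integral_of_continuous _ isCompact_Icc
  fun_prop
lemma xh_zero {w : Rp → ℂ} (hc : Hc w) : ∃ R > 0, ∀ ζ y, R < |y| → xh w (ζ, y) = 0 := by
  obtain ⟨R, hR0, hR⟩ := cs_box hc
  refine ⟨R, hR0, fun ζ y h => ?_⟩
  simp [xh, hR _ y (Or.inr h)]
lemma xh_cs {w : Rp → ℂ} (hc : Hc w) (ζ : ℝ) :
    Hc (fun y => xh w (ζ, y)) := by
  obtain ⟨R, hR0, hR⟩ := xh_zero hc
  refine HasCompactSupport.intro (isCompact_Icc (a := -R) (b := R)) fun y hy => hR ζ y ?_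
  grind
open FourierTransform in
lemma xh_dX {w : Rp → ℂ} (hw : Sm w) (hc : Hc w) (ζ y : ℝ) :
    xh (dX w) (ζ, y) = 2 * π * Ii * ζ * xh w (ζ, y) := by
  have hd := fun x => slice_x (sm_diff hw) x y
  have e := funext fun x => (hd x).deriv
  have c2 := (sm_dX hw).continuous
  have := congrFun (Real.fourier_deriv (f := fun x => w (x, y))
    (icc (by fun_prop) (cs_slice_x hc y))
    (fun x => (hd x).differentiableAt)
    (by rw [e]; exact (icc (by fun_prop) (cs_slice_x (cs_dX hc) y)))) ζ
  rw [e] at this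
  rw [xh_eq, xh_eq, this, smul_eq_mul]
lemma xh_dY {w : Rp → ℂ} (hw : Sm w) (hc : Hc w) (ζ y : ℝ) :
    HasDerivAt (fun y => xh w (ζ, y)) (xh (dY w) (ζ, y)) y := by
  obtain ⟨R', hR0', hR', h'⟩ := xh_box (cs_dY hc)
  have c2 := (sm_dY hw).continuous
  obtain ⟨M, hM⟩ := (cs_dY hc).exists_bound_of_continuous c2
  refine (hasDerivAt_integral_of_dominated_loc_of_deriv_le (s := Set.univ) (μ := volume)
    (F := fun y x => Complex.exp (↑(-2 * π * x * ζ) * Ii) * w (x, y))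
    (F' := fun y x => Complex.exp (↑(-2 * π * x * ζ) * Ii) * dY w (x, y))
    (bound := (Set.Icc (-R') R').indicator (fun _ => M)) univ_mem ?_ ?_ ?_ ?_ ?_ ?_).2
  · exact evf fun y => Continuous.aestronglyMeasurable (by fun_prop)
  · exact icc (by fun_prop) (cs_slice_x hc y).mul_left
  · fun_prop
  · refine evf fun x y _ => ?_
    rw [norm_mul, Complex.norm_exp_ofReal_mul_I, one_mul]
    by_cases hx : x ∈ Set.Icc (-R') R'
    · rw [Set.indicator_of_mem hx]; grind
    · rw [Set.indicator_of_notMem hx, hR', norm_zero]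
      grind
  · rw [integrable_indicator_iff measurableSet_Icc]
    simp
  · exact evf fun x y _ => (slice_y (sm_diff hw) x y).const_mul _
lemma nsq_cs {α : Type*} [TopologicalSpace α] {v : α → ℂ} (hc : Hc v) :
    Hc (fun y => ‖v y‖ ^ 2) :=
  hc.comp_left (g := fun z : ℂ => ‖z‖ ^ 2) (by simp)
lemma xh_planch {w : Rp → ℂ} (hw : Sm w) (hc : Hc w) :
    Integrable (fun p => ‖xh w p‖ ^ 2) ∧ ∫ p, ‖xh w p‖ ^ 2 = ∫ p, ‖w p‖ ^ 2 := by
  have c1 := hw.continuous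
  have c2 := xh_cont c1 hc
  have hS : ∀ y, ∃ s : SchwartzMap ℝ ℂ, (∀ x, s x = w (x, y)) ∧ ∀ ζ, (FourierTransform.fourier s) ζ = xh w (ζ, y) := by
    intro y
    refine ⟨(cs_slice_x hc y).toSchwartzMap (hw.comp (by fun_prop)), fun x => rfl, fun ζ => ?_⟩
    rw [xh_eq]; rfl
  have i1 : ∀ y, Integrable (fun ζ => ‖xh w (ζ, y)‖ ^ 2) := by
    intro y
    obtain ⟨s, hs1, hs2⟩ := hS y
    simp_rw [← hs2]
    have := (FourierTransform.fourier s).memLp 2 (μ := volume)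
    rwa [memLp_two_iff_integrable_sq_norm this.1] at this
  have e1 : ∀ y, ∫ ζ, ‖xh w (ζ, y)‖ ^ 2 = ∫ x, ‖w (x, y)‖ ^ 2 := by
    intro y
    obtain ⟨s, hs1, hs2⟩ := hS y
    simp_rw [← hs2, ← hs1]
    exact SchwartzMap.integral_norm_sq_fourier s
  have iw : Integrable (fun p => ‖w p‖ ^ 2) :=
    icc (by fun_prop) (nsq_cs hc)
  rw [Measure.volume_eq_prod] at iw ⊢
  have I : Integrable (fun p => ‖xh w p‖ ^ 2) ((volume : Measure ℝ).prod volume) := by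
    rw [integrable_prod_iff' (Continuous.aestronglyMeasurable (by fun_prop))]
    refine ⟨evf i1, ?_⟩
    simp
    simp_rw [e1]
    exact iw.integral_prod_right
  refine ⟨I, ?_⟩
  rw [integral_prod_symm _ I, integral_prod_symm _ iw]
  exact integral_congr_ae (evf e1)
lemma l2_norm_sq {α : Type*} [MeasurableSpace α] {μ : Measure α} {f : α → ℂ} (hf : MemLp f 2 μ) :
    ‖hf.toLp f‖ ^ 2 = ∫ x, ‖f x‖ ^ 2 ∂μ := by
  rw [Lp.norm_toLp, hf.eLpNorm_eq_integral_rpow_norm (by norm_num) (by norm_num)]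
  rw [ENNReal.toReal_ofReal (by positivity), ← Real.rpow_natCast, ← Real.rpow_mul (by positivity)]
  norm_num
lemma l2_inner {α : Type*} [MeasurableSpace α] {μ : Measure α} {f g : α → ℂ} (hf : MemLp f 2 μ) (hg : MemLp g 2 μ) :
    inner ℂ (hf.toLp f) (hg.toLp g) = ∫ x, starRingEnd ℂ (f x) * g x ∂μ := by
  apply integral_congr_ae
  filter_upwards [hf.coeFn_toLp, hg.coeFn_toLp] with y h1 h2
  rw [h1, h2]
  simp [mul_comm]
lemma l2_cs {α : Type*} [MeasurableSpace α] {μ : Measure α} {f g : α → ℂ} (hf : MemLp f 2 μ) (hg : MemLp g 2 μ) :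
    ‖∫ x, starRingEnd ℂ (f x) * g x ∂μ‖ ^ 2 ≤ (∫ x, ‖f x‖ ^ 2 ∂μ) * ∫ x, ‖g x‖ ^ 2 ∂μ := by
  rw [← l2_inner hf hg, ← l2_norm_sq hf, ← l2_norm_sq hg, ← mul_pow]
  gcongr
  exact norm_inner_le_norm _ _
lemma sH_cont (k : ℕ) : Continuous (fun p : ℝ × Rp => sH p.1 p.2.1 k p.2.2) := by
  unfold sH
  have := hF_cont k
  fun_prop
lemma sH_cont' (β c : ℝ) (k : ℕ) : Continuous (sH β c k) := by
  unfold sH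
  have := hF_cont k
  fun_prop
lemma sH_orth {β : ℝ} (hβ : 0 < β) (c : ℝ) (j k : ℕ) :
    Integrable (fun y => sH β c j y * sH β c k y) ∧
    ∫ y, sH β c j y * sH β c k y = if j = k then 1 else 0 := by
  have hs0 := Real.sqrt_pos.2 hβ
  have e : ∀ y, sH β c j y * sH β c k y = √β * (fun t => hF j t * hF k t) (√β * (y - c)) := by
    intro y; simp only [sH]
    grind
  simp_rw [e]
  constructor
  · have := (hF_int2 j k).comp_mul_left' hs0.ne'
    exact (this.comp_sub_right c).const_mul _
  · rw [icm, integral_sub_right_eq_self (fun y => (fun t => hF j t * hF k t) (√β * y)) c,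
      Measure.integral_comp_mul_left (fun t => hF j t * hF k t) (√β), hF_orth, smul_eq_mul, abs_of_pos (inv_pos.2 hs0), ← mul_assoc,
      mul_inv_cancel₀ hs0.ne', one_mul]
def lF (B ζ : ℝ) (k : ℕ) (p : Rp) : ℂ :=
  Complex.exp (↑(2 * π * p.1 * ζ) * Ii) * (sH |B| (-(2 * π * ζ) / B) k p.2 : ℂ)
lemma lF_cont (B : ℝ) (k : ℕ) : Continuous (fun q : ℝ × Rp => lF B q.1 k q.2) := by
  unfold lF
  have := sH_cont k
  fun_prop
lemma lF_cont' (B ζ : ℝ) (k : ℕ) : Continuous (lF B ζ k) :=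
  (lF_cont B k).comp (f := fun p : Rp => (ζ, p)) (by fun_prop)
lemma lF_norm (B ζ : ℝ) (k : ℕ) (p : Rp) : ‖lF B ζ k p‖ ^ 2 = sH |B| (-(2 * π * ζ) / B) k p.2 ^ 2 := by
  rw [lF, norm_mul, Complex.norm_exp_ofReal_mul_I, one_mul, Complex.norm_real, nea, sq_abs]
lemma lF_dens {B : ℝ} (hB : B ≠ 0) (k : ℕ) (p : Rp) :
    Integrable (fun ζ => ‖lF B ζ k p‖ ^ 2) ∧ ∫ ζ, ‖lF B ζ k p‖ ^ 2 = |B| / (2 * π) := by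
  have hβ := abs_pos.2 hB
  have hs0 := Real.sqrt_pos.2 hβ
  set d : ℝ := √|B| * (2 * π) / B with hd
  have hd0 : d ≠ 0 := by positivity
  have e : ∀ ζ, ‖lF B ζ k p‖ ^ 2 = √|B| * (fun t => hF k t * hF k t) (√|B| * p.2 + d * ζ) := by
    intro ζ
    rw [lF_norm, sH, mul_pow, Real.sq_sqrt hs0.le]
    grind
  simp_rw [e]
  constructor
  · have := ((hF_int2 k k).comp_add_left (√|B| * p.2)).comp_mul_left' hd0
    fun_prop
  · rw [icm, Measure.integral_comp_mul_left (fun ζ => (fun t => hF k t * hF k t) (√|B| * p.2 + ζ)) d,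
      integral_add_left_eq_self (fun t => hF k t * hF k t), hF_orth, hd, smul_eq_mul]
    simp only [if_true, abs_inv, abs_div, abs_mul, abs_of_pos hs0, abs_of_pos pi_pos, abs_two]
    field_simp
lemma lF_pair {v : Rp → ℂ} (hv : Continuous v) (hc : Hc v) (B ζ : ℝ) (k : ℕ) :
    ∫ p, starRingEnd ℂ (lF B ζ k p) * v p = ∫ y, (sH |B| (-(2 * π * ζ) / B) k y : ℂ) * xh v (ζ, y) := by
  have c2 := lF_cont' B ζ k
  have I : Integrable (fun p => starRingEnd ℂ (lF B ζ k p) * v p) (volume : Measure (Rp)) :=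
    icc (by fun_prop) hc.mul_left
  rw [Measure.volume_eq_prod] at I ⊢
  rw [integral_prod_symm _ I]
  congr 1; ext y
  rw [xh, ← icm]
  congr 1; ext x
  simp only [lF, map_mul, Complex.conj_ofReal]
  rw [← Complex.exp_conj, map_mul, Complex.conj_I, Complex.conj_ofReal]
  have : (↑(2 * π * x * ζ) * -Ii : ℂ) = ↑(-2 * π * x * ζ) * Ii := by simp
  rw [this]; ring
lemma sH_memLp {β : ℝ} (hβ : 0 < β) (c : ℝ) (k : ℕ) : MemLp (fun y => (sH β c k y : ℂ)) 2 := by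
  have h : MemLp (sH β c k) 2 := by
    rw [memLp_two_iff_integrable_sq (sH_cont' β c k).aestronglyMeasurable]
    simpa [sq] using (sH_orth hβ c k k).1
  exact h.ofReal
theorem landau_upper {v : Rp → ℂ} (hv : Sm v) (hc : Hc v)
    {B : ℝ} (hB : B ≠ 0) (L : ℝ) (K : ℕ) (hK : L ≤ (2 * K + 1) * |B|) :
    (∀ k, Integrable (fun ζ => ‖∫ p, starRingEnd ℂ (lF B ζ k p) * v p‖ ^ 2)) ∧
    L * (∫ p, ‖v p‖ ^ 2) - (∫ p, (‖-Ii * dX v p + ((B * p.2 : ℝ) : ℂ) * v p‖ ^ 2 + ‖-Ii * dY v p‖ ^ 2)) ≤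
      ∑ k ∈ Finset.range K, (L - (2 * k + 1) * |B|) * ∫ ζ, ‖∫ p, starRingEnd ℂ (lF B ζ k p) * v p‖ ^ 2 := by
  have hβ : 0 < |B| := abs_pos.2 hB
  have cv := hv.continuous
  have cx := xh_cont cv hc
  let w : Rp → ℂ := fun p => -Ii * dX v p + ((B * p.2 : ℝ) : ℂ) * v p
  have hw : Sm w := by
    have h1 := sm_dX hv
    have h2 : Sm (fun p : Rp => ((B * p.2 : ℝ) : ℂ)) :=
      Complex.ofRealCLM.contDiff.comp (contDiff_const.mul contDiff_snd)
    fun_prop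
  have hwc : Hc w := (cs_dX hc).mul_left.add hc.mul_left
  have hyw := sm_dY hv
  have hywc := cs_dY hc
  obtain ⟨I1, E1⟩ := xh_planch hv hc
  obtain ⟨I2, E2⟩ := xh_planch hw hwc
  obtain ⟨I3, E3⟩ := xh_planch hyw hywc
  have xw : ∀ ζ y, xh w (ζ, y) = ((2 * π * ζ + B * y : ℝ) : ℂ) * xh v (ζ, y) := by
    intro ζ y
    have c2 := (sm_dX hv).continuous
    have i1 : Integrable (fun x : ℝ => Complex.exp (↑(-2 * π * x * ζ) * Ii) * dX v (x, y)) :=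
      icc (by fun_prop) (cs_slice_x (cs_dX hc) y).mul_left
    have i2 : Integrable (fun x : ℝ => Complex.exp (↑(-2 * π * x * ζ) * Ii) * v (x, y)) :=
      icc (by fun_prop) (cs_slice_x hc y).mul_left
    have : xh w (ζ, y) = -Ii * xh (dX v) (ζ, y) + ((B * y : ℝ) : ℂ) * xh v (ζ, y) := by
      simp only [xh]
      rw [← icm, ← icm, ← integral_add (i1.const_mul _) (i2.const_mul _)]
      grind
    rw [this, xh_dX hv hc]
    push_cast
    linear_combination (-(2 * π * ζ) * xh v (ζ, y)) * Complex.I_mul_I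
  have J1 := I1.integral_prod_left
  have J2 := I2.integral_prod_left
  have J3 := I3.integral_prod_left
  have slice : ∀ ζ, L * (∫ y, ‖xh v (ζ, y)‖ ^ 2) - ((∫ y, ‖xh w (ζ, y)‖ ^ 2) + ∫ y, ‖xh (dY v) (ζ, y)‖ ^ 2) ≤
      ∑ k ∈ Finset.range K, (L - (2 * k + 1) * |B|) * ‖∫ p, starRingEnd ℂ (lF B ζ k p) * v p‖ ^ 2 := by
    intro ζ
    have hd : ∀ y, HasDerivAt (fun y => xh v (ζ, y)) (xh (dY v) (ζ, y)) y := fun y => xh_dY hv hc ζ y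
    have ed : deriv (fun y => xh v (ζ, y)) = fun y => xh (dY v) (ζ, y) := funext fun y => (hd y).deriv
    have cd := xh_cont hyw.continuous hywc
    have cw := xh_cont hw.continuous hwc
    have hf1 : ContDiff ℝ 1 (fun y => xh v (ζ, y)) := by
      rw [contDiff_one_iff_deriv]
      refine ⟨fun y => (hd y).differentiableAt, ?_⟩
      rw [ed]; fun_prop
    have := osc_scaled hf1 (xh_cs hc ζ) hβ (-(2 * π * ζ) / B) L K hK
    simp_rw [lF_pair cv hc]
    refine le_trans (le_of_eq ?_) this
    rw [ed, add_comm, ← integral_add]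
    · congr 2; ext y
      rw [xw, norm_mul, mul_pow, Complex.norm_real, nea, sq_abs, sq_abs]
      grind
    · exact icc (by fun_prop) (nsq_cs (xh_cs hywc ζ))
    · exact icc (by fun_prop) (nsq_cs (xh_cs hwc ζ))
  have IK : ∀ k, Integrable (fun ζ => ‖∫ p, starRingEnd ℂ (lF B ζ k p) * v p‖ ^ 2) := by
    intro k
    refine J1.mono' ?_ ?_
    · have : Continuous (fun ζ => ∫ p, starRingEnd ℂ (lF B ζ k p) * v p) := by
        have e : ∀ ζ, ∫ p, starRingEnd ℂ (lF B ζ k p) * v p = ∫ p in tsupport v, starRingEnd ℂ (lF B ζ k p) * v p := by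
          intro ζ
          rw [setIntegral_eq_integral_of_forall_compl_eq_zero]
          intro p hp
          rw [izt hp, mul_zero]
        simp_rw [e]
        apply continuous_parametric_integral_of_continuous _ hc.isCompact
        have := lF_cont B k
        fun_prop
      exact Continuous.aestronglyMeasurable (by fun_prop)
    · refine evf fun ζ => ?_
      rw [lF_pair cv hc, Real.norm_of_nonneg (by positivity)]
      have hm := cc_memLp (by fun_prop) (xh_cs hc ζ)
      have := l2_cs (sH_memLp hβ (-(2 * π * ζ) / B) k) hm
      simp only [Complex.conj_ofReal] at this
      refine this.trans (le_of_eq ?_)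
      have h1 : ∀ y, ‖(sH |B| (-(2 * π * ζ) / B) k y : ℂ)‖ ^ 2 = sH |B| (-(2 * π * ζ) / B) k y * sH |B| (-(2 * π * ζ) / B) k y := by
        intro y; rw [Complex.norm_real, nea, sq_abs, sq]
      simp_rw [h1]
      rw [(sH_orth hβ _ k k).2]; simp
  refine ⟨IK, ?_⟩
  have main := integral_mono ((J1.const_mul L).sub (J2.add J3))
    (integrable_finsetSum (Finset.range K) fun k _ => (IK k).const_mul (L - (2 * k + 1) * |B|)) (fun ζ => slice ζ)
  rw [integral_finsetSum _ (fun k _ => (IK k).const_mul _)] at main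
  simp_rw [icm] at main
  refine le_trans (le_of_eq ?_) main
  have e1 : ∫ ζ, ((L * ∫ y, ‖xh v (ζ, y)‖ ^ 2) - ((∫ y, ‖xh w (ζ, y)‖ ^ 2) + ∫ y, ‖xh (dY v) (ζ, y)‖ ^ 2))
     = L * (∫ p, ‖xh v p‖ ^ 2) - ((∫ p, ‖xh w p‖ ^ 2) + ∫ p, ‖xh (dY v) p‖ ^ 2) := by
    have J23 : Integrable (fun ζ => (∫ y, ‖xh w (ζ, y)‖ ^ 2) + ∫ y, ‖xh (dY v) (ζ, y)‖ ^ 2) := J2.add J3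
    rw [integral_sub (J1.const_mul L) J23, integral_add J2 J3, icm,
      Measure.volume_eq_prod, integral_prod _ I1, integral_prod _ I2, integral_prod _ I3]
  refine Eq.trans ?_ e1.symm
  rw [E1, E2, E3, ← integral_add]
  · simp [w]
  · have := hw.continuous
    exact icc (by fun_prop) (nsq_cs hwc)
  · have := hyw.continuous
    exact icc (by fun_prop) (nsq_cs hywc)
lemma sT_cd : Sm Real.smoothTransition := Real.smoothTransition.contDiff
lemma sT_deriv_zero {x : ℝ} (hx : x < 0 ∨ 1 < x) : deriv Real.smoothTransition x = 0 := by
  rcases hx with hx | hx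
  · have : Real.smoothTransition =ᶠ[nhds x] fun _ => 0 := by
      filter_upwards [Iio_mem_nhds hx] with t ht
      exact Real.smoothTransition.zero_of_nonpos (le_of_lt ht)
    rw [this.deriv_eq]; simp
  · have : Real.smoothTransition =ᶠ[nhds x] fun _ => 1 := by
      filter_upwards [Ioi_mem_nhds hx] with t ht
      exact Real.smoothTransition.one_of_one_le (le_of_lt ht)
    rw [this.deriv_eq]; simp
lemma sT_bound : ∃ M > 0, ∀ x, |π / 2 * deriv Real.smoothTransition x| ≤ M := by
  have hc := sT_cd.continuous_deriv (by simp)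
  obtain ⟨C, hC⟩ := isCompact_Icc.exists_bound_of_continuousOn (s := Set.Icc (0 : ℝ) 1) hc.continuousOn
  have hC0 := (norm_nonneg _).trans (hC 0 (by simp))
  refine ⟨π / 2 * C + 1, by positivity, fun x => ?_⟩
  by_cases hx : x ∈ Set.Icc (0 : ℝ) 1
  · have := hC x hx
    rw [abs_mul, abs_of_pos (by positivity)]
    have h2 : π / 2 * |deriv Real.smoothTransition x| ≤ π / 2 * C := by gcongr; exact this
    linarith
  · rw [sT_deriv_zero (by simp only [Set.mem_Icc, not_and_or, not_le] at hx; exact hx)]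
    simp; positivity
def tA (c w x : ℝ) : ℝ := π / 2 * Real.smoothTransition ((x - c) / w)
def tA' (c w x : ℝ) : ℝ := π / 2 * deriv Real.smoothTransition ((x - c) / w) * w⁻¹
lemma tA_deriv (c w x : ℝ) : HasDerivAt (tA c w) (tA' c w x) x := by
  have h1 : HasDerivAt (fun x => (x - c) / w) (w⁻¹) x := by
    simpa using ((hasDerivAt_id x).sub_const c).div_const w
  have h2 : HasDerivAt Real.smoothTransition (deriv Real.smoothTransition ((x - c) / w)) ((x - c) / w) :=
    (sT_cd.differentiable (by simp)).differentiableAt.hasDerivAt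
  have := (h2.comp x h1).const_mul (π / 2)
  refine this.congr_deriv ?_
  rw [tA']; ring
lemma tA_left {c w x : ℝ} (hw : 0 < w) (h : x ≤ c) : tA c w x = 0 := by
  rw [tA, Real.smoothTransition.zero_of_nonpos, mul_zero]
  exact div_nonpos_of_nonpos_of_nonneg (by linarith) hw.le
lemma tA_right {c w x : ℝ} (hw : 0 < w) (h : c + w ≤ x) : tA c w x = π / 2 := by
  rw [tA, Real.smoothTransition.one_of_one_le, mul_one]
  rw [le_div_iff₀ hw]; linarith
lemma tA'_ne {c w x : ℝ} (hw : 0 < w) (h : tA' c w x ≠ 0) : c ≤ x ∧ x ≤ c + w := by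
  by_contra hh
  apply h
  rw [tA', sT_deriv_zero]; · simp
  rw [not_and_or, not_le, not_le] at hh
  rcases hh with hh | hh
  · left; exact div_neg_of_neg_of_pos (by linarith) hw
  · right; rw [lt_div_iff₀ hw]; linarith
lemma tA_smooth (c w : ℝ) : Sm (tA c w) := by
  unfold tA
  fun_prop
def gB (c w : ℕ → ℝ) (n : ℕ) (x : ℝ) : ℝ := sin (tA (c n) (w n) x) * cos (tA (c (n+1)) (w (n+1)) x)
def gB' (c w : ℕ → ℝ) (n : ℕ) (x : ℝ) : ℝ :=
  cos (tA (c n) (w n) x) * tA' (c n) (w n) x * cos (tA (c (n+1)) (w (n+1)) x) +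
   sin (tA (c n) (w n) x) * (- sin (tA (c (n+1)) (w (n+1)) x) * tA' (c (n+1)) (w (n+1)) x)
lemma gB_deriv (c w : ℕ → ℝ) (n : ℕ) (x : ℝ) : HasDerivAt (gB c w n) (gB' c w n x) x :=
  (tA_deriv (c n) (w n) x).sin.mul (tA_deriv (c (n+1)) (w (n+1)) x).cos
lemma gB_smooth (c w : ℕ → ℝ) (n : ℕ) : Sm (gB c w n) :=
  (tA_smooth _ _).sin.mul (tA_smooth _ _).cos
lemma gB_ne {c w : ℕ → ℝ} (hw : ∀ n, 0 < w n) {n : ℕ} {x : ℝ} (h : gB c w n x ≠ 0) : c n ≤ x ∧ x ≤ c (n+1) + w (n+1) := by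
  constructor
  · by_contra hh; apply h; rw [gB, tA_left (hw n) (by linarith)]; simp
  · by_contra hh; apply h; rw [gB, tA_right (hw (n+1)) (by linarith)]; simp
lemma gB_one {c w : ℕ → ℝ} (hw : ∀ n, 0 < w n) {n : ℕ} {x : ℝ} (h1 : c n + w n ≤ x) (h2 : x ≤ c (n+1)) : gB c w n x = 1 := by
  rw [gB, tA_right (hw n) h1, tA_left (hw _) h2]; simp
lemma gB_sum {c w : ℕ → ℝ} (hw : ∀ n, 0 < w n) (hc : ∀ n, c n + w n < c (n+1)) (m : ℕ) (x : ℝ) : ∑ n ∈ Finset.range m, gB c w n x ^ 2 =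
    sin (tA (c 0) (w 0) x) ^ 2 - sin (tA (c m) (w m) x) ^ 2 := by
  induction m with
  | zero => simp
  | succ m ih =>
    rw [Finset.sum_range_succ, ih, gB, mul_pow, Real.cos_sq']
    rcases le_total x (c (m+1)) with h | h
    · rw [tA_left (hw _) h]; simp
    · rw [tA_right (hw m) (by linarith [hc m])]; simp
lemma gB_sum_le {c w : ℕ → ℝ} (hw : ∀ n, 0 < w n) (hc : ∀ n, c n + w n < c (n+1)) (m : ℕ) (x : ℝ) : ∑ n ∈ Finset.range m, gB c w n x ^ 2 ≤ 1 := by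
  rw [gB_sum hw hc]
  nlinarith [Real.sin_sq_le_one (tA (c 0) (w 0) x)]
lemma gB_sum_one {c w : ℕ → ℝ} (hw : ∀ n, 0 < w n) (hc : ∀ n, c n + w n < c (n+1)) {m : ℕ} {x : ℝ} (h1 : c 0 + w 0 ≤ x) (h2 : x ≤ c m) :
    ∑ n ∈ Finset.range m, gB c w n x ^ 2 = 1 := by
  rw [gB_sum hw hc, tA_right (hw 0) h1, tA_left (hw m) h2]; simp
lemma gB'_sum {c w : ℕ → ℝ} (hw : ∀ n, 0 < w n) (hc : ∀ n, c n + w n < c (n+1)) {M : ℝ} (hM : ∀ x, |π / 2 * deriv Real.smoothTransition x| ≤ M) {D x : ℝ}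
    (hx : ∀ n, c n ≤ x → x ≤ c n + w n → 2 * M / w n ≤ D) (m : ℕ) :
    ∑ n ∈ Finset.range m, gB' c w n x ^ 2 ≤ D ^ 2 := by
  set θ : ℕ → ℝ := fun n => tA' (c n) (w n) x with hθ
  have b1 : ∀ n, gB' c w n x ^ 2 ≤ 2 * (θ n ^ 2 + θ (n+1) ^ 2) := by
    intro n
    have e : gB' c w n x = (cos (tA (c n) (w n) x) * cos (tA (c (n+1)) (w (n+1)) x)) * θ n -
      (sin (tA (c n) (w n) x) * sin (tA (c (n+1)) (w (n+1)) x)) * θ (n+1) := by rw [gB']; ring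
    rw [e]
    set p := cos (tA (c n) (w n) x) * cos (tA (c (n+1)) (w (n+1)) x)
    set q := sin (tA (c n) (w n) x) * sin (tA (c (n+1)) (w (n+1)) x)
    have hp : p ^ 2 ≤ 1 := by
      rw [mul_pow]; exact mul_le_one₀ (Real.cos_sq_le_one _) (sq_nonneg _) (Real.cos_sq_le_one _)
    have hq : q ^ 2 ≤ 1 := by
      rw [mul_pow]; exact mul_le_one₀ (Real.sin_sq_le_one _) (sq_nonneg _) (Real.sin_sq_le_one _)
    nlinarith [sq_nonneg (p * θ n + q * θ (n+1)), mlr hp (sq_nonneg (θ n)),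
      mlr hq (sq_nonneg (θ (n+1)))]
  have hmono : ∀ {k l : ℕ}, k < l → c k + w k < c l := by
    intro k l h
    induction l, h using Nat.le_induction with
    | base => exact hc k
    | succ l _ ih => linarith [hc l, hw l]
  have b2 : ∀ s : Finset ℕ, ∑ n ∈ s, θ n ^ 2 ≤ (D / 2) ^ 2 := by
    intro s
    by_cases h : ∃ n, θ n ≠ 0
    · obtain ⟨k, hk⟩ := h
      have hk' := tA'_ne (hw k) hk
      have h1 : ∀ n, n ≠ k → θ n = 0 := by
        intro n hn
        by_contra h3
        have h3' := tA'_ne (hw n) h3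
        rcases lt_or_gt_of_ne hn with h4 | h4
        · grind
        · grind
      have h2 : |θ k| ≤ D / 2 := by
        rw [hθ]; simp only [tA']
        rw [abs_mul, abs_inv, abs_of_pos (hw k), ← div_eq_mul_inv]
        have h5 := div_le_div_of_nonneg_right (hM ((x - c k) / w k)) (hw k).le
        grind
      calc ∑ n ∈ s, θ n ^ 2 ≤ ∑ n ∈ s, if n = k then θ k ^ 2 else 0 := by
            apply Finset.sum_le_sum; intro n _
            split_ifs with h5
            · rw [h5]
            · rw [h1 n h5]; simp
        _ ≤ θ k ^ 2 := by
            rw [Finset.sum_ite_eq']; split_ifs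
            · rfl
            · positivity
        _ ≤ _ := by rw [← sq_abs]; gcongr
    · push Not at h
      simp [h]; positivity
  have b3 : ∑ n ∈ Finset.range m, θ (n+1) ^ 2 = ∑ n ∈ (Finset.range m).image (· + 1), θ n ^ 2 := by simp
  calc _ ≤ ∑ n ∈ Finset.range m, 2 * (θ n ^ 2 + θ (n+1) ^ 2) := Finset.sum_le_sum fun n _ => b1 n
    _ ≤ _ := by
      rw [← Finset.mul_sum, Finset.sum_add_distrib, b3]
      grind
lemma prod_grad {f g : ℝ → ℝ} {f' g' : ℝ} {p : Rp} (hf : HasDerivAt f f' p.2) (hg : HasDerivAt g g' p.1) :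
    dXr (fun p => f p.2 * g p.1) p = f p.2 * g' ∧ dYr (fun p => f p.2 * g p.1) p = f' * g p.1 := by
  have h := (hf.hasFDerivAt.comp p hasFDerivAt_snd).mul (hg.hasFDerivAt.comp p hasFDerivAt_fst)
  have e : fderiv ℝ (fun p : Rp => f p.2 * g p.1) p = _ := h.fderiv
  simp only [dXr, dYr]
  rw [e]
  constructor <;> simp [mul_comm]
structure PUn (C a R : ℝ) (s : Finset (ℕ × ℕ)) (X Y : ℕ × ℕ → ℝ) (χ : ℕ × ℕ → Rp → ℝ) : Prop where
  pos : ∀ i, 0 < Y i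
  sm : ∀ i, Sm (χ i)
  sup : ∀ i, tsupport (χ i) ⊆ Set.Icc (X i) (X i + 3 * a * Y i) ×ˢ Set.Icc (Y i) (Y i + 3 * a * Y i)
  le1 : ∀ p, ∑ i ∈ s, χ i p ^ 2 ≤ 1
  eq1 : ∀ p : Rp, |p.1| ≤ R → R⁻¹ ≤ p.2 → p.2 ≤ R → ∑ i ∈ s, χ i p ^ 2 = 1
  grad : ∀ p : Rp, 0 < p.2 → ∑ i ∈ s, (dXr (χ i) p ^ 2 + dYr (χ i) p ^ 2) ≤ C / (a * p.2) ^ 2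
  mass : ∀ i, (a * Y i) ^ 2 / 4 ≤ ∫ p, χ i p ^ 2
theorem part_exists : ∃ C > 0, ∀ a R : ℝ, 0 < a → a ≤ 1 → 0 < R → ∃ s X Y χ, PUn C a R s X Y χ := by
  obtain ⟨M, hM0, hM⟩ := sT_bound
  refine ⟨300 * M ^ 2, by positivity, fun a R ha ha1 hR => ?_⟩
  set y0 := (2 * R)⁻¹ with hy0
  have hy0p : 0 < y0 := by positivity
  let cy : ℕ → ℝ := fun n => y0 * (1 + a) ^ n
  let wy : ℕ → ℝ := fun n => a * cy n / 2
  have hcy0 : ∀ n, 0 < cy n := fun n => by positivity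
  let cx : ℕ → ℕ → ℝ := fun j n => -R - a * cy j + a * cy j * n
  let wx : ℕ → ℕ → ℝ := fun j _ => a * cy j / 2
  have hwy : ∀ n, 0 < wy n := fun n => by have := hcy0 n; positivity
  have hwx : ∀ j n, 0 < wx j n := fun j n => by have := hcy0 j; positivity
  have hcyS : ∀ n, cy (n+1) = cy n * (1 + a) := fun n => by simp only [cy, pow_succ]; ring
  have hcy : ∀ n, cy n + wy n < cy (n+1) := fun n => by
    have := mul_pos ha (hcy0 n)
    rw [hcyS]; simp only [wy]; linarith
  have hcx : ∀ j n, cx j n + wx j n < cx j (n+1) := fun j n => by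
    have := mul_pos ha (hcy0 j)
    simp only [cx, wx]; push_cast; linarith
  obtain ⟨m, hm⟩ : ∃ m : ℕ, R ≤ cy m := by
    obtain ⟨m, hm⟩ := pow_unbounded_of_one_lt (R / y0) (by linarith : 1 < 1 + a)
    refine ⟨m, ?_⟩
    rw [div_lt_iff₀ hy0p] at hm
    simp only [cy]; linarith
  have hcymono : ∀ n, y0 ≤ cy n := fun n => by
    simp only [cy]; nlinarith [one_le_pow₀ (by linarith : 1 ≤ 1 + a) (n := n)]
  obtain ⟨m', hm'⟩ : ∃ m' : ℕ, ∀ j, R ≤ cx j m' := by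
    obtain ⟨m', hm'⟩ := exists_nat_gt (2 * R / (a * y0) + 1)
    refine ⟨m', fun j => ?_⟩
    have h1 : 2 * R / (a * y0) < m' - 1 := by linarith
    rw [div_lt_iff₀ (by positivity)] at h1
    have h2 : (m' - 1 : ℝ) * (a * y0) ≤ (m' - 1) * (a * cy j) := by
      have : (0 : ℝ) ≤ m' - 1 := by
        have : 0 ≤ 2 * R / (a * y0) := by positivity
        linarith
      gcongr; exact hcymono j
    linarith
  let χ : ℕ × ℕ → Rp → ℝ := fun i p => gB cy wy i.1 p.2 * gB (cx i.1) (wx i.1) i.2 p.1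
  have sm : ∀ i, Sm (χ i) := fun i =>
    ((gB_smooth _ _ _).comp contDiff_snd).mul ((gB_smooth _ _ _).comp contDiff_fst)
  have sup : ∀ i, tsupport (χ i) ⊆ Set.Icc (cx i.1 i.2) (cx i.1 i.2 + 3 * a * cy i.1) ×ˢ
      Set.Icc (cy i.1) (cy i.1 + 3 * a * cy i.1) := by
    intro i
    refine closure_minimal ?_ (isClosed_Icc.prod isClosed_Icc)
    intro p hp
    have h1 := gB_ne hwy (left_ne_zero_of_mul hp)
    have h2 := gB_ne (hwx i.1) (right_ne_zero_of_mul hp)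
    have h0 := hcy0 i.1
    have h3 : a * a * cy i.1 ≤ a * 1 * cy i.1 := by gcongr
    simp only [wy, hcyS] at h1
    grind
  refine ⟨Finset.range m ×ˢ Finset.range m', fun i => cx i.1 i.2, fun i => cy i.1, χ, ?_⟩
  have sumsq : ∀ p, ∑ i ∈ Finset.range m ×ˢ Finset.range m', χ i p ^ 2 = ∑ j ∈ Finset.range m,
      gB cy wy j p.2 ^ 2 * ∑ n ∈ Finset.range m', gB (cx j) (wx j) n p.1 ^ 2 := by
    intro p
    rw [Finset.sum_product]
    simp only [χ, mul_pow, Finset.mul_sum]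
  refine ⟨fun i => hcy0 _, sm, sup, fun p => ?_, fun p h1 h2 h3 => ?_, fun p hp => ?_, fun i => ?_⟩
  · rw [sumsq]
    refine le_trans (Finset.sum_le_sum fun j _ => ?_) (gB_sum_le hwy hcy m p.2)
    exact mul_le_of_le_one_right (sq_nonneg _) (gB_sum_le (hwx j) (hcx j) m' p.1)
  · rw [sumsq]
    rw [abs_le] at h1
    have : ∀ j, ∑ n ∈ Finset.range m', gB (cx j) (wx j) n p.1 ^ 2 = 1 := by
      intro j
      apply gB_sum_one (hwx j) (hcx j)
      · grind
      · linarith [hm' j]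
    simp only [this, mul_one]
    apply gB_sum_one hwy hcy
    · refine le_trans ?_ h2
      simp only [wy, cy, mul_one]
      have : R⁻¹ = 2 * y0 := by grind
      rw [this]; nlinarith
    · linarith
  · have hg : ∀ i, dXr (χ i) p = gB cy wy i.1 p.2 * gB' (cx i.1) (wx i.1) i.2 p.1 ∧
        dYr (χ i) p = gB' cy wy i.1 p.2 * gB (cx i.1) (wx i.1) i.2 p.1 := fun i =>
      prod_grad (gB_deriv _ _ _ _) (gB_deriv _ _ _ _)
    have key : ∀ j, cy j ≤ p.2 → p.2 ≤ cy (j+1) + wy (j+1) → 2 * M / (a * cy j / 2) ≤ 12 * M / (a * p.2) := by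
      intro j h1 h2
      rw [hcyS] at h2; simp only [wy, hcyS] at h2
      have h3 : a * a * cy j ≤ a * 1 * cy j := by gcongr
      have h4 : p.2 ≤ 3 * cy j := by nlinarith
      rw [div_le_div_iff₀ (by positivity) (by positivity)]
      have := mll h4 (by positivity)
      nlinarith
    have e : ∑ i ∈ Finset.range m ×ˢ Finset.range m', (dXr (χ i) p ^ 2 + dYr (χ i) p ^ 2) =
      ∑ j ∈ Finset.range m, (gB cy wy j p.2 ^ 2 * ∑ n ∈ Finset.range m', gB' (cx j) (wx j) n p.1 ^ 2 +
        gB' cy wy j p.2 ^ 2 * ∑ n ∈ Finset.range m', gB (cx j) (wx j) n p.1 ^ 2) := by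
      rw [Finset.sum_product]
      simp only [hg, mul_pow, Finset.mul_sum, Finset.sum_add_distrib]
    rw [e, Finset.sum_add_distrib]
    have s1 : ∑ j ∈ Finset.range m, gB cy wy j p.2 ^ 2 * ∑ n ∈ Finset.range m', gB' (cx j) (wx j) n p.1 ^ 2 ≤
        ∑ j ∈ Finset.range m, gB cy wy j p.2 ^ 2 * (12 * M / (a * p.2)) ^ 2 := by
      refine Finset.sum_le_sum fun j _ => ?_
      by_cases h : gB cy wy j p.2 = 0
      · simp [h]
      · have hne := gB_ne hwy h
        refine mll ?_ (sq_nonneg _)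
        exact gB'_sum (hwx j) (hcx j) hM (fun n _ _ => key j hne.1 hne.2) m'
    have s2 : ∑ j ∈ Finset.range m, gB' cy wy j p.2 ^ 2 * ∑ n ∈ Finset.range m', gB (cx j) (wx j) n p.1 ^ 2 ≤
        ∑ j ∈ Finset.range m, gB' cy wy j p.2 ^ 2 := by
      refine Finset.sum_le_sum fun j _ => ?_
      exact mul_le_of_le_one_right (sq_nonneg _) (gB_sum_le (hwx j) (hcx j) m' p.1)
    have s3 : ∑ j ∈ Finset.range m, gB' cy wy j p.2 ^ 2 ≤ (12 * M / (a * p.2)) ^ 2 := by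
      refine gB'_sum hwy hcy hM (fun n h1 h2 => key n h1 ?_) m
      grind
    rw [← Finset.sum_mul] at s1
    have s4 := mul_le_of_le_one_left (sq_nonneg (12 * M / (a * p.2))) (gB_sum_le hwy hcy m p.2)
    have : 2 * (12 * M / (a * p.2)) ^ 2 = 288 * M ^ 2 / (a * p.2) ^ 2 := by rw [div_pow]; ring
    have : (300 * M ^ 2 - 288 * M ^ 2) / (a * p.2) ^ 2 ≥ 0 := by apply div_nonneg <;> nlinarith
    grind
  · have h0 := hcy0 i.1
    set r := a * cy i.1 / 2 with hr
    have hr0 := hwy i.1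
    have h1 : ∀ p ∈ Set.Icc (cx i.1 i.2 + r) (cx i.1 i.2 + 2 * r) ×ˢ Set.Icc (cy i.1 + r) (cy i.1 + 2 * r), χ i p = 1 := by
      intro p hp
      obtain ⟨⟨h1, h2⟩, h3, h4⟩ := hp
      simp only [χ]
      rw [gB_one hwy h3, gB_one (hwx i.1) h1, mul_one]
      · grind
      · grind
    set Q := Set.Icc (cx i.1 i.2 + r) (cx i.1 i.2 + 2 * r) ×ˢ Set.Icc (cy i.1 + r) (cy i.1 + 2 * r) with hQ
    have hcs := HasCompactSupport.of_support_subset_isCompact (isCompact_Icc.prod isCompact_Icc)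
      ((subset_tsupport _).trans (sup i))
    have hi : Integrable (fun p => χ i p ^ 2) := icc (by fun_prop)
      (hcs.comp_left (g := fun t : ℝ => t ^ 2) (by simp))
    have h2 : ∫ p in Q, χ i p ^ 2 = r ^ 2 := by
      rw [setIntegral_congr_fun (g := fun _ => (1 : ℝ)) (measurableSet_Icc.prod measurableSet_Icc) (fun p hp => by simp [h1 p hp])]
      simp only [integral_const, smul_eq_mul, mul_one]
      rw [measureReal_restrict_apply_univ, Measure.volume_eq_prod, measureReal_prod_prod]
      simp only [Real.volume_real_Icc]
      grind
    calc _ = ∫ p in Q, χ i p ^ 2 := by rw [h2, hr]; ring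
      _ ≤ _ := setIntegral_le_integral hi (evf fun p => sq_nonneg _)
lemma lin_alg {E H0 H1 : Type*} [AddCommGroup E] [Module ℂ E] [NormedAddCommGroup H0] [InnerProductSpace ℂ H0]
    [NormedAddCommGroup H1] [InnerProductSpace ℂ H1] (J0 : E →ₗ[ℂ] H0) (J1 : E →ₗ[ℂ] H1)
    (hJ : Function.Injective J0) (V : Submodule ℂ E) (hfd : FiniteDimensional ℂ V) (lam : ℝ)
    (hV : ∀ u ∈ V, u ≠ 0 → ‖J1 u‖ ^ 2 < lam * ‖J0 u‖ ^ 2) {κ : Type} (s : Finset κ) (f : κ → E)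
    (hf : ∀ u, ∑ j ∈ s, ‖inner ℂ (J0 (f j)) (J0 u)‖ ^ 2 ≤ ‖J0 u‖ ^ 2) :
    ∃ (N : ℕ) (e : Fin N → E), Orthonormal ℂ (fun i => J0 (e i)) ∧ Module.finrank ℂ V ≤ N ∧
      (∀ i, ‖J1 (e i)‖ ^ 2 < lam) ∧
      (∃ U : Submodule ℂ E, Module.finrank ℂ U = N ∧ ∀ u ∈ U, u ≠ 0 → ‖J1 u‖ ^ 2 < lam * ‖J0 u‖ ^ 2) ∧
      ∑ j ∈ s, (lam * ‖J0 (f j)‖ ^ 2 - ‖J1 (f j)‖ ^ 2) ≤ ∑ i, (lam - ‖J1 (e i)‖ ^ 2) := by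
  classical
  let W : Submodule ℂ E := V ⊔ Submodule.span ℂ (f '' s)
  have : FiniteDimensional ℂ (Submodule.span ℂ (f '' s)) :=
    FiniteDimensional.span_of_finite ℂ (s.finite_toSet.image f)
  have : FiniteDimensional ℂ W := Submodule.finiteDimensional_sup _ _
  let W' := W.map J0
  let φ : W ≃ₗ[ℂ] W' := Submodule.equivMapOfInjective J0 hJ W
  have : FiniteDimensional ℂ W' := φ.finiteDimensional
  let L : W' →ₗ[ℂ] E := W.subtype ∘ₗ φ.symm.toLinearMap
  have hL : ∀ w : W', J0 (L w) = w := by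
    intro w
    have : (φ (φ.symm w) : H0) = J0 (φ.symm w : W) := rfl
    rw [LinearEquiv.apply_symm_apply] at this
    exact this.symm
  have hL2 : ∀ u ∈ W, ∃ w : W', L w = u := by
    intro u hu
    exact ⟨φ ⟨u, hu⟩, by simp [L]⟩
  let T : W' →ₗ[ℂ] H1 := J1 ∘ₗ L
  let T' : W' →ₗ[ℂ] LinearMap.range T := T.rangeRestrict
  have : FiniteDimensional ℂ (LinearMap.range T) := inferInstance
  have hS : (LinearMap.adjoint T' ∘ₗ T').IsSymmetric := fun x y => by
    rw [LinearMap.comp_apply, LinearMap.adjoint_inner_left, LinearMap.comp_apply, LinearMap.adjoint_inner_right]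
  let n := Module.finrank ℂ W'
  let b := hS.eigenvectorBasis (rfl : Module.finrank ℂ W' = n)
  let ε := hS.eigenvalues (rfl : Module.finrank ℂ W' = n)
  have hq : ∀ w : W', ‖T w‖ ^ 2 = ∑ i, ε i * ‖inner ℂ (b i) w‖ ^ 2 := by
    intro w
    have h1 : ((‖T w‖ ^ 2 : ℝ) : ℂ) = inner ℂ w ((LinearMap.adjoint T' ∘ₗ T') w) := by
      rw [LinearMap.comp_apply (LinearMap.adjoint T') T', LinearMap.adjoint_inner_right, inner_self_eq_norm_sq_to_K]
      norm_cast
    have h2 : ∀ i, inner ℂ (b i) ((LinearMap.adjoint T' ∘ₗ T') w) = ε i * inner ℂ (b i) w := by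
      intro i
      rw [← hS, hS.apply_eigenvectorBasis, inner_smul_left]
      simp [ε, b]
    rw [← b.sum_inner_mul_inner] at h1
    simp only [h2] at h1
    have h3 : ∀ i, inner ℂ w (b i) * (ε i * inner ℂ (b i) w) = ((ε i * ‖inner ℂ (b i) w‖ ^ 2 : ℝ) : ℂ) := by
      intro i
      rw [← inner_conj_symm w (b i)]
      push_cast
      rw [← Complex.conj_mul']; ring
    simp only [h3] at h1
    exact_mod_cast h1
  have hn : ∀ w : W', ‖w‖ ^ 2 = ∑ i, ‖inner ℂ (b i) w‖ ^ 2 := fun w => (b.sum_sq_norm_inner_right w).symm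
  have hqb : ∀ i, ‖T (b i)‖ ^ 2 = ε i := by
    intro i
    rw [hq, Finset.sum_eq_single i]
    · simp
    · intro j _ hj
      rw [b.inner_eq_ite, if_neg hj]; simp
    · simp
  let I := {i : Fin n // ε i < lam}
  let N := Fintype.card I
  let eqv : Fin N ≃ I := (Fintype.equivFin I).symm
  refine ⟨N, fun i => L (b (eqv i)), ?_, ?_, fun i => ?_, ?_, ?_⟩
  · simp only [hL]
    have h1 : Orthonormal ℂ (fun i : Fin N => b (eqv i)) :=
      b.orthonormal.comp _ (Subtype.val_injective.comp eqv.injective)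
    exact h1.comp_linearIsometry W'.subtypeₗᵢ
  · by_contra hlt
    push Not at hlt
    have hφ : ∀ v : V, (v : E) ∈ W := fun v => Submodule.mem_sup_left v.2
    let iV : V →ₗ[ℂ] W := Submodule.inclusion le_sup_left
    let g : V →ₗ[ℂ] (I → ℂ) := LinearMap.pi fun i => (innerₛₗ ℂ (b i.1)) ∘ₗ φ.toLinearMap ∘ₗ iV
    have hni : ¬ Function.Injective g := by
      intro hi
      have := LinearMap.finrank_le_finrank_of_injective hi
      rw [Module.finrank_fintype_fun_eq_card] at this
      omega
    rw [← LinearMap.ker_eq_bot] at hni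
    obtain ⟨v, hv1, hv2⟩ := Submodule.exists_mem_ne_zero_of_ne_bot hni
    set w : W' := φ (iV v) with hw
    have hLw : L w = v := by simp [L, hw, iV]
    have hz : ∀ i : I, inner ℂ (b i.1) w = 0 := fun i => congrFun (LinearMap.mem_ker.1 hv1) i
    have h1 := hV v v.2 (by simpa using hv2)
    rw [← hLw, hL] at h1
    have h2 : ‖T w‖ ^ 2 < lam * ‖w‖ ^ 2 := h1
    rw [hq, hn, Finset.mul_sum] at h2
    refine absurd h2 (not_lt.2 (Finset.sum_le_sum fun i _ => ?_))
    by_cases hi : ε i < lam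
    · rw [hz ⟨i, hi⟩]; simp
    · exact mlr (not_lt.1 hi) (by positivity)
  · have := hqb (eqv i)
    have h2 := (eqv i).2
    change ‖T (b (eqv i))‖ ^ 2 < lam
    rw [this]; exact h2
  · have hLi : Function.Injective L := fun x y h => by
      have := congrArg J0 h
      rw [hL, hL] at this; exact Subtype.ext this
    have hli : LinearIndependent ℂ (fun i : Fin N => b (eqv i)) := (b.orthonormal.comp _ (Subtype.val_injective.comp eqv.injective)).linearIndependent
    refine ⟨(Submodule.span ℂ (Set.range fun i : Fin N => b (eqv i))).map L, ?_, ?_⟩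
    · rw [← (Submodule.equivMapOfInjective L hLi _).finrank_eq, finrank_span_eq_card hli, Fintype.card_fin]
    · rintro _ ⟨w, hw, rfl⟩ h0
      have hz : ∀ i, ¬ ε i < lam → inner ℂ (b i) w = 0 := by
        intro i hi
        refine Submodule.span_induction (p := fun w _ => inner ℂ (b i) w = 0) ?_ (inner_zero_right _) (fun x y _ _ hx hy => by rw [inner_add_right, hx, hy, add_zero]) (fun c x _ hx => by rw [inner_smul_right, hx, mul_zero]) hw
        rintro _ ⟨j, rfl⟩
        simp only
        rw [b.inner_eq_ite, if_neg]
        intro h; apply hi; rw [h]; exact (eqv j).2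
      rw [hL]
      change ‖T w‖ ^ 2 < lam * ‖w‖ ^ 2
      have hw0 : w ≠ 0 := fun h => h0 (by rw [h, map_zero])
      have hex : ∃ i, inner ℂ (b i) w ≠ 0 := by
        by_contra hcon
        push Not at hcon
        exact hw0 (norm_eq_zero.1 (pow_eq_zero_iff (two_ne_zero) |>.1 (by rw [hn]; simp [hcon])))
      obtain ⟨i0, hi0⟩ := hex
      rw [hq, hn, Finset.mul_sum]
      refine Finset.sum_lt_sum (fun i _ => ?_) ⟨i0, Finset.mem_univ _, ?_⟩
      · by_cases hi : ε i < lam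
        · exact mlr hi.le (by positivity)
        · rw [hz i hi]; simp
      · have : ε i0 < lam := by by_contra h; exact hi0 (hz i0 h)
        exact mul_lt_mul_of_pos_right this (by positivity)
  · have hsum : ∑ i : Fin N, (lam - ‖J1 (L (b (eqv i)))‖ ^ 2) = ∑ i : I, (lam - ε i.1) := by
      rw [← eqv.sum_comp]
      refine Finset.sum_congr rfl fun i _ => ?_
      change lam - ‖T (b (eqv i))‖ ^ 2 = _
      rw [hqb]
    rw [hsum]
    have hfW : ∀ j ∈ s, ∃ w : W', L w = f j := fun j hj =>
      hL2 _ (Submodule.mem_sup_right (Submodule.subset_span ⟨j, hj, rfl⟩))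
    choose! w hw using hfW
    have h1 : ∀ j ∈ s, lam * ‖J0 (f j)‖ ^ 2 - ‖J1 (f j)‖ ^ 2 = ∑ i, (lam - ε i) * ‖inner ℂ (b i) (w j)‖ ^ 2 := by
      intro j hj
      rw [← hw j hj, hL]
      change lam * ‖w j‖ ^ 2 - ‖T (w j)‖ ^ 2 = _
      rw [hn, hq, Finset.mul_sum, ← Finset.sum_sub_distrib]
      exact Finset.sum_congr rfl fun i _ => by ring
    rw [Finset.sum_congr rfl h1, Finset.sum_comm]
    have h2 : ∀ i, ∑ j ∈ s, ‖inner ℂ (b i) (w j)‖ ^ 2 ≤ 1 := by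
      intro i
      have := hf (L (b i))
      rw [hL] at this
      have h3 : ‖((b i : W') : H0)‖ = 1 := b.orthonormal.1 i
      rw [h3, one_pow] at this
      refine le_trans (le_of_eq (Finset.sum_congr rfl fun j hj => ?_)) this
      rw [← hw j hj, hL, norm_inner_symm]; rfl
    have h3 : ∑ i : I, (lam - ε i.1) = ∑ i, if ε i < lam then lam - ε i else 0 := by
      rw [← Finset.sum_filter]
      exact (Finset.sum_subtype _ (by simp) (fun i => lam - ε i)).symm
    rw [h3]
    refine Finset.sum_le_sum fun i _ => ?_
    rw [← Finset.mul_sum]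
    split_ifs with hi
    · exact mul_le_of_le_one_right (by linarith) (h2 i)
    · exact mul_nonpos_of_nonpos_of_nonneg (by linarith) (Finset.sum_nonneg fun _ _ => by positivity)
def dens (P Q : Rp → ℝ) (f : Rp → ℂ) (p : Rp) : ℝ :=
  ‖-Ii * dX f p - (P p : ℂ) * f p‖ ^ 2 + ‖-Ii * dY f p - (Q p : ℂ) * f p‖ ^ 2
def wi (f u : Rp → ℂ) : ℂ := ∫ p, (((p.2 ^ 2)⁻¹ : ℝ) : ℂ) * (starRingEnd ℂ (f p) * u p)
def wn (u : Rp → ℂ) : ℝ := ∫ p, (p.2 ^ 2)⁻¹ * ‖u p‖ ^ 2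
lemma UHP_open : IsOpen UHP := isOpen_lt continuous_const continuous_snd
lemma UHP_meas : MeasurableSet UHP := UHP_open.measurableSet
lemma volH_integral (f : Rp → ℝ) : ∫ p, f p ∂volH = ∫ p in UHP, (p.2 ^ 2)⁻¹ * f p := by
  have hm : Measurable fun p : Rp => ((p.2 ^ 2)⁻¹).toNNReal := by fun_prop
  have : volH = (volume.restrict UHP).withDensity fun p => ((((p.2 ^ 2)⁻¹).toNNReal : NNReal) : ENNReal) := rfl
  rw [this, integral_withDensity_eq_integral_smul hm]
  congr 1; ext p
  rw [NNReal.smul_def, Real.coe_toNNReal _ (by positivity), smul_eq_mul]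
lemma test_zero {u : Rp → ℂ} (hu : IsTestOn UHP u) {p : Rp} (hp : p ∉ UHP) : u p = 0 :=
  izt fun h => hp (hu.2.2 h)
lemma dX_zero {u : Rp → ℂ} {p : Rp} (hp : p ∉ tsupport u) : dX u p = 0 := by
  rw [dX, fderiv_of_notMem_tsupport ℝ hp]; simp
lemma dY_zero {u : Rp → ℂ} {p : Rp} (hp : p ∉ tsupport u) : dY u p = 0 := by
  rw [dY, fderiv_of_notMem_tsupport ℝ hp]; simp
lemma nsq_eq {u : Rp → ℂ} (hu : IsTestOn UHP u) : ∫ p, ‖u p‖ ^ 2 ∂volH = wn u := by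
  rw [volH_integral, wn]
  apply setIntegral_eq_integral_of_forall_compl_eq_zero
  intro p hp; rw [test_zero hu hp]; simp
lemma qA_eq {P Q : Rp → ℝ} {u : Rp → ℂ} (hu : IsTestOn UHP u) : qA P Q u = ∫ p, dens P Q u p := by
  rw [qA, volH_integral]
  rw [setIntegral_congr_fun (g := dens P Q u) UHP_meas]
  · apply setIntegral_eq_integral_of_forall_compl_eq_zero
    intro p hp
    have := fun h => hp (hu.2.2 h)
    rw [dens, test_zero hu hp, dX_zero this, dY_zero this]; simp
  · intro p hp
    have : p.2 ≠ 0 := ne_of_gt hp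
    simp only [dens]
    field_simp
lemma cont_mul {A : Rp → ℂ} (hA : ContinuousOn A UHP) {u : Rp → ℂ} (hc : Continuous u)
    (hs : tsupport u ⊆ UHP) : Continuous (fun p => A p * u p) := by
  refine continuous_of_tsupport fun x hx => ?_
  have h1 := closure_mono (Function.support_mul_subset_right _ _) hx
  exact (hA.continuousAt (UHP_open.mem_nhds (hs h1))).mul hc.continuousAt
lemma cont_mulr {A : Rp → ℝ} (hA : ContinuousOn A UHP) {u : Rp → ℂ} (hc : Continuous u)
    (hs : tsupport u ⊆ UHP) : Continuous (fun p => (A p : ℂ) * u p) :=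
  cont_mul (Complex.continuous_ofReal.comp_continuousOn hA) hc hs
lemma inv_cont : ContinuousOn (fun p : Rp => p.2⁻¹) UHP :=
  continuousOn_snd.inv₀ fun _ hp => ne_of_gt hp
lemma memLp_cs {f : Rp → ℂ} (hf : Continuous f) (hc : Hc f) : MemLp f 2 :=
  hf.memLp_of_hasCompactSupport hc
lemma test_D {A : Rp → ℝ} (hA : ContinuousOn A UHP) {u : Rp → ℂ} (hu : IsTestOn UHP u) :
    (Continuous (fun p => -Ii * dX u p - (A p : ℂ) * u p) ∧
    Hc (fun p => -Ii * dX u p - (A p : ℂ) * u p)) ∧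
    (Continuous (fun p => -Ii * dY u p - (A p : ℂ) * u p) ∧
    Hc (fun p => -Ii * dY u p - (A p : ℂ) * u p)) := by
  have h := cont_mulr hA hu.1.continuous hu.2.2
  have h1 := (sm_dX hu.1).continuous
  have h2 := (sm_dY hu.1).continuous
  exact ⟨⟨by fun_prop, (cs_dX hu.2.1).mul_left.sub hu.2.1.mul_left⟩, ⟨by fun_prop, (cs_dY hu.2.1).mul_left.sub hu.2.1.mul_left⟩⟩
lemma test_y {u : Rp → ℂ} (hu : IsTestOn UHP u) :
    Continuous (fun p => ((p.2⁻¹ : ℝ) : ℂ) * u p) ∧ Hc (fun p => ((p.2⁻¹ : ℝ) : ℂ) * u p) :=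
  ⟨cont_mulr inv_cont hu.1.continuous hu.2.2, hu.2.1.mul_left⟩
lemma test_add {u v : Rp → ℂ} (hu : IsTestOn UHP u) (hv : IsTestOn UHP v) : IsTestOn UHP (u + v) :=
  ⟨hu.1.add hv.1, hu.2.1.add hv.2.1, (tsupport_add _ _).trans (Set.union_subset hu.2.2 hv.2.2)⟩
lemma test_smul (c : ℂ) {u : Rp → ℂ} (hu : IsTestOn UHP u) : IsTestOn UHP (c • u) :=
  ⟨contDiff_const.smul hu.1, hu.2.1.smul_left (f := fun _ => c), (closure_mono (Function.support_const_smul_subset c u)).trans hu.2.2⟩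
def TS : Submodule ℂ (Rp → ℂ) where
  carrier := {f | IsTestOn UHP f}
  add_mem' := test_add
  zero_mem' := ⟨contDiff_const, HasCompactSupport.zero, by simp⟩
  smul_mem' c _ hu := test_smul c hu
def J0 : TS →ₗ[ℂ] Lp ℂ 2 (volume : Measure (Rp)) where
  toFun u := (memLp_cs (test_y u.2).1 (test_y u.2).2).toLp _
  map_add' u v := by
    rw [← MemLp.toLp_add]; congr 1; ext p; simp [mul_add]
  map_smul' c u := by
    rw [RingHom.id_apply, ← MemLp.toLp_const_smul]; congr 1; ext p; simp; ring
def J1 {P Q : Rp → ℝ} (h1 : ContinuousOn P UHP) (h2 : ContinuousOn Q UHP) :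
    TS →ₗ[ℂ] WithLp 2 (Lp ℂ 2 (volume : Measure (Rp)) × Lp ℂ 2 (volume : Measure (Rp))) where
  toFun u := WithLp.toLp 2 ((memLp_cs (test_D h1 u.2).1.1 (test_D h1 u.2).1.2).toLp _,
    (memLp_cs (test_D h2 u.2).2.1 (test_D h2 u.2).2.2).toLp _)
  map_add' u v := by
    rw [← WithLp.toLp_add, Prod.mk_add_mk, ← MemLp.toLp_add, ← MemLp.toLp_add]
    have e := fun p => fderiv_add (u.2.1.differentiable (by simp) p) (v.2.1.differentiable (by simp) p)
    congr 3
    · ext p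
      simp only [dX, Submodule.coe_add, Pi.add_apply]
      rw [e]; simp only [add_apply]; ring
    · ext p
      simp only [dY, Submodule.coe_add, Pi.add_apply]
      rw [e]; simp only [add_apply]; ring
  map_smul' c u := by
    rw [RingHom.id_apply, ← WithLp.toLp_smul, Prod.smul_mk, ← MemLp.toLp_const_smul, ← MemLp.toLp_const_smul]
    have e := fun p => fderiv_const_smul (u.2.1.differentiable (by simp) p) c
    congr 3
    · ext p
      simp only [dX, Submodule.coe_smul, Pi.smul_apply, smul_eq_mul]
      rw [e]; simp only [smul_apply, smul_eq_mul]; ring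
    · ext p
      simp only [dY, Submodule.coe_smul, Pi.smul_apply, smul_eq_mul]
      rw [e]; simp only [smul_apply, smul_eq_mul]; ring
lemma J0_inner (u v : TS) : inner ℂ (J0 u) (J0 v) = wi u v := by
  simp only [J0, LinearMap.coe_mk, AddHom.coe_mk]
  rw [l2_inner, wi]
  simp; push_cast; ring
lemma J0_norm (u : TS) : ‖J0 u‖ ^ 2 = wn u := by
  simp only [J0, LinearMap.coe_mk, AddHom.coe_mk]
  rw [l2_norm_sq, wn]
  congr 1; ext p
  rw [norm_mul, mul_pow, Complex.norm_real, nea, sq_abs, inv_pow]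
lemma J1_norm {P Q : Rp → ℝ} (h1 : ContinuousOn P UHP) (h2 : ContinuousOn Q UHP) (u : TS) :
    ‖J1 h1 h2 u‖ ^ 2 = qA P Q u := by
  rw [WithLp.prod_norm_sq_eq_of_L2]
  change ‖(memLp_cs (test_D h1 u.2).1.1 (test_D h1 u.2).1.2).toLp _‖ ^ 2 +
    ‖(memLp_cs (test_D h2 u.2).2.1 (test_D h2 u.2).2.2).toLp _‖ ^ 2 = _
  rw [l2_norm_sq, l2_norm_sq, qA_eq u.2, ← integral_add]
  · rfl
  · have := (test_D h1 u.2).1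
    exact icc (this.1.norm.pow 2) (nsq_cs this.2)
  · have := (test_D h2 u.2).2
    exact icc (this.1.norm.pow 2) (nsq_cs this.2)
lemma J0_inj : Function.Injective J0 := by
  rw [← LinearMap.ker_eq_bot, LinearMap.ker_eq_bot']
  intro u hu
  have h1 : ‖J0 u‖ ^ 2 = 0 := by rw [hu]; simp
  simp only [J0, LinearMap.coe_mk, AddHom.coe_mk] at h1
  have hc := test_y u.2
  have hi : Integrable (fun p : Rp => ‖((p.2⁻¹ : ℝ) : ℂ) * u.1 p‖ ^ 2) :=
    icc (hc.1.norm.pow 2) (nsq_cs hc.2)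
  rw [l2_norm_sq, integral_eq_zero_iff_of_nonneg (fun _ => by positivity) hi] at h1
  have h2 := (Continuous.ae_eq_iff_eq volume (hc.1.norm.pow 2) continuous_const).1 h1
  apply Subtype.ext
  funext p
  by_cases hp : p ∈ UHP
  · have h3 : ‖((p.2⁻¹ : ℝ) : ℂ) * u.1 p‖ ^ 2 = 0 := congrFun h2 p
    have h4 : p.2 ≠ 0 := ne_of_gt hp
    simpa [h4] using h3
  · exact test_zero u.2 hp
theorem spec_family {P Q : Rp → ℝ} (h1 : ContinuousOn P UHP) (h2 : ContinuousOn Q UHP) (lam : ℝ)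
    (V : Submodule ℂ (Rp → ℂ)) (hV : (V : Set (Rp → ℂ)) ⊆ {f | IsTestOn UHP f})
    (hq : ∀ u ∈ V, u ≠ 0 → qA P Q u < lam * ∫ p, ‖u p‖ ^ 2 ∂volH)
    {κ : Type} (s : Finset κ) (f : κ → Rp → ℂ) (hf : ∀ j, IsTestOn UHP (f j))
    (hB : ∀ u, IsTestOn UHP u → ∑ j ∈ s, ‖wi (f j) u‖ ^ 2 ≤ wn u) :
    ∃ (N : ℕ) (e : Fin N → Rp → ℂ), (∀ i, IsTestOn UHP (e i)) ∧ (∀ i j, wi (e i) (e j) = if i = j then 1 else 0) ∧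
      Module.finrank ℂ V ≤ N ∧ (∀ i, qA P Q (e i) < lam) ∧ (∃ U : Submodule ℂ (Rp → ℂ), (U : Set (Rp → ℂ)) ⊆ {f | IsTestOn UHP f} ∧ Module.finrank ℂ U = N ∧
        ∀ u ∈ U, u ≠ 0 → qA P Q u < lam * ∫ p, ‖u p‖ ^ 2 ∂volH) ∧
      ∑ j ∈ s, (lam * wn (f j) - qA P Q (f j)) ≤ ∑ i, (lam - qA P Q (e i)) := by
  wlog hfd : FiniteDimensional ℂ V generalizing V
  · have h0 : Module.finrank ℂ V = 0 := Module.finrank_of_infinite_dimensional hfd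
    obtain ⟨N, e, H⟩ := this ⊥ (by intro x hx; rw [(Submodule.mem_bot ℂ).1 hx]; exact TS.zero_mem) (by simp) inferInstance
    exact ⟨N, e, H.1, H.2.1, by omega, H.2.2.2⟩
  let V' : Submodule ℂ TS := V.comap TS.subtype
  let φ : V' ≃ₗ[ℂ] V := Submodule.comapSubtypeEquivOfLe hV
  obtain ⟨N, e, ho, hN, hl, ⟨U, hU1, hU2⟩, hs⟩ := lin_alg J0 (J1 h1 h2) J0_inj V' φ.symm.finiteDimensional lam
    (fun u hu h0 => by
      rw [J1_norm, J0_norm, ← nsq_eq u.2]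
      exact hq u hu (by simpa using h0)) s (fun j => ⟨f j, hf j⟩)
    (fun u => by simp only [J0_inner, J0_norm]; exact hB u u.2)
  rw [φ.finrank_eq] at hN
  simp only [J1_norm, J0_norm] at hl hs hU2
  refine ⟨N, fun i => e i, fun i => (e i).2, fun i j => ?_, hN, hl, ⟨U.map TS.subtype, ?_, ?_, ?_⟩, hs⟩
  rotate_left
  · rintro _ ⟨u, _, rfl⟩; exact u.2
  · rw [Submodule.finrank_map_subtype_eq, hU1]
  · rintro _ ⟨u, hu, rfl⟩ h0
    have := hU2 u hu (by rintro rfl; exact h0 rfl)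
    rwa [← nsq_eq u.2] at this
  rw [← J0_inner]
  exact orthonormal_iff_ite.1 ho i j
lemma wi_bessel {N : ℕ} {e : Fin N → Rp → ℂ} (he : ∀ i, IsTestOn UHP (e i))
    (ho : ∀ i j, wi (e i) (e j) = if i = j then 1 else 0) {g : Rp → ℂ} (hg : Continuous g)
    (hgc : Hc g) :
    ∑ i, ‖∫ p, starRingEnd ℂ (g p) * e i p‖ ^ 2 ≤ ∫ p, p.2 ^ 2 * ‖g p‖ ^ 2 := by
  have hm : MemLp (fun p => ((p.2 : ℝ) : ℂ) * g p) 2 :=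
    memLp_cs (by fun_prop) hgc.mul_left
  have ho' : Orthonormal ℂ (fun i => J0 ⟨e i, he i⟩) := by
    rw [orthonormal_iff_ite]; intro i j; rw [J0_inner, ho]
  have := ho'.sum_inner_products_le (s := Finset.univ) (hm.toLp _)
  rw [l2_norm_sq] at this
  refine le_trans (le_of_eq ?_) (this.trans (le_of_eq ?_))
  · refine Finset.sum_congr rfl fun i _ => ?_
    rw [← norm_inner_symm]
    simp only [J0, LinearMap.coe_mk, AddHom.coe_mk]
    rw [l2_inner]
    congr 3; ext p
    by_cases hp : p ∈ UHP
    · have h4 : (p.2 : ℂ) ≠ 0 := by exact_mod_cast ne_of_gt hp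
      simp; push_cast; field_simp
    · rw [test_zero (he i) hp]; simp
  · congr 1; ext p
    rw [norm_mul, mul_pow, Complex.norm_real, nea, sq_abs]
lemma cutoff_ex {T : Set (Rp)} (hT : IsCompact T) (hU : T ⊆ UHP) :
    ∃ ψ : Rp → ℝ, Sm ψ ∧ Hc ψ ∧ tsupport ψ ⊆ UHP ∧
      ∀ p ∈ T, ψ =ᶠ[nhds p] 1 := by
  obtain ⟨K, hK, h1, h2⟩ := exists_compact_between hT UHP_open hU
  obtain ⟨f, hf1, hf0, -⟩ := exists_contMDiffMap_one_nhds_of_subset_interior (n := (⊤ : ℕ∞)) (modelWithCornersSelf ℝ (Rp)) hT.isClosed h1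
  have hs : tsupport f ⊆ K := closure_minimal (fun x hx => by
    by_contra h; exact hx (hf0 x h)) hK.isClosed
  refine ⟨f, f.contMDiff.contDiff, hK.of_isClosed_subset (isClosed_tsupport _) hs, hs.trans h2, fun p hp => ?_⟩
  exact hf1.filter_mono (nhds_le_nhdsSet hp)
lemma cd_cut {n : ℕ∞} {A ψ : Rp → ℝ} (hA : ContDiffOn ℝ n A UHP) (hψ : Sm ψ) (hs : tsupport ψ ⊆ UHP) :
    ContDiff ℝ n (fun p => ψ p * A p) := by
  rw [contDiff_iff_contDiffAt]
  intro p
  by_cases hp : p ∈ UHP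
  · exact (hψ.contDiffAt.of_le (by exact_mod_cast le_top)).mul (hA.contDiffAt (UHP_open.mem_nhds hp))
  · have : (fun p => ψ p * A p) =ᶠ[nhds p] fun _ => 0 := by
      filter_upwards [(isClosed_tsupport ψ).isOpen_compl.mem_nhds (fun h => hp (hs h))] with q hq
      rw [izt hq, zero_mul]
    exact contDiffAt_const.congr_of_eventuallyEq this
lemma slice_xr {v : Rp → ℝ} (hv : Differentiable ℝ v) (x y : ℝ) :
    HasDerivAt (fun x => v (x, y)) (dXr v (x, y)) x :=
  (hv (x, y)).hasFDerivAt.comp_hasDerivAt x ((hasDerivAt_id x).prodMk (hasDerivAt_const x y))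
lemma slice_yr {v : Rp → ℝ} (hv : Differentiable ℝ v) (x y : ℝ) :
    HasDerivAt (fun y => v (x, y)) (dYr v (x, y)) y :=
  (hv (x, y)).hasFDerivAt.comp_hasDerivAt y ((hasDerivAt_const y x).prodMk (hasDerivAt_id y))
lemma cont_dr {v : Rp → ℝ} (hv : ContDiff ℝ 1 v) (e : Rp) : Continuous (fun p => fderiv ℝ v p e) :=
  (hv.continuous_fderiv (by simp)).clm_apply continuous_const
lemma prim_ex {g1 g2 : Rp → ℝ} (h1 : ContDiff ℝ 1 g1) (h2 : ContDiff ℝ 1 g2)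
    (hc2 : Hc g2) (y0 : ℝ) : ∃ φ : Rp → ℝ, ContDiff ℝ 1 φ ∧
    (∀ p, dXr φ p = (∫ t in y0..p.2, dXr g2 (p.1, t)) + g1 (p.1, y0)) ∧ ∀ p, dYr φ p = g2 p := by
  have hd2 := h2.differentiable one_ne_zero
  have hcx : Continuous (dXr g2) := cont_dr h2 _
  obtain ⟨M, hM⟩ := (hcx.bounded_above_of_compact_support (hc2.fderiv_apply ℝ (1, 0)))
  let F : ℝ → ℝ → ℝ := fun x y => (∫ t in y0..y, g2 (x, t)) + ∫ s in (0:ℝ)..x, g1 (s, y0)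
  let f1 : ℝ → ℝ → ℝ := fun x y => (∫ t in y0..y, dXr g2 (x, t)) + g1 (x, y0)
  have hf1 : ∀ x y, HasDerivAt (fun x => F x y) (f1 x y) x := by
    intro x y
    have ha := (intervalIntegral.hasDerivAt_integral_of_dominated_loc_of_deriv_le (μ := volume) (a := y0) (b := y)
      (F := fun x t => g2 (x, t)) (F' := fun x t => dXr g2 (x, t)) (bound := fun _ => M) (x₀ := x) univ_mem
      (evf fun x => (h2.continuous.comp (by fun_prop)).aestronglyMeasurable)
      ((h2.continuous.comp (by fun_prop)).intervalIntegrable _ _)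
      (hcx.comp (by fun_prop)).aestronglyMeasurable
      (evf fun t _ x _ => hM _) intervalIntegrable_const
      (evf fun t _ x _ => slice_xr hd2 x t)).2
    refine ha.add ?_
    exact intervalIntegral.integral_hasDerivAt_right ((h1.continuous.comp (by fun_prop)).intervalIntegrable _ _)
      (h1.continuous.comp (by fun_prop)).stronglyMeasurable.stronglyMeasurableAtFilter (h1.continuous.comp (by fun_prop)).continuousAt
  have hf2 : ∀ x y, HasDerivAt (fun y => F x y) (g2 (x, y)) y := by
    intro x y
    refine HasDerivAt.add_const _ ?_
    exact intervalIntegral.integral_hasDerivAt_right ((h2.continuous.comp (by fun_prop)).intervalIntegrable _ _)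
      (h2.continuous.comp (by fun_prop)).stronglyMeasurable.stronglyMeasurableAtFilter (h2.continuous.comp (by fun_prop)).continuousAt
  have cf1 : Continuous (fun p : Rp => f1 p.1 p.2) := by fun_prop
  let L1 : ℝ → ℝ → ℝ →L[ℝ] ℝ := fun x y => ContinuousLinearMap.toSpanSingleton ℝ (f1 x y)
  let L2 : ℝ → ℝ → ℝ →L[ℝ] ℝ := fun x y => ContinuousLinearMap.toSpanSingleton ℝ (g2 (x, y))
  have cL1 : Continuous (fun p : Rp => L1 p.1 p.2) :=
    (ContinuousLinearMap.toSpanSingletonCLE (𝕜 := ℝ) (E := ℝ)).continuous.comp cf1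
  have cL2 : Continuous (fun p : Rp => L2 p.1 p.2) :=
    (ContinuousLinearMap.toSpanSingletonCLE (𝕜 := ℝ) (E := ℝ)).continuous.comp h2.continuous
  have key : ∀ u : Rp, HasFDerivAt (fun p : Rp => F p.1 p.2) ((L1 u.1 u.2).coprod (L2 u.1 u.2)) u := by
    intro u
    exact (hasStrictFDerivAt_uncurry_coprod (u := u) (f := F) (f₁ := L1) (f₂ := L2)
      (evf fun v => (hf1 v.1 v.2).hasFDerivAt) (evf fun v => (hf2 v.1 v.2).hasFDerivAt)
      cL1.continuousAt cL2.continuousAt).hasFDerivAt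
  refine ⟨fun p => F p.1 p.2, ?_, fun p => ?_, fun p => ?_⟩
  · rw [contDiff_one_iff_hasFDerivAt]
    refine ⟨_, ?_, key⟩
    fun_prop
  · rw [dXr, (key p).fderiv]; simp [L1, f1]
  · rw [dYr, (key p).fderiv]; simp [L2]
lemma moll {φ : Rp → ℝ} (h : ContDiff ℝ 1 φ) (hc : Hc φ) {η : ℝ} (hη : 0 < η) :
    ∃ g : Rp → ℝ, Sm g ∧ ∀ p, |dXr g p - dXr φ p| ≤ η ∧ |dYr g p - dYr φ p| ≤ η := by
  have hcd := h.continuous_fderiv (by simp)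
  have hu := hcd.uniformContinuous_of_tendsto_cocompact (x := 0)
    ((hc.fderiv ℝ).is_zero_at_infty)
  obtain ⟨d, hd, hdd⟩ := Metric.uniformContinuous_iff.1 hu (η / 2) (by positivity)
  let β : ContDiffBump (0 : Rp) := ⟨d / 2, d, by positivity, by linarith⟩
  have hs : Sm (MeasureTheory.convolution (β.normed volume) φ (ContinuousLinearMap.lsmul ℝ ℝ) volume) :=
    β.hasCompactSupport_normed.contDiff_convolution_left _ β.contDiff_normed h.continuous.locallyIntegrable
  refine ⟨_, hs, ?_⟩
  intro p
  have hD := hc.hasFDerivAt_convolution_right (ContinuousLinearMap.lsmul ℝ ℝ) (μ := volume) (f := β.normed volume)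
    (β.continuous_normed.locallyIntegrable) h p
  have hb := β.dist_normed_convolution_le (μ := volume) (g := fderiv ℝ φ) (x₀ := p) (ε := η / 2) hcd.aestronglyMeasurable
    (fun x hx => (hdd (by simpa [β] using hx)).le)
  have hD2 : HasFDerivAt (MeasureTheory.convolution (β.normed volume) φ (ContinuousLinearMap.lsmul ℝ ℝ) volume)
     (MeasureTheory.convolution (β.normed volume) (fderiv ℝ φ) (ContinuousLinearMap.lsmul ℝ ℝ) volume p) p := by fun_prop
  have hx : ∀ e : Rp, ‖e‖ ≤ 1 → |fderiv ℝ (MeasureTheory.convolution (β.normed volume) φ (ContinuousLinearMap.lsmul ℝ ℝ) volume) p e - fderiv ℝ φ p e| ≤ η := by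
    intro e he
    rw [hD2.fderiv, ← ContinuousLinearMap.sub_apply, ← nea]
    refine (ContinuousLinearMap.le_opNorm _ _).trans ?_
    rw [dist_eq_norm] at hb
    nlinarith [norm_nonneg e]
  exact ⟨hx _ (by simp ), hx _ (by simp [Prod.norm_def])⟩
lemma gauge_ex {P Q : Rp → ℝ} (h1 : Cd P UHP) (h2 : Cd Q UHP) {x0 y0 l B K η : ℝ}
    (hy : 0 < y0) (hl : 0 < l) (hη : 0 < η)
    (hK : ∀ p ∈ Set.Icc x0 (x0 + l) ×ˢ Set.Icc y0 (y0 + l), |dXr Q p - dYr P p - B| ≤ K) :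
    ∃ φ : Rp → ℝ, Sm φ ∧ ∀ p ∈ Set.Icc x0 (x0 + l) ×ˢ Set.Icc y0 (y0 + l),
      |P p - dXr φ p + B * p.2| ≤ l * K + η ∧ |Q p - dYr φ p| ≤ η := by
  set T := Set.Icc x0 (x0 + l) ×ˢ Set.Icc y0 (y0 + l) with hT
  have hTc : IsCompact T := isCompact_Icc.prod isCompact_Icc
  have hTU : T ⊆ UHP := fun p hp => lt_of_lt_of_le hy hp.2.1
  obtain ⟨ψ, ψs, ψc, ψU, ψ1⟩ := cutoff_ex hTc hTU
  have hg1 := cd_cut (n := 2) h1 ψs ψU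
  have hg2 := cd_cut (n := 2) h2 ψs ψU
  set g1 := fun p => ψ p * P p
  set g2 := fun p => ψ p * Q p
  have c1 : ContDiff ℝ 1 g1 := hg1.of_le (by norm_num)
  have c2 : ContDiff ℝ 1 g2 := hg2.of_le (by norm_num)
  have e1 : ∀ p ∈ T, g1 =ᶠ[nhds p] P := fun p hp => by
    filter_upwards [ψ1 p hp] with q hq; simp [g1, hq]
  have e2 : ∀ p ∈ T, g2 =ᶠ[nhds p] Q := fun p hp => by
    filter_upwards [ψ1 p hp] with q hq; simp [g2, hq]
  obtain ⟨φ, cφ, φx, φy⟩ := prim_ex c1 c2 (ψc.mul_right) y0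
  let φ1 : Rp → ℝ := fun p => φ p + B * y0 * p.1
  have cφ1 : ContDiff ℝ 1 φ1 := cφ.add (by fun_prop)
  have dφ := cφ.differentiable one_ne_zero
  have fφ : ∀ p e, fderiv ℝ φ1 p e = fderiv ℝ φ p e + B * y0 * e.1 := by
    intro p e
    have := ((dφ p).hasFDerivAt.add ((hasFDerivAt_fst (𝕜 := ℝ) (p := p)).const_mul (B * y0)))
    rw [HasFDerivAt.fderiv (f := φ1) this]; simp
  obtain ⟨g, gs, hg⟩ := moll (φ := fun p => ψ p * φ1 p) ((ψs.of_le (by exact_mod_cast le_top)).mul cφ1) (ψc.mul_right) hη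
  refine ⟨g, gs, fun p hp => ?_⟩
  have e3 : (fun p => ψ p * φ1 p) =ᶠ[nhds p] φ1 := by
    filter_upwards [ψ1 p hp] with q hq; simp [hq]
  have hgp := hg p
  simp only [dXr, dYr] at hgp φx φy ⊢
  rw [e3.fderiv_eq, fφ, fφ, φx, φy] at hgp
  rw [← (e1 p hp).eq_of_nhds, ← (e2 p hp).eq_of_nhds]
  simp only [mul_one, mul_zero, add_zero] at hgp
  refine ⟨?_, by rw [abs_sub_comm]; exact hgp.2⟩
  have hdg1 := c1.differentiable one_ne_zero
  have i1 : Continuous fun t => dYr g1 (p.1, t) := (cont_dr c1 _).comp (by fun_prop)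
  have i2 : Continuous fun t => dXr g2 (p.1, t) := (cont_dr c2 _).comp (by fun_prop)
  have hI : g1 p - g1 (p.1, y0) = ∫ t in y0..p.2, dYr g1 (p.1, t) :=
    (intervalIntegral.integral_eq_sub_of_hasDerivAt (fun t _ => slice_yr hdg1 p.1 t) (i1.intervalIntegrable _ _)).symm
  have hJ : ∫ t in y0..p.2, (dXr g2 (p.1, t) - dYr g1 (p.1, t) - B) = (∫ t in y0..p.2, dXr g2 (p.1, t)) - (g1 p - g1 (p.1, y0)) - B * (p.2 - y0) := by
    have i3 : Continuous fun t => dXr g2 (p.1, t) - dYr g1 (p.1, t) := i2.sub i1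
    rw [intervalIntegral.integral_sub (i3.intervalIntegrable _ _) intervalIntegrable_const,
      intervalIntegral.integral_sub (i2.intervalIntegrable _ _) (i1.intervalIntegrable _ _), hI]
    simp; ring
  have hb : |∫ t in y0..p.2, (dXr g2 (p.1, t) - dYr g1 (p.1, t) - B)| ≤ K * |p.2 - y0| := by
    rw [← nea]
    refine intervalIntegral.norm_integral_le_of_norm_le_const fun t ht => ?_
    rw [Set.uIoc_of_le hp.2.1] at ht
    have htT : (p.1, t) ∈ T := ⟨hp.1, ⟨ht.1.le, ht.2.trans hp.2.2⟩⟩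
    have := hK _ htT
    simp only [dXr, dYr] at this ⊢
    rwa [(e1 _ htT).fderiv_eq, (e2 _ htT).fderiv_eq]
  have hK0 : 0 ≤ K := (abs_nonneg _).trans (hK p hp)
  have hb2 : K * |p.2 - y0| ≤ l * K := by
    rw [abs_of_nonneg (by linarith [hp.2.1])]
    nlinarith [hp.2.2]
  rw [hJ] at hb
  have hh := hgp.1
  simp only [dXr] at hb
  rw [abs_le] at hb hh ⊢
  constructor <;> linarith [hb.1, hb.2, hh.1, hh.2]
def cE (φ : Rp → ℝ) (p : Rp) : ℂ := Complex.exp ((φ p : ℂ) * Ii)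
lemma cE_norm (φ : Rp → ℝ) (p : Rp) : ‖cE φ p‖ = 1 := Complex.norm_exp_ofReal_mul_I _
lemma cE_smooth {φ : Rp → ℝ} (h : Sm φ) : Sm (cE φ) :=
  ((Complex.ofRealCLM.contDiff.comp h).mul contDiff_const).cexp
lemma fd_rmul {χ : Rp → ℝ} {u : Rp → ℂ} {p : Rp} (hχ : DifferentiableAt ℝ χ p) (hu : DifferentiableAt ℝ u p) (e : Rp) :
    fderiv ℝ (fun p => (χ p : ℂ) * u p) p e = ((fderiv ℝ χ p e : ℝ) : ℂ) * u p + (χ p : ℂ) * fderiv ℝ u p e := by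
  have h1 : HasFDerivAt (fun p => (χ p : ℂ)) (Complex.ofRealCLM.comp (fderiv ℝ χ p)) p :=
    Complex.ofRealCLM.hasFDerivAt.comp p hχ.hasFDerivAt
  rw [(h1.fun_mul hu.hasFDerivAt).fderiv]
  simp; ring
lemma fd_emul {φ : Rp → ℝ} {u : Rp → ℂ} {p : Rp} (hφ : DifferentiableAt ℝ φ p) (hu : DifferentiableAt ℝ u p) (e : Rp) :
    fderiv ℝ (fun p => cE φ p * u p) p e = cE φ p * (Ii * (fderiv ℝ φ p e : ℝ) * u p + fderiv ℝ u p e) := by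
  have h1 : HasFDerivAt (fun p => (φ p : ℂ)) (Complex.ofRealCLM.comp (fderiv ℝ φ p)) p :=
    Complex.ofRealCLM.hasFDerivAt.comp p hφ.hasFDerivAt
  have h2 : HasFDerivAt (cE φ) _ p := (h1.mul_const Ii).cexp
  rw [(h2.fun_mul hu.hasFDerivAt).fderiv]
  simp [cE]; ring
lemma dens_gauge {φ : Rp → ℝ} {u : Rp → ℂ} {p : Rp} (hφ : DifferentiableAt ℝ φ p) (hu : DifferentiableAt ℝ u p) (P Q : Rp → ℝ) :
    dens P Q (fun p => cE φ p * u p) p = dens (fun p => P p - dXr φ p) (fun p => Q p - dYr φ p) u p := by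
  simp only [dens, dX, dY, fd_emul hφ hu, dXr, dYr]
  have : ∀ d A z w : ℂ, -Ii * (cE φ p * (Ii * d * z + w)) - A * (cE φ p * z) = cE φ p * (-Ii * w - (A - d) * z) := by
    intro d A z w; linear_combination (-cE φ p * d * z) * Complex.I_sq
  rw [this, this, norm_mul, norm_mul, cE_norm]
  simp
lemma ims_one (c d A : ℝ) (z w : ℂ) : ‖-Ii * ((d : ℂ) * z + (c : ℂ) * w) - (A : ℂ) * ((c : ℂ) * z)‖ ^ 2 =
    c ^ 2 * ‖-Ii * w - A * z‖ ^ 2 + d ^ 2 * ‖z‖ ^ 2 + (c * d) * (2 * (w.re * z.re + w.im * z.im)) := by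
  simp only [← Complex.normSq_eq_norm_sq, Complex.normSq_apply]
  simp; ring
lemma ims_sum {ι : Type*} {s : Finset ι} {χ : ι → Rp → ℝ} (hχ : ∀ i, Sm (χ i)) {u : Rp → ℂ} {p : Rp}
    (hu : DifferentiableAt ℝ u p) (h1 : ∀ᶠ q in nhds p, ∑ i ∈ s, χ i q ^ 2 = 1) (P Q : Rp → ℝ) :
    ∑ i ∈ s, dens P Q (fun p => (χ i p : ℂ) * u p) p = dens P Q u p +
      (∑ i ∈ s, (dXr (χ i) p ^ 2 + dYr (χ i) p ^ 2)) * ‖u p‖ ^ 2 := by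
  have hd : ∀ i, DifferentiableAt ℝ (χ i) p := fun i => sm_diff (hχ i) p
  have hz : ∀ e, ∑ i ∈ s, χ i p * fderiv ℝ (χ i) p e = 0 := by
    intro e
    have hs : HasFDerivAt (fun q => ∑ i ∈ s, χ i q ^ 2) (∑ i ∈ s, ((2 * χ i p ^ 1) • fderiv ℝ (χ i) p)) p :=
      HasFDerivAt.fun_sum fun i _ => by simpa using! (hd i).hasFDerivAt.pow 2
    have hc : (fun q => ∑ i ∈ s, χ i q ^ 2) =ᶠ[nhds p] fun _ => 1 := h1
    have := hs.fderiv
    rw [hc.fderiv_eq] at this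
    have h2 := congrArg (fun L : Rp →L[ℝ] ℝ => L e) this
    simp [mul_assoc, ← Finset.mul_sum] at h2
    exact h2
  have h1p := h1.self_of_nhds
  simp only [dens, dX, dY, fd_rmul (hd _) hu, ims_one, dXr, dYr]
  simp only [Finset.sum_add_distrib, ← Finset.sum_mul, hz, h1p]
  ring
lemma sq_pert {α β τ : ℝ} {f w : ℂ} (hτ : 0 < τ) : ‖w - (α : ℂ) * f‖ ^ 2 ≥ (1 - τ) * ‖w - (β : ℂ) * f‖ ^ 2 - τ⁻¹ * ((α - β) ^ 2 * ‖f‖ ^ 2) := by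
  have h : ‖w - (β : ℂ) * f‖ ≤ ‖w - (α : ℂ) * f‖ + |α - β| * ‖f‖ := by
    have : w - (β : ℂ) * f = (w - (α : ℂ) * f) + ((α - β : ℝ) : ℂ) * f := by push_cast; ring
    rw [this]
    refine (norm_add_le _ _).trans (le_of_eq ?_)
    rw [norm_mul, Complex.norm_real, nea]
  rw [← sq_abs (α - β), ← mul_pow]
  set x := ‖w - (β : ℂ) * f‖
  set y := ‖w - (α : ℂ) * f‖
  set z := |α - β| * ‖f‖
  rcases le_or_gt 1 τ with h1 | h1
  · have : 0 ≤ τ⁻¹ * z ^ 2 := by positivity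
    nlinarith [sq_nonneg y]
  have h2 : (1 - τ) * x ^ 2 ≤ (1 - τ) * (y + z) ^ 2 := by
    apply mll _ (by linarith); gcongr
  have h3 : y ^ 2 - (1 - τ) * (y + z) ^ 2 + τ⁻¹ * z ^ 2 = τ⁻¹ * ((τ * y - (1 - τ) * z) ^ 2 + τ * (1-τ)*z^2 *0 + (τ * z^2 - τ*z^2) + (1 - (1-τ)^2 - τ * (1 - τ)) * z ^ 2) := by grind
  have h4 : 0 ≤ τ⁻¹ * ((τ * y - (1 - τ) * z) ^ 2 + τ * (1-τ)*z^2 *0 + (τ * z^2 - τ*z^2) + (1 - (1-τ)^2 - τ * (1 - τ)) * z ^ 2) := by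
    have : (1 - (1-τ)^2 - τ * (1 - τ)) = τ := by ring
    rw [this]
    have e : (τ * y - (1 - τ) * z) ^ 2 + τ * (1-τ)*z^2 *0 + (τ * z^2 - τ*z^2) + τ * z ^ 2 = (τ * y - (1 - τ) * z) ^ 2 + τ * z ^ 2 := by ring
    rw [e]; positivity
  linarith
lemma sq_pert' {α β τ : ℝ} {f w : ℂ} (hτ : 0 < τ) : ‖w - (α : ℂ) * f‖ ^ 2 ≤ (1 + τ) * ‖w - (β : ℂ) * f‖ ^ 2 + (1 + τ⁻¹) * ((α - β) ^ 2 * ‖f‖ ^ 2) := by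
  have h : ‖w - (α : ℂ) * f‖ ≤ ‖w - (β : ℂ) * f‖ + |α - β| * ‖f‖ := by
    have : w - (α : ℂ) * f = (w - (β : ℂ) * f) - ((α - β : ℝ) : ℂ) * f := by push_cast; ring
    rw [this]
    refine (norm_sub_le _ _).trans (le_of_eq ?_)
    rw [norm_mul, Complex.norm_real, nea]
  rw [← sq_abs (α - β), ← mul_pow]
  set x := ‖w - (β : ℂ) * f‖
  set y := ‖w - (α : ℂ) * f‖
  set z := |α - β| * ‖f‖
  have h2 : y ^ 2 ≤ (x + z) ^ 2 := by gcongr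
  have h3 : (1 + τ) * x ^ 2 + (1 + τ⁻¹) * z ^ 2 - (x + z) ^ 2 = τ⁻¹ * (τ * x - z) ^ 2 := by grind
  have : 0 ≤ τ⁻¹ * (τ * x - z) ^ 2 := by positivity
  linarith
lemma dens_pert {P Q B₁ B₂ : Rp → ℝ} {f : Rp → ℂ} {p : Rp} {τ e : ℝ} (hτ : 0 < τ)
    (h1 : f p ≠ 0 → |P p - B₁ p| ≤ e ∧ |Q p - B₂ p| ≤ e) :
    (1 - τ) * dens B₁ B₂ f p - τ⁻¹ * (2 * e ^ 2) * ‖f p‖ ^ 2 ≤ dens P Q f p ∧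
    dens P Q f p ≤ (1 + τ) * dens B₁ B₂ f p + (1 + τ⁻¹) * (2 * e ^ 2) * ‖f p‖ ^ 2 := by
  have a1 := sq_pert (α := P p) (β := B₁ p) (f := f p) (w := -Ii * dX f p) hτ
  have a2 := sq_pert (α := Q p) (β := B₂ p) (f := f p) (w := -Ii * dY f p) hτ
  have b1 := sq_pert' (α := P p) (β := B₁ p) (f := f p) (w := -Ii * dX f p) hτ
  have b2 := sq_pert' (α := Q p) (β := B₂ p) (f := f p) (w := -Ii * dY f p) hτ
  have c : (P p - B₁ p) ^ 2 * ‖f p‖ ^ 2 ≤ e ^ 2 * ‖f p‖ ^ 2 ∧ (Q p - B₂ p) ^ 2 * ‖f p‖ ^ 2 ≤ e ^ 2 * ‖f p‖ ^ 2 := by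
    by_cases h : f p = 0
    · simp [h]
    · obtain ⟨h1, h2⟩ := h1 h
      constructor <;> apply mlr _ (by positivity)
      · exact sq_le_sq' (by linarith [(abs_le.1 h1).1]) (abs_le.1 h1).2
      · exact sq_le_sq' (by linarith [(abs_le.1 h2).1]) (abs_le.1 h2).2
  have t1 : 0 < τ⁻¹ := by positivity
  simp only [dens]
  constructor <;> nlinarith [mll c.2 t1.le, c.1, c.2]
lemma cont_cut {A g : Rp → ℝ} (hA : ContinuousOn A UHP) (hg : Continuous g) (hs : tsupport g ⊆ UHP) :
    Continuous (fun p => A p * g p) := by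
  rw [continuous_iff_continuousAt]
  intro p
  by_cases hp : p ∈ UHP
  · exact (hA.continuousAt (UHP_open.mem_nhds hp)).mul hg.continuousAt
  · have : (fun p => A p * g p) =ᶠ[nhds p] fun _ => 0 := by
      filter_upwards [(isClosed_tsupport g).isOpen_compl.mem_nhds (fun h => hp (hs h))] with q hq
      rw [izt hq, mul_zero]
    exact continuousAt_const.congr this.symm
lemma int_cut {A g : Rp → ℝ} (hA : ContinuousOn A UHP) (hg : Continuous g) (hc : Hc g) (hs : tsupport g ⊆ UHP) :
    Integrable (fun p => A p * g p) :=
  (cont_cut hA hg hs).integrable_of_hasCompactSupport hc.mul_left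
lemma fd_nsq {v : Rp → ℂ} {p : Rp} (hv : DifferentiableAt ℝ v p) (e : Rp) :
    fderiv ℝ (fun p => ‖v p‖ ^ 2) p e = 2 * ((v p).re * (fderiv ℝ v p e).re + (v p).im * (fderiv ℝ v p e).im) := by
  rw [(hv.hasFDerivAt.norm_sq).fderiv]
  simp ; ring
lemma sym_zero {v : Rp → ℂ} (hv : Sm v) (hc : Hc v) :
    ∫ p, ((starRingEnd ℂ (dX v p)) * dY v p).im = 0 := by
  let w : Rp → ℂ := fun p => starRingEnd ℂ (v p)
  have hw : Sm w := Complex.conjCLE.contDiff.comp hv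
  have hwc : Hc w := hc.comp_left (map_zero _)
  have fw : ∀ p e, fderiv ℝ w p e = starRingEnd ℂ (fderiv ℝ v p e) := by
    intro p e
    have : HasFDerivAt w _ p := Complex.conjCLE.hasFDerivAt.comp p (sm_diff hv p).hasFDerivAt
    rw [this.fderiv]; simp
  have ff : ∀ p e f, fderiv ℝ (fun q => fderiv ℝ v q e) p f = fderiv ℝ (fderiv ℝ v) p f e := by
    intro p e f
    have h := ((hv.fderiv_right (m := (⊤ : ℕ∞)) (by norm_cast)).differentiable (by simp) p).hasFDerivAt.clm_apply (hasFDerivAt_const e p)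
    rw [h.fderiv]; simp
  have sy : ∀ p, fderiv ℝ (fun q => fderiv ℝ v q (1,0)) p (0,1) = fderiv ℝ (fun q => fderiv ℝ v q (0,1)) p (1,0) := by
    intro p
    rw [ff, ff]
    exact (hv.contDiffAt.isSymmSndFDerivAt (by rw [minSmoothness_of_isRCLikeNormedField]; change ((2 : ℕ∞) : WithTop ℕ∞) ≤ _; exact_mod_cast le_top)) _ _
  have int : ∀ {f g : Rp → ℂ}, Sm f → Sm g → Hc f → Integrable (fun p => f p * g p) :=
    fun hf hg hc => (hf.continuous.mul hg.continuous).integrable_of_hasCompactSupport hc.mul_right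
  have ibp : ∀ {g : Rp → ℂ}, Sm g → ∀ e, ∫ p, w p * fderiv ℝ g p e = - ∫ p, fderiv ℝ w p e * g p := by
    intro g hg e
    exact integral_mul_fderiv_eq_neg_fderiv_mul_of_integrable (int (sm_fd hw e) hg (cs_fd hwc e)) (int hw (sm_fd hg e) hwc) (int hw hg hwc)
      (fun x _ => sm_diff hw x) (fun x _ => sm_diff hg x)
  have e1 := ibp (sm_fd hv (0,1)) (1,0)
  have e2 := ibp (sm_fd hv (1,0)) (0,1)
  simp only [sy] at e2
  rw [e1, neg_inj] at e2
  have i1 := int (sm_fd hw (1,0)) (sm_fd hv (0,1)) (cs_fd hwc _)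
  have i2 := int (sm_fd hw (0,1)) (sm_fd hv (1,0)) (cs_fd hwc _)
  have e3 : ∫ p, (fderiv ℝ w p (1,0) * fderiv ℝ v p (0,1) - fderiv ℝ w p (0,1) * fderiv ℝ v p (1,0)) = 0 := by
    rw [integral_sub i1 i2, e2, sub_self]
  have e4 := congrArg Complex.im e3
  have e5 : (∫ p, (fderiv ℝ w p (1,0) * fderiv ℝ v p (0,1) - fderiv ℝ w p (0,1) * fderiv ℝ v p (1,0))).im =
    ∫ p, (fderiv ℝ w p (1,0) * fderiv ℝ v p (0,1) - fderiv ℝ w p (0,1) * fderiv ℝ v p (1,0)).im :=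
    (Complex.imCLM.integral_comp_comm (i1.sub i2)).symm
  rw [e5] at e4
  have e6 : ∀ p, (fderiv ℝ w p (1,0) * fderiv ℝ v p (0,1) - fderiv ℝ w p (0,1) * fderiv ℝ v p (1,0)).im = 2 * ((starRingEnd ℂ (dX v p)) * dY v p).im := by
    intro p; rw [fw, fw]; simp [dX, dY]; ring
  simp only [e6, icm, Complex.zero_im] at e4
  linarith
lemma dens_int {P Q : Rp → ℝ} (h1 : ContinuousOn P UHP) (h2 : ContinuousOn Q UHP) {v : Rp → ℂ} (hv : IsTestOn UHP v) :
    Integrable (dens P Q v) := by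
  have a := (test_D h1 hv).1
  have b := (test_D h2 hv).2
  have i1 : Integrable (fun p => ‖-Ii * dX v p - (P p : ℂ) * v p‖ ^ 2) :=
    (a.1.norm.pow 2).integrable_of_hasCompactSupport (nsq_cs a.2)
  have i2 : Integrable (fun p => ‖-Ii * dY v p - (Q p : ℂ) * v p‖ ^ 2) :=
    (b.1.norm.pow 2).integrable_of_hasCompactSupport (nsq_cs b.2)
  exact i1.add i2
lemma cd_on {A : Rp → ℝ} (h : Cd A UHP) (e : Rp) : ContDiffOn ℝ 1 (fun p => fderiv ℝ A p e) UHP :=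
  (h.fderiv_of_isOpen UHP_open (m := 1) (by norm_num)).clm_apply contDiffOn_const
lemma mag_lower {P Q : Rp → ℝ} (h1 : Cd P UHP) (h2 : Cd Q UHP) {v : Rp → ℂ} (hv : IsTestOn UHP v)
    {σ L : ℝ} (hσ : σ ^ 2 = 1) (hL : ∀ p, v p ≠ 0 → L ≤ σ * fieldB P Q p) : L * wn v ≤ ∫ p, dens P Q v p := by
  have hN := hv.1.continuous.norm.pow 2
  have hNc := nsq_cs hv.2.1
  have hNd := hv.1.norm_sq ℝ
  have hNs : tsupport (fun p => ‖v p‖ ^ 2) ⊆ tsupport v := closure_mono (fun p hp => by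
    simp at hp ⊢; intro h; exact hp (by simp [h]))
  have hfs := fun e =>
    (tsupport_fderiv_apply_subset ℝ e).trans (hNs.trans hv.2.2)
  have ibp : ∀ {A : Rp → ℝ}, Cd A UHP → ∀ e, Integrable (fun p => A p * fderiv ℝ (fun p => ‖v p‖ ^ 2) p e) ∧
      Integrable (fun p => fderiv ℝ A p e * ‖v p‖ ^ 2) ∧ 
      ∫ p, A p * fderiv ℝ (fun p => ‖v p‖ ^ 2) p e = - ∫ p, fderiv ℝ A p e * ‖v p‖ ^ 2 := by
    intro A hA e
    have j1 := int_cut hA.continuousOn (sm_fd hNd e).continuous (cs_fd hNc e) (hfs e)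
    have j2 := int_cut (cd_on hA e).continuousOn hN hNc (hNs.trans hv.2.2)
    refine ⟨j1, j2, integral_mul_fderiv_eq_neg_fderiv_mul_of_integrable j2 j1 (int_cut hA.continuousOn hN hNc (hNs.trans hv.2.2))
      (fun x hx => ?_) (fun x _ => hNd.differentiable (by simp) x)⟩
    exact (hA.contDiffAt (UHP_open.mem_nhds (hv.2.2 (hNs hx)))).differentiableAt (by simp)
  obtain ⟨i1, i2, i3⟩ := ibp h1 (0, 1)
  obtain ⟨i4, i5, i6⟩ := ibp h2 (1, 0)
  have i7 : Integrable (fun p => ((starRingEnd ℂ (dX v p)) * dY v p).im) := by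
    have c1 := (sm_dX hv.1).continuous
    have c2 := (sm_dY hv.1).continuous
    refine icc (by fun_prop) ?_
    exact HasCompactSupport.comp_left (g := Complex.im) (f := fun p => (starRingEnd ℂ (dX v p)) * dY v p) ((cs_dY hv.2.1).mul_left) rfl
  have i8 : Integrable (fun p => (p.2 ^ 2)⁻¹ * ‖v p‖ ^ 2) := by
    refine int_cut (A := fun p => (p.2 ^ 2)⁻¹) ?_ hN hNc (hNs.trans hv.2.2)
    exact (continuousOn_snd.pow 2).inv₀ fun p hp => pow_ne_zero _ (ne_of_gt hp)
  have key : ∀ p, L * ((p.2 ^ 2)⁻¹ * ‖v p‖ ^ 2) ≤ σ * (fderiv ℝ Q p (1,0) * ‖v p‖ ^ 2 - fderiv ℝ P p (0,1) * ‖v p‖ ^ 2) := by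
    intro p
    by_cases h0 : v p = 0
    · simp [h0]
    have hp : 0 < p.2 := hv.2.2 (subset_tsupport v h0)
    have := hL p h0
    rw [fieldB, dXr, dYr] at this
    have h3 : L * (p.2 ^ 2)⁻¹ ≤ σ * (fderiv ℝ Q p (1,0) - fderiv ℝ P p (0,1)) := by
      rw [← div_eq_mul_inv, div_le_iff₀ (by positivity)]; linarith
    have h4 : 0 ≤ ‖v p‖ ^ 2 := by positivity
    nlinarith [mlr h3 h4]
  have key2 : ∀ p, σ * (2 * ((starRingEnd ℂ (dX v p)) * dY v p).im - Q p * fderiv ℝ (fun p => ‖v p‖ ^ 2) p (1,0) + P p * fderiv ℝ (fun p => ‖v p‖ ^ 2) p (0,1)) ≤ dens P Q v p := by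
    intro p
    rw [fd_nsq (sm_diff hv.1 p), fd_nsq (sm_diff hv.1 p)]
    simp only [dens, ← Complex.normSq_eq_norm_sq, Complex.normSq_apply]
    change _ * (_ - Q p * (2 * ((v p).re * (dX v p).re + (v p).im * (dX v p).im)) + P p * (2 * ((v p).re * (dY v p).re + (v p).im * (dY v p).im))) ≤ _
    simp
    generalize (dX v p).re = a
    generalize (dX v p).im = b
    generalize (dY v p).re = c
    generalize (dY v p).im = d
    generalize (v p).re = x
    generalize (v p).im = y
    generalize P p = m
    generalize Q p = n
    have e : ∀ s : ℝ, s ^ 2 = 1 → 0 ≤ ((b - m * x) - s * (-c - n * y)) ^ 2 + ((-a - m * y) + s * (d - n * x)) ^ 2 := fun s _ => by positivity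
    have e1 := e σ hσ
    have e2 := e (-σ) (by simpa using hσ)
    nlinarith [e2, hσ]
  have key3 : ∀ p, L * ((p.2 ^ 2)⁻¹ * ‖v p‖ ^ 2) - dens P Q v p ≤ σ * ((fderiv ℝ Q p (1,0) * ‖v p‖ ^ 2 - fderiv ℝ P p (0,1) * ‖v p‖ ^ 2)
      - (2 * ((starRingEnd ℂ (dX v p)) * dY v p).im - Q p * fderiv ℝ (fun p => ‖v p‖ ^ 2) p (1,0) + P p * fderiv ℝ (fun p => ‖v p‖ ^ 2) p (0,1))) := by grind
  have hd := dens_int h1.continuousOn h2.continuousOn hv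
  have fin := integral_mono ((i8.const_mul L).sub hd) (((i5.sub i2).sub (((i7.const_mul 2).sub i4).add i1)).const_mul σ) key3
  simp only [Pi.sub_apply, Pi.add_apply] at fin
  rw [integral_sub (i8.const_mul L) hd, icm, icm, 
    integral_sub (f := fun a => fderiv ℝ Q a (1, 0) * ‖v a‖ ^ 2 - fderiv ℝ P a (0, 1) * ‖v a‖ ^ 2)
      (g := fun a => 2 * ((starRingEnd ℂ (dX v a)) * dY v a).im - Q a * fderiv ℝ (fun p => ‖v p‖ ^ 2) a (1, 0) + P a * fderiv ℝ (fun p => ‖v p‖ ^ 2) a (0, 1)) (i5.sub i2) (((i7.const_mul 2).sub i4).add i1),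
    integral_sub i5 i2, integral_add (f := fun a => 2 * ((starRingEnd ℂ (dX v a)) * dY v a).im - Q a * fderiv ℝ (fun p => ‖v p‖ ^ 2) a (1, 0)) ((i7.const_mul 2).sub i4) i1, integral_sub (i7.const_mul 2) i4, icm, sym_zero hv.1 hv.2.1, i3, i6] at fin
  have : wn v = ∫ p, (p.2 ^ 2)⁻¹ * ‖v p‖ ^ 2 := rfl
  grind
lemma lF_fub {B : ℝ} (hB : B ≠ 0) (k : ℕ) {W : Rp → ℝ} (hW : Continuous W) (hc : Hc W) :
    Integrable (fun ζ => ∫ p, W p * ‖lF B ζ k p‖ ^ 2) ∧ ∫ ζ, ∫ p, W p * ‖lF B ζ k p‖ ^ 2 = |B| / (2 * π) * ∫ p, W p := by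
  have hlc := (lF_cont B k).comp (f := fun q : (Rp) × ℝ => (q.2, q.1)) (by fun_prop)
  have hi : Integrable (Function.uncurry fun (p : Rp) (ζ : ℝ) => W p * ‖lF B ζ k p‖ ^ 2) (volume.prod volume) := by
    rw [integrable_prod_iff (Continuous.aestronglyMeasurable (by simp only [Function.uncurry_def]; fun_prop))]
    refine ⟨evf fun p => by simp; exact (lF_dens hB k p).1.const_mul (W p), ?_⟩
    have : (fun p : Rp => ∫ ζ : ℝ, ‖Function.uncurry (fun (p : Rp) (ζ : ℝ) => W p * ‖lF B ζ k p‖ ^ 2) (p, ζ)‖) = fun p => ‖W p‖ * (|B| / (2 * π)) := by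
      funext p
      simp
      rw [icm, (lF_dens hB k p).2]
    rw [this]
    exact ((hW.integrable_of_hasCompactSupport hc).norm).mul_const _
  refine ⟨hi.integral_prod_right, ?_⟩
  rw [← integral_integral_swap hi]
  simp only [icm, (lF_dens hB k _).2, integral_mul_const]
  ring
lemma rmul_test {χ : Rp → ℝ} (hχ : Sm χ) {u : Rp → ℂ} (hu : IsTestOn UHP u) :
    IsTestOn UHP (fun p => (χ p : ℂ) * u p) :=
  ⟨(Complex.ofRealCLM.contDiff.comp hχ).mul hu.1, hu.2.1.mul_left, (tsupport_mul_subset_right).trans hu.2.2⟩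
lemma nint {v : Rp → ℂ} (hv : Continuous v) (hc : Hc v) : Integrable (fun p => ‖v p‖ ^ 2) :=
  (hv.norm.pow 2).integrable_of_hasCompactSupport (nsq_cs hc)
lemma mdens_eq (B : ℝ) (v : Rp → ℂ) (p : Rp) : dens (fun p => -(B * p.2)) (fun _ => 0) v p =
    ‖-Ii * dX v p + ((B * p.2 : ℝ) : ℂ) * v p‖ ^ 2 + ‖-Ii * dY v p‖ ^ 2 := by
  simp [dens]
lemma tile_up {P Q φ χ : Rp → ℝ} (h1 : ContinuousOn P UHP) (h2 : ContinuousOn Q UHP)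
    (hφ : Sm φ) (hχ : Sm χ) (hχc : Hc χ)
    {B ε τ L : ℝ} (hB : B ≠ 0) (hτ : 0 < τ) (hτ1 : τ < 1) {K : ℕ} (hK : L ≤ (2 * K + 1) * |B|)
    (hK' : ∀ k : ℕ, k < K → (2 * k + 1) * |B| ≤ L)
    (hε : ∀ p, χ p ≠ 0 → |P p - dXr φ p + B * p.2| ≤ ε ∧ |Q p - dYr φ p| ≤ ε)
    {N : ℕ} {e : Fin N → Rp → ℂ} (he : ∀ i, IsTestOn UHP (e i))
    (ho : ∀ i j, wi (e i) (e j) = if i = j then 1 else 0) :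
    ∑ j, (((1 - τ) * L - τ⁻¹ * (2 * ε ^ 2)) * (∫ p, ‖(χ p : ℂ) * e j p‖ ^ 2) - ∫ p, dens P Q (fun p => (χ p : ℂ) * e j p) p) ≤
      (1 - τ) * (K * |B| * (L - K * |B|)) / (2 * π) * ∫ p, p.2 ^ 2 * χ p ^ 2 := by
  let v : Fin N → Rp → ℂ := fun j p => cE (fun p => -φ p) p * ((χ p : ℂ) * e j p)
  have hφ' : Sm (fun p => -φ p) := hφ.neg
  have hu : ∀ j, IsTestOn UHP (fun p => (χ p : ℂ) * e j p) := fun j => rmul_test hχ (he j)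
  have hv : ∀ j, Sm (v j) := fun j => (cE_smooth hφ').mul (hu j).1
  have hvc : ∀ j, Hc (v j) := fun j => (hu j).2.1.mul_left
  have hvt : ∀ j, IsTestOn UHP (v j) := fun j => ⟨hv j, hvc j, (tsupport_mul_subset_right).trans (hu j).2.2⟩
  have hvn : ∀ j p, ‖v j p‖ = ‖(χ p : ℂ) * e j p‖ := fun j p => by
    simp only [v]; rw [norm_mul (cE _ _), cE_norm, one_mul]
  have huv : ∀ j, (fun p => (χ p : ℂ) * e j p) = fun p => cE φ p * v j p := by
    intro j; funext p; simp only [v, cE]; rw [← mul_assoc, ← Complex.exp_add]; simp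
  have s1 : ∀ j, ((1 - τ) * L - τ⁻¹ * (2 * ε ^ 2)) * (∫ p, ‖(χ p : ℂ) * e j p‖ ^ 2) - ∫ p, dens P Q (fun p => (χ p : ℂ) * e j p) p ≤
      (1 - τ) * ∑ k ∈ Finset.range K, (L - (2 * k + 1) * |B|) * ∫ ζ, ‖∫ p, starRingEnd ℂ (lF B ζ k p) * v j p‖ ^ 2 := by
    intro j
    have l := (landau_upper (hv j) (hvc j) hB L K hK).2
    simp only [← mdens_eq] at l
    refine le_trans ?_ (mll l (by linarith))
    simp only [← hvn]
    have i1 := dens_int h1 h2 (hu j)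
    have i2 : Integrable (dens (fun p => -(B * p.2)) (fun _ => 0) (v j)) := dens_int (by fun_prop) (by fun_prop) (hvt j)
    have i3 := nint (hv j).continuous (hvc j)
    have pw : ∀ p, (1 - τ) * dens (fun p => -(B * p.2)) (fun _ => 0) (v j) p - τ⁻¹ * (2 * ε ^ 2) * ‖v j p‖ ^ 2 ≤ dens P Q (fun p => (χ p : ℂ) * e j p) p := by
      intro p
      rw [huv j, dens_gauge (sm_diff hφ p) (sm_diff (hv j) p)]
      refine (dens_pert hτ fun h => ?_).1
      have hc0 : χ p ≠ 0 := by rintro h0; apply h; simp [v, h0]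
      grind
    have := integral_mono ((i2.const_mul (1 - τ)).sub (i3.const_mul (τ⁻¹ * (2 * ε ^ 2)))) i1 pw
    simp at this
    rw [integral_sub (i2.const_mul _) (i3.const_mul _), icm, icm] at this
    linarith
  refine (Finset.sum_le_sum fun j _ => s1 j).trans ?_
  rw [← Finset.mul_sum, Finset.sum_comm]
  simp only [← Finset.mul_sum]
  have s2 : ∀ k : ℕ, ∑ j, ∫ ζ, ‖∫ p, starRingEnd ℂ (lF B ζ k p) * v j p‖ ^ 2 ≤ |B| / (2 * π) * ∫ p, p.2 ^ 2 * χ p ^ 2 := by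
    intro k
    have hii := fun j => (landau_upper (hv j) (hvc j) hB L K hK).1 k
    have hWc : Hc (fun p : Rp => p.2 ^ 2 * χ p ^ 2) := (hχc.comp_left (g := fun t : ℝ => t ^ 2) (by simp)).mul_left
    have hW : Continuous (fun p : Rp => p.2 ^ 2 * χ p ^ 2) := by fun_prop
    rw [← integral_finsetSum _ (fun j _ => hii j), ← (lF_fub hB k hW hWc).2]
    refine integral_mono (integrable_finsetSum _ fun j _ => hii j) (lF_fub hB k hW hWc).1 fun ζ => ?_
    have b := wi_bessel he ho (g := fun p => cE φ p * ((χ p : ℂ) * lF B ζ k p)) 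
      ((cE_smooth hφ).continuous.mul ((Complex.continuous_ofReal.comp hχ.continuous).mul (lF_cont' B ζ k)))
      ((HasCompactSupport.mul_right (hχc.comp_left (g := fun t : ℝ => (t : ℂ)) (by simp))).mul_left)
    refine le_trans (le_of_eq ?_) (b.trans (le_of_eq ?_))
    · refine Finset.sum_congr rfl fun j _ => ?_
      congr 3; funext p
      simp only [v, cE, map_mul, ← Complex.exp_conj, Complex.conj_I]
      simp; ring
    · congr 1; funext p
      rw [norm_mul, norm_mul, cE_norm, Complex.norm_real, nea, one_mul, mul_pow, sq_abs]; ring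
  have s3 : ∑ k ∈ Finset.range K, (L - (2 * k + 1) * |B|) = K * (L - K * |B|) := by
    clear hK hK' s1
    induction K with
    | zero => simp
    | succ n ih => rw [Finset.sum_range_succ, ih]; grind
  have s4 : ∑ k ∈ Finset.range K, (L - (2 * k + 1) * |B|) * ∑ j, ∫ ζ, ‖∫ p, starRingEnd ℂ (lF B ζ k p) * v j p‖ ^ 2 ≤
     ∑ k ∈ Finset.range K, (L - (2 * k + 1) * |B|) * (|B| / (2 * π) * ∫ p, p.2 ^ 2 * χ p ^ 2) :=
    Finset.sum_le_sum fun k hk => mll (s2 k) (by linarith [hK' k (Finset.mem_range.1 hk)])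
  rw [← Finset.sum_mul, s3] at s4
  refine (mll s4 (by linarith)).trans (le_of_eq ?_)
  ring
def nn (b lam : ℝ) : ℕ := ⌈(lam / b - 1) / 2⌉₊
def nu (b lam : ℝ) : ℝ := if b = 0 then lam / 2 else b * nn b lam
def Gt (b lam : ℝ) : ℝ := nu b lam * (lam - nu b lam)
lemma nn_lt {b lam : ℝ} (hb : 0 < b) (k : ℕ) : k < nn b lam ↔ (2 * k + 1) * b < lam := by
  rw [nn, Nat.lt_ceil, lt_div_iff₀ (by norm_num), lt_sub_iff_add_lt, lt_div_iff₀ hb]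
  grind
lemma nn_le {b lam : ℝ} (hb : 0 < b) : lam ≤ (2 * (nn b lam : ℝ) + 1) * b :=
  not_lt.1 fun h => lt_irrefl _ ((nn_lt hb _).2 h)
lemma nu_nonneg {b lam : ℝ} (hb : 0 ≤ b) (hl : 0 ≤ lam) : 0 ≤ nu b lam := by
  unfold nu; positivity
lemma Gt_max {b lam : ℝ} (hb : 0 < b) (n : ℕ) : n * b * (lam - n * b) ≤ Gt b lam := by
  have h1 := nn_le (lam := lam) hb
  rw [Gt, nu, if_neg hb.ne']
  set N := nn b lam with hN
  rcases lt_trichotomy n N with h | h | h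
  · have h2 : (2 * ((N - 1 : ℕ) : ℝ) + 1) * b < lam := (nn_lt hb _).1 (by omega)
    rw [Nat.cast_sub (by omega)] at h2
    have h3 : (n : ℝ) + 1 ≤ N := by exact_mod_cast h
    push_cast at h2
    have h4 : (n + N : ℝ) * b ≤ (2 * N - 1) * b := by gcongr; linarith
    nlinarith 
  · rw [h]; linarith
  · have h3 : (N : ℝ) + 1 ≤ n := by exact_mod_cast h
    have h4 : (2 * N + 1) * b ≤ (n + N : ℝ) * b := mlr (by linarith) hb.le
    nlinarith 
lemma Gt_nu {b : ℝ} (hb : 0 ≤ b) (lam mu : ℝ) : nu b mu * (lam - nu b mu) ≤ Gt b lam := by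
  rcases hb.eq_or_lt with h | h
  · subst h; simp only [Gt, nu, if_true]; nlinarith [sq_nonneg (lam - mu)]
  · have := Gt_max (lam := lam) h (nn b mu)
    simp only [nu, if_neg h.ne']; linarith
lemma Gt_sub_le {b : ℝ} (hb : 0 ≤ b) (l1 l2 : ℝ) : Gt b l2 - Gt b l1 ≤ (l2 - l1) * nu b l2 := by
  have := Gt_nu hb l1 l2; simp only [Gt] at *; linarith
lemma Gt_nonneg {b lam : ℝ} (hb : 0 ≤ b) : 0 ≤ Gt b lam := by
  rcases hb.eq_or_lt with h | h
  · subst h; simp only [Gt, nu, if_true]; nlinarith [sq_nonneg lam]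
  · simpa using Gt_max (lam := lam) h 0
lemma Gt_mono {b l1 l2 : ℝ} (hb : 0 ≤ b) (h1 : 0 ≤ l1) (h : l1 ≤ l2) : Gt b l1 ≤ Gt b l2 := by
  have := Gt_nu hb l2 l1
  simp only [Gt] at *
  nlinarith [mul_nonneg (nu_nonneg hb h1) (sub_nonneg.2 h)]
lemma nu_mono {b l1 l2 : ℝ} (hb : 0 ≤ b) (h : l1 ≤ l2) : nu b l1 ≤ nu b l2 := by
  unfold nu nn; split_ifs
  · linarith
  · gcongr
lemma Gt_le (b lam : ℝ) : Gt b lam ≤ lam ^ 2 / 4 := by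
  unfold Gt; nlinarith [sq_nonneg (lam - 2 * nu b lam)]
lemma nu_le {b lam : ℝ} (hb : 0 ≤ b) (hl : 0 ≤ lam) : nu b lam ≤ lam := by
  unfold nu; split_ifs with h
  · linarith
  · have hb : 0 < b := lt_of_le_of_ne hb (Ne.symm h)
    rcases Nat.eq_zero_or_pos (nn b lam) with h0 | h0
    · simp [h0, hl]
    · have h2 : (2 * ((nn b lam - 1 : ℕ) : ℝ) + 1) * b < lam := (nn_lt hb _).1 (by omega)
      rw [Nat.cast_sub (by omega)] at h2
      have : (1 : ℝ) ≤ nn b lam := by exact_mod_cast h0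
      push_cast at h2
      nlinarith 
lemma le_nu {b lam : ℝ} (hb : 0 ≤ b) : (lam - b) / 2 ≤ nu b lam := by
  unfold nu; split_ifs with h
  · linarith
  · have := nn_le (lam := lam) (lt_of_le_of_ne hb (Ne.symm h)); linarith
lemma nu_zero {b lam : ℝ} (hb : 0 < b) (h : lam ≤ b) : nu b lam = 0 := by
  rw [nu, if_neg hb.ne']
  have : nn b lam = 0 := by
    by_contra h0
    have := (nn_lt (lam := lam) hb 0).1 (Nat.pos_of_ne_zero h0)
    grind
  simp [this]
lemma Gt_zero {b lam : ℝ} (hb : 0 < b) (h : lam ≤ b) : Gt b lam = 0 := by simp [Gt, nu_zero hb h]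
lemma Gt_ge {b lam : ℝ} (hb : 0 ≤ b) (hl : 0 ≤ lam) : (lam ^ 2 - b ^ 2) / 4 ≤ Gt b lam := by
  rcases hb.eq_or_lt with h | h
  · subst h; simp only [Gt, nu, if_true]; nlinarith
  · have h1 : -b ≤ lam - 2 * nu b lam := by
      rcases le_total lam b with h2 | h2
      · rw [nu_zero h h2]; linarith
      · have h0 : 0 < nn b lam ∨ lam = b := by
          rcases h2.eq_or_lt with h3 | h3
          · grind
          · exact Or.inl ((nn_lt h 0).2 (by simpa using h3))
        rcases h0 with h0 | h0
        · have h2 : (2 * ((nn b lam - 1 : ℕ) : ℝ) + 1) * b < lam := (nn_lt h _).1 (by omega)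
          rw [Nat.cast_sub (by omega)] at h2
          push_cast at h2
          rw [nu, if_neg h.ne']; linarith
        · rw [nu_zero h h0.le]; linarith
    have h2 := le_nu (lam := lam) hb
    unfold Gt
    nlinarith
lemma Gt_scale {b mu c : ℝ} (hb : 0 ≤ b) (hc : 1 ≤ c) : c * Gt b mu ≤ Gt b (c * mu) := by
  have := Gt_nu hb (c * mu) mu
  simp only [Gt] at *
  nlinarith [mul_nonneg (sub_nonneg.2 hc) (sq_nonneg (nu b mu))]
lemma Gt_cmp {b1 b2 m1 m2 κ : ℝ} (hb1 : 0 ≤ b1) (hb2 : 0 ≤ b2) (hκ : 0 ≤ κ) (hκ1 : κ ≤ 1 / 4)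
    (h : |b1 - b2| ≤ κ * (b1 + 1)) (hm1 : 0 ≤ m1) (hm : (1 + 4 * κ) * m1 ≤ m2) (h4 : m1 ^ 2 + 4 ≤ m2 ^ 2) :
    Gt b1 m1 ≤ Gt b2 m2 := by
  obtain ⟨h5, h6⟩ := abs_le.1 h
  have hm2 : 0 ≤ m2 := by nlinarith
  rcases lt_or_ge b1 1 with h1 | h1
  · have h2 : b2 ≤ 2 := by nlinarith
    have := Gt_ge hb2 hm2
    have := Gt_le b1 m1
    nlinarith
  · have hb1' : 0 < b1 := by linarith
    have hb2' : 0 < b2 := by nlinarith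
    have e : Gt b1 m1 = nn b1 m1 * b1 * (m1 - nn b1 m1 * b1) := by rw [Gt, nu, if_neg hb1'.ne']; ring
    have h0 := Gt_nonneg (lam := m1) hb1
    set n := nn b1 m1
    rcases le_total b1 b2 with h7 | h7
    · set s := b2 / b1 with hs
      have hs1 : 1 ≤ s := by rw [hs, le_div_iff₀ hb1']; linarith
      have hs2 : s ≤ 1 + 4 * κ := by rw [hs, div_le_iff₀ hb1']; nlinarith
      have hb : b2 = s * b1 := by grind
      have := Gt_max (lam := s * m1) hb2' n
      have h8 : Gt b2 (s * m1) ≤ Gt b2 m2 := Gt_mono hb2 (by positivity) (le_trans (by gcongr) hm)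
      have h9 : n * b2 * (s * m1 - n * b2) = s ^ 2 * Gt b1 m1 := by grind
      nlinarith [mul_nonneg (by nlinarith : 0 ≤ s ^ 2 - 1) h0]
    · set s := b1 / b2 with hs
      have hs1 : 1 ≤ s := by rw [hs, le_div_iff₀ hb2']; linarith
      have hs2 : s ≤ 1 + 4 * κ := by rw [hs, div_le_iff₀ hb2']; nlinarith [mul_nonneg hκ hb1, mul_nonneg hκ (by linarith : 0 ≤ b1 - 1)]
      have hb : b1 = s * b2 := by grind
      have := Gt_max (lam := s * m1) hb2' n
      have h8 : Gt b2 (s * m1) ≤ Gt b2 m2 := Gt_mono hb2 (by positivity) (le_trans (by gcongr) hm)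
      have h9 : n * b2 * (s * m1 - n * b2) = Gt b1 m1 + (s ^ 2 - 1) * (n * b2) ^ 2 := by grind
      nlinarith [mul_nonneg (by nlinarith : 0 ≤ s ^ 2 - 1) (sq_nonneg (n * b2))]
lemma nu_meas (lam : ℝ) : Measurable fun b => nu b lam := by
  unfold nu nn
  refine Measurable.ite (measurableSet_singleton 0) measurable_const ?_
  fun_prop
lemma Gt_meas (lam : ℝ) : Measurable fun b => Gt b lam :=
  (nu_meas lam).mul (measurable_const.sub (nu_meas lam))
lemma tsum_heav {b lam : ℝ} (hb : 0 < b) : b * ∑' k : ℕ, heav (lam - (2 * (k : ℝ) + 1) * b) = nu b lam := by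
  rw [nu, if_neg hb.ne']
  rw [tsum_eq_sum (s := Finset.range (nn b lam))]
  · rw [Finset.sum_congr rfl (g := fun _ => (1 : ℝ))]
    · simp
    · intro k hk
      have := (nn_lt hb k).1 (Finset.mem_range.1 hk)
      rw [heav, if_pos (by linarith)]
  · intro k hk
    have : ¬ (k < nn b lam) := fun h => hk (Finset.mem_range.2 h)
    rw [nn_lt hb] at this
    rw [heav, if_neg (by linarith)]
def Tl (a X Y : ℝ) : Set (Rp) := Set.Icc X (X + 3 * a * Y) ×ˢ Set.Icc Y (Y + 3 * a * Y)
lemma Tl_UHP {a X Y : ℝ} (hY : 0 < Y) : Tl a X Y ⊆ UHP := fun _ hp => lt_of_lt_of_le hY hp.2.1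
lemma fieldB_cd {P Q : Rp → ℝ} (h1 : Cd P UHP) (h2 : Cd Q UHP) : ContDiffOn ℝ 1 (fieldB P Q) UHP :=
  (contDiff_snd.pow 2).contDiffOn.mul ((cd_on h2 (1, 0)).sub (cd_on h1 (0, 1)))
lemma fieldB_var {P Q : Rp → ℝ} (h1 : Cd P UHP) (h2 : Cd Q UHP) {C₀ : ℝ} (hC : 0 < C₀) (hH : H2 C₀ P Q)
    {a X Y : ℝ} (ha : 0 < a) (hY : 0 < Y) (hc : 12 * a * C₀ ≤ 1) {p q : Rp} (hp : p ∈ Tl a X Y) (hq : q ∈ Tl a X Y) :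
    |fieldB P Q p - fieldB P Q q| ≤ 12 * a * C₀ * (intenB P Q q + 1) := by
  have hcd := fieldB_cd h1 h2
  have hK : IsCompact (Tl a X Y) := isCompact_Icc.prod isCompact_Icc
  have hU := Tl_UHP (a := a) (X := X) hY
  obtain ⟨m, hm, hmax⟩ := hK.exists_isMaxOn ⟨p, hp⟩ ((hcd.continuousOn.mono hU).abs)
  set M := |fieldB P Q m| with hM
  have hM0 : 0 ≤ M := abs_nonneg _
  have key : ∀ p ∈ Tl a X Y, ∀ q ∈ Tl a X Y, |fieldB P Q p - fieldB P Q q| ≤ 6 * a * C₀ * (M + 1) := by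
    intro p hp q hq
    have hb : ∀ z ∈ Tl a X Y, ‖fderiv ℝ (fieldB P Q) z‖ ≤ 2 * (C₀ * (M + 1) / Y) := by
      intro z hz
      have hz2 := hz.2.1
      have hh := hH z (hU hz)
      have hs : √((dXr (fieldB P Q) z) ^ 2 + (dYr (fieldB P Q) z) ^ 2) ≤ C₀ * (M + 1) / Y := by
        rw [le_div_iff₀ hY]
        have h3 : C₀ * (intenB P Q z + 1) ≤ C₀ * (M + 1) := by
          gcongr; exact hmax hz
        nlinarith [Real.sqrt_nonneg ((dXr (fieldB P Q) z) ^ 2 + (dYr (fieldB P Q) z) ^ 2)]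
      have hx : |dXr (fieldB P Q) z| ≤ C₀ * (M + 1) / Y := (Real.abs_le_sqrt (by nlinarith )).trans hs
      have hy : |dYr (fieldB P Q) z| ≤ C₀ * (M + 1) / Y := (Real.abs_le_sqrt (by nlinarith )).trans hs
      refine ContinuousLinearMap.opNorm_le_bound _ (by positivity) fun v => ?_
      have : fderiv ℝ (fieldB P Q) z v = v.1 * dXr (fieldB P Q) z + v.2 * dYr (fieldB P Q) z := by
        have : v = v.1 • ((1 : ℝ), (0 : ℝ)) + v.2 • ((0 : ℝ), (1 : ℝ)) := by simp
        conv_lhs => rw [this, map_add, map_smul, map_smul]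
        rfl
      rw [this, nea]
      refine (abs_add_le _ _).trans ?_
      rw [abs_mul, abs_mul]
      have v1 : |v.1| ≤ ‖v‖ := norm_fst_le v
      have v2 : |v.2| ≤ ‖v‖ := norm_snd_le v
      have := mul_le_mul v1 hx (abs_nonneg _) (norm_nonneg _)
      have := mul_le_mul v2 hy (abs_nonneg _) (norm_nonneg _)
      linarith
    have hconv : Convex ℝ (Tl a X Y) := (convex_Icc _ _).prod (convex_Icc _ _)
    have := hconv.norm_image_sub_le_of_norm_fderiv_le (𝕜 := ℝ) (f := fieldB P Q)
      (fun z hz => (hcd.differentiableOn (by norm_num)).differentiableAt (UHP_open.mem_nhds (hU hz))) hb hq hp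
    have hd : ‖p - q‖ ≤ 3 * a * Y := by
      obtain ⟨⟨a1, a2⟩, a3, a4⟩ := hp
      obtain ⟨⟨b1, b2⟩, b3, b4⟩ := hq
      exact max_le (abs_le.2 ⟨by simp; linarith, by simp; linarith⟩) (abs_le.2 ⟨by simp; linarith, by simp; linarith⟩)
    refine this.trans ((mll hd (by positivity)).trans (le_of_eq ?_))
    field_simp; ring
  have k1 := key m hm q hq
  have k2 := key p hp q hq
  have k3 : M ≤ intenB P Q q + 6 * a * C₀ * (M + 1) := by
    have := abs_sub_abs_le_abs_sub (fieldB P Q m) (fieldB P Q q)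
    unfold intenB; linarith
  have k4 : M + 1 ≤ 2 * (intenB P Q q + 1) := by nlinarith
  have : 0 < 6 * a * C₀ := by positivity
  nlinarith
lemma intenB_var {P Q : Rp → ℝ} (h1 : Cd P UHP) (h2 : Cd Q UHP) {C₀ : ℝ} (hC : 0 < C₀) (hH : H2 C₀ P Q)
    {a X Y : ℝ} (ha : 0 < a) (hY : 0 < Y) (hc : 12 * a * C₀ ≤ 1) {p q : Rp} (hp : p ∈ Tl a X Y) (hq : q ∈ Tl a X Y) :
    |intenB P Q p - intenB P Q q| ≤ 12 * a * C₀ * (intenB P Q q + 1) :=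
  (abs_abs_sub_abs_le_abs_sub _ _).trans (fieldB_var h1 h2 hC hH ha hY hc hp hq)
lemma Tl_corner {a X Y : ℝ} (ha : 0 < a) (hY : 0 < Y) : (X, Y) ∈ Tl a X Y :=
  have : 0 < 3 * a * Y := by positivity
  ⟨⟨le_rfl, by simp; linarith⟩, le_rfl, by simp; linarith⟩
lemma tile_gauge {P Q : Rp → ℝ} (h1 : Cd P UHP) (h2 : Cd Q UHP) {C₀ : ℝ} (hC : 0 < C₀) (hH : H2 C₀ P Q)
    {a X Y : ℝ} (ha : 0 < a) (hY : 0 < Y) (hc : 12 * a * C₀ ≤ 1) :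
    ∃ (φ : Rp → ℝ) (B : ℝ), Sm φ ∧ |B| = (intenB P Q (X, Y) + a) / Y ^ 2 ∧ B ≠ 0 ∧
      ∀ p ∈ Tl a X Y, |P p - dXr φ p + B * p.2| ≤ (36 * C₀ + 19) * a ^ 2 * (intenB P Q (X, Y) + 1) / Y ∧
        |Q p - dYr φ p| ≤ (36 * C₀ + 19) * a ^ 2 * (intenB P Q (X, Y) + 1) / Y := by
  set b := intenB P Q (X, Y) with hb
  have hb0 : 0 ≤ b := abs_nonneg _
  obtain ⟨σ, hσ, hσb⟩ : ∃ σ : ℝ, |σ| = 1 ∧ fieldB P Q (X, Y) = σ * b := by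
    rcases le_total 0 (fieldB P Q (X, Y)) with h | h
    · exact ⟨1, by simp, by rw [hb, intenB, abs_of_nonneg h]; ring⟩
    · exact ⟨-1, by simp, by rw [hb, intenB, abs_of_nonpos h]; ring⟩
  let B := σ * ((b + a) / Y ^ 2)
  have hBabs : |B| = (b + a) / Y ^ 2 := by
    simp only [B]; rw [abs_mul, hσ, one_mul, abs_of_pos (by positivity)]
  have hK : ∀ p ∈ Tl a X Y, |dXr Q p - dYr P p - B| ≤ (12 * C₀ + 6) * a * (b + 1) / Y ^ 2 := by
    intro p hp
    have hp2 := hp.2.1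
    have hp3 := hp.2.2
    have hp0 : 0 < p.2 := by linarith
    have hv := fieldB_var h1 h2 hC hH ha hY hc hp (Tl_corner ha hY)
    have e : dXr Q p - dYr P p - B = ((fieldB P Q p - fieldB P Q (X, Y)) * Y ^ 2 + fieldB P Q (X, Y) * (Y ^ 2 - p.2 ^ 2) - σ * a * p.2 ^ 2) / (p.2 ^ 2 * Y ^ 2) := by
      simp only [B]; rw [hσb]; simp only [fieldB]; field_simp; ring
    rw [e, abs_div, abs_of_pos (by positivity : 0 < p.2 ^ 2 * Y ^ 2), div_le_div_iff₀ (by positivity) (by positivity)]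
    have t1 : |(fieldB P Q p - fieldB P Q (X, Y)) * Y ^ 2| ≤ 12 * a * C₀ * (b + 1) * p.2 ^ 2 := by
      rw [abs_mul, abs_of_pos (by positivity : 0 < Y ^ 2)]
      exact mul_le_mul hv (by gcongr) (by positivity) (by positivity)
    have t2 : |fieldB P Q (X, Y) * (Y ^ 2 - p.2 ^ 2)| ≤ b * (6 * a * p.2 ^ 2) := by
      rw [abs_mul, ← intenB, ← hb]
      refine mll ?_ hb0
      rw [abs_of_nonpos (by nlinarith)]
      nlinarith [mul_nonneg ha.le (mul_nonneg hp0.le (sub_nonneg.2 hp2)), mul_nonneg hY.le (sub_nonneg.2 hp3), mul_nonneg hp0.le (sub_nonneg.2 hp3)]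
    have t3 : |σ * a * p.2 ^ 2| ≤ a * p.2 ^ 2 := by
      rw [abs_mul, abs_mul, hσ, one_mul, abs_of_pos ha, abs_of_pos (by positivity)]
    have t4 : |(fieldB P Q p - fieldB P Q (X, Y)) * Y ^ 2 + fieldB P Q (X, Y) * (Y ^ 2 - p.2 ^ 2) - σ * a * p.2 ^ 2| ≤ (12 * C₀ + 6) * a * (b + 1) * p.2 ^ 2 := by
      refine (abs_sub _ _).trans ((add_le_add (abs_add_le _ _) le_rfl).trans ?_)
      grind
    rw [← mul_assoc]
    exact mlr t4 (by positivity)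
  obtain ⟨φ, hφ, H⟩ := gauge_ex h1 h2 (x0 := X) (y0 := Y) (l := 3 * a * Y) (B := B) (η := a ^ 2 * (b + 1) / Y) hY (by positivity) (by positivity) hK
  refine ⟨φ, B, hφ, hBabs, ?_, fun p hp => ?_⟩
  · grind
  · obtain ⟨x1, x2⟩ := H p hp
    have e : 3 * a * Y * ((12 * C₀ + 6) * a * (b + 1) / Y ^ 2) + a ^ 2 * (b + 1) / Y = (36 * C₀ + 19) * a ^ 2 * (b + 1) / Y := by field_simp; ring
    rw [e] at x1
    refine ⟨x1, x2.trans ?_⟩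
    gcongr
    nlinarith 
lemma intenB_cont {P Q : Rp → ℝ} (h1 : Cd P UHP) (h2 : Cd Q UHP) : ContinuousOn (intenB P Q) UHP :=
  (fieldB_cd h1 h2).continuousOn.abs
def BX (R : ℝ) : Set (Rp) := Set.Icc (-R) R ×ˢ Set.Icc R⁻¹ R
lemma box_ex {P Q : Rp → ℝ} (h : H1 P Q) (lam : ℝ) : ∃ R > 0, ∀ p ∈ UHP, intenB P Q p ≤ lam → p ∈ BX R := by
  obtain ⟨R0, hR⟩ := h (lam + 1)
  set s := Real.sinh (R0 / 2) with hs
  refine ⟨2 + 4 * s ^ 2, by positivity, fun p hp hb => ?_⟩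
  have hp0 : 0 < p.2 := hp
  have h1 : hDist p < R0 := by grind
  have h2 : Real.sqrt (p.1 ^ 2 + (p.2 - 1) ^ 2) / (2 * Real.sqrt p.2) < s := by
    rw [hDist] at h1
    have := Real.sinh_lt_sinh.2 (by linarith : Real.arsinh (Real.sqrt (p.1 ^ 2 + (p.2 - 1) ^ 2) / (2 * Real.sqrt p.2)) < R0 / 2)
    rwa [Real.sinh_arsinh] at this
  rw [div_lt_iff₀ (by positivity)] at h2
  have h3 : p.1 ^ 2 + (p.2 - 1) ^ 2 ≤ (s * (2 * √p.2)) ^ 2 := by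
    rw [← Real.sq_sqrt (by positivity : 0 ≤ p.1 ^ 2 + (p.2 - 1) ^ 2)]
    exact pow_le_pow_left₀ (Real.sqrt_nonneg _) h2.le 2
  have h4 : (s * (2 * √p.2)) ^ 2 = 4 * s ^ 2 * p.2 := by grind
  have h5 : p.2 ≤ 2 + 4 * s ^ 2 := by
    by_contra hh; push Not at hh; nlinarith 
  have h6 : |p.1| ≤ 2 + 4 * s ^ 2 := by
    apply abs_le_of_sq_le_sq _ (by positivity)
    nlinarith [sq_nonneg (p.2 - 1), sq_nonneg s]
  refine ⟨abs_le.1 h6, ?_, h5⟩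
  rw [inv_le_iff_one_le_mul₀ (by positivity)]
  nlinarith [sq_nonneg p.2]
lemma BX_fin {R : ℝ} (hR : 0 < R) : volH (BX R) < ⊤ := by
  have hm : MeasurableSet (BX R) := measurableSet_Icc.prod measurableSet_Icc
  rw [volH, withDensity_apply _ hm]
  refine lt_of_le_of_lt (setLIntegral_mono measurable_const (g := fun _ => ENNReal.ofReal (R ^ 2)) fun p hp => ?_) ?_
  · apply ENNReal.ofReal_le_ofReal
    have := hp.2.1
    rw [← inv_pow]
    have h0 := lt_of_lt_of_le (by positivity) this
    exact pow_le_pow_left₀ (by positivity) (inv_le_of_inv_le₀ hR this) 2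
  · rw [setLIntegral_const]
    refine ENNReal.mul_lt_top ENNReal.ofReal_lt_top ?_
    exact (isCompact_Icc.prod isCompact_Icc).measure_lt_top
lemma volH_ae {P : Rp → Prop} (h : ∀ p ∈ UHP, P p) : ∀ᵐ p ∂volH, P p := by
  have : ∀ᵐ p ∂(volume.restrict UHP), P p := (ae_restrict_iff' UHP_meas).2 (evf h)
  exact (withDensity_absolutelyContinuous _ _).ae_le this
lemma aem_H {P Q : Rp → ℝ} (h1 : Cd P UHP) (h2 : Cd Q UHP) : AEMeasurable (intenB P Q) volH :=
  ((intenB_cont h1 h2).aemeasurable UHP_meas).mono_ac (withDensity_absolutelyContinuous _ _)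
lemma int_H {P Q : Rp → ℝ} (h1 : Cd P UHP) (h2 : Cd Q UHP) (hH : H1 P Q)
    {F : ℝ → ℝ} (hF : Measurable F) {M Lm : ℝ} (hM : ∀ b, 0 ≤ b → |F b| ≤ M) (h0 : ∀ b, 0 ≤ b → Lm < b → F b = 0) :
    Integrable (fun p => F (intenB P Q p)) volH := by
  obtain ⟨R, hR, hbox⟩ := box_ex hH Lm
  have hm : MeasurableSet (BX R) := measurableSet_Icc.prod measurableSet_Icc
  have hi : Integrable ((BX R).indicator fun _ => M) volH :=
    (integrable_indicator_iff hm).2 (integrableOn_const (BX_fin hR).ne)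
  refine hi.mono' (hF.comp_aemeasurable (aem_H h1 h2)).aestronglyMeasurable (volH_ae fun p hp => ?_)
  by_cases hb : p ∈ BX R
  · rw [Set.indicator_of_mem hb]; exact hM _ (abs_nonneg _)
  · rw [Set.indicator_of_notMem hb, h0 (intenB P Q p) (abs_nonneg _) (not_le.1 fun h => hb (hbox p hp h))]; simp
lemma int_Gt {P Q : Rp → ℝ} (h1 : Cd P UHP) (h2 : Cd Q UHP) (hH : H1 P Q) {lam : ℝ} (hl : 0 ≤ lam) :
    Integrable (fun p => Gt (intenB P Q p) lam) volH :=
  int_H h1 h2 hH (F := fun b => Gt b lam) (Gt_meas lam) (M := lam ^ 2 / 4) (Lm := lam)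
    (fun b hb => by rw [abs_of_nonneg (Gt_nonneg hb)]; exact Gt_le _ _) (fun b hb h => Gt_zero (by linarith) h.le)
lemma cpt_R {K : Set (Rp)} (hK : IsCompact K) (hU : K ⊆ UHP) : ∃ R > 0, ∀ p ∈ K, |p.1| < R ∧ R⁻¹ < p.2 ∧ p.2 < R := by
  have hc : ContinuousOn (fun p : Rp => |p.1| + p.2 + p.2⁻¹) K :=
    ContinuousOn.add (by fun_prop) (inv_cont.mono hU)
  obtain ⟨M, hM⟩ := (hK.bddAbove_image hc)
  refine ⟨|M| + 1, by positivity, fun p hp => ?_⟩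
  have h0 : 0 < p.2 := hU hp
  have h1 := hM ⟨p, hp, rfl⟩
  have h2 : 0 < p.2⁻¹ := by positivity
  have := le_abs_self M
  have := abs_nonneg p.1
  exact ⟨by linarith, (inv_lt_comm₀ (by positivity) h0).2 (by linarith), by linarith⟩
lemma wn_int {u : Rp → ℂ} (hu : IsTestOn UHP u) : Integrable (fun p => (p.2 ^ 2)⁻¹ * ‖u p‖ ^ 2) := by
  have : (fun p : Rp => (p.2 ^ 2)⁻¹ * ‖u p‖ ^ 2) = fun p => ‖((p.2⁻¹ : ℝ) : ℂ) * u p‖ ^ 2 := by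
    funext p; rw [norm_mul, mul_pow, Complex.norm_real, nea, sq_abs, inv_pow]
  rw [this]
  exact nint (test_y hu).1 (test_y hu).2
lemma wi_self {u : Rp → ℂ} (h : wi u u = 1) : wn u = 1 := by
  have : wi u u = ((wn u : ℝ) : ℂ) := by
    rw [wi, wn, ← integral_complex_ofReal]
    congr 1; ext p
    rw [← Complex.normSq_eq_conj_mul_self, Complex.normSq_eq_norm_sq]; simp
  rw [this] at h; exact_mod_cast h
lemma PUn_wn {C a R : ℝ} {s : Finset (ℕ × ℕ)} {X Y : ℕ × ℕ → ℝ} {χ : ℕ × ℕ → Rp → ℝ} (H : PUn C a R s X Y χ)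
    {u : Rp → ℂ} (hu : IsTestOn UHP u) (hR : ∀ p ∈ tsupport u, |p.1| < R ∧ R⁻¹ < p.2 ∧ p.2 < R) :
    ∑ i ∈ s, wn (fun p => (χ i p : ℂ) * u p) = wn u := by
  simp only [wn]
  rw [← integral_finsetSum _ fun i _ => wn_int (rmul_test (H.sm i) hu)]
  congr 1; ext p
  by_cases hp : p ∈ tsupport u
  · obtain ⟨r1, r2, r3⟩ := hR p hp
    simp only [norm_mul, mul_pow, Complex.norm_real, nea, sq_abs]
    rw [← Finset.mul_sum, ← Finset.sum_mul, H.eq1 p r1.le r2.le r3.le, one_mul]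
  · simp [izt hp]
lemma PUn_ims {P Q : Rp → ℝ} (h1 : ContinuousOn P UHP) (h2 : ContinuousOn Q UHP)
    {C a R : ℝ} (ha : 0 < a) {s : Finset (ℕ × ℕ)} {X Y : ℕ × ℕ → ℝ} {χ : ℕ × ℕ → Rp → ℝ} (H : PUn C a R s X Y χ)
    {u : Rp → ℂ} (hu : IsTestOn UHP u) (hR : ∀ p ∈ tsupport u, |p.1| < R ∧ R⁻¹ < p.2 ∧ p.2 < R) :
    ∑ i ∈ s, ∫ p, dens P Q (fun p => (χ i p : ℂ) * u p) p ≤ qA P Q u + C / a ^ 2 * wn u := by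
  rw [qA_eq hu, wn, ← icm, ← integral_add (dens_int h1 h2 hu) ((wn_int hu).const_mul _),
    ← integral_finsetSum _ fun i _ => dens_int h1 h2 (rmul_test (H.sm i) hu)]
  refine integral_mono (integrable_finsetSum _ fun i _ => dens_int h1 h2 (rmul_test (H.sm i) hu))
    ((dens_int h1 h2 hu).add ((wn_int hu).const_mul _)) fun p => ?_
  by_cases hp : p ∈ tsupport u
  · have hU : 0 < p.2 := hu.2.2 hp
    rw [ims_sum H.sm (sm_diff hu.1 p)]
    · have := H.grad p hU
      have e : C / a ^ 2 * ((p.2 ^ 2)⁻¹ * ‖u p‖ ^ 2) = C / (a * p.2) ^ 2 * ‖u p‖ ^ 2 := by grind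
      rw [e]
      gcongr
    · obtain ⟨r1, r2, r3⟩ := hR p hp
      filter_upwards [(isOpen_lt (continuous_fst.abs) continuous_const).mem_nhds r1,
        (isOpen_lt continuous_const continuous_snd).mem_nhds r2,
        (isOpen_lt continuous_snd continuous_const).mem_nhds r3] with q q1 q2 q3
      exact H.eq1 q (le_of_lt q1) (le_of_lt q2) (le_of_lt q3)
  · have h0 : ∀ i, p ∉ tsupport (fun p => (χ i p : ℂ) * u p) := fun i h => hp ((tsupport_mul_subset_right) h)
    have e : ∀ v : Rp → ℂ, p ∉ tsupport v → dens P Q v p = 0 := fun v hv => by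
      simp [dens, dX_zero hv, dY_zero hv, izt hv]
    rw [Finset.sum_eq_zero fun i _ => e _ (h0 i), e _ hp, izt hp]; simp
lemma int_cs {g : Rp → ℝ} (hg : Continuous g) (hc : Hc g) (hU : tsupport g ⊆ UHP) : Integrable g volH := by
  obtain ⟨R, hR, hb⟩ := cpt_R hc hU
  obtain ⟨M, hM⟩ := hc.exists_bound_of_continuous hg
  have hm : MeasurableSet (BX R) := measurableSet_Icc.prod measurableSet_Icc
  have hi : Integrable ((BX R).indicator fun _ => M) volH :=
    (integrable_indicator_iff hm).2 (integrableOn_const (BX_fin hR).ne)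
  refine hi.mono' hg.aestronglyMeasurable (evf fun p => ?_)
  by_cases hp : p ∈ tsupport g
  · obtain ⟨r1, r2, r3⟩ := hb p hp
    rw [Set.indicator_of_mem (show p ∈ BX R from ⟨abs_le.1 r1.le, r2.le, r3.le⟩)]; grind
  · rw [izt hp, norm_zero]
    exact Set.indicator_nonneg (fun _ _ => (norm_nonneg _).trans (hM p)) _
lemma sq_ts {χ : Rp → ℝ} {S : Set (Rp)} (h : tsupport χ ⊆ S) : tsupport (fun p => χ p ^ 2) ⊆ S := by
  refine (closure_mono ?_).trans h
  simp
lemma int_chi {χ : Rp → ℝ} (hχ : Continuous χ) (hc : Hc χ) (hU : tsupport χ ⊆ UHP) : Integrable (fun p => χ p ^ 2) volH :=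
  int_cs (hχ.pow 2) (hc.comp_left (g := fun t : ℝ => t ^ 2) (by simp)) (sq_ts hU)
lemma volH_chi {χ : Rp → ℝ} (hU : tsupport χ ⊆ UHP) : ∫ p, χ p ^ 2 ∂volH = ∫ p, (p.2 ^ 2)⁻¹ * χ p ^ 2 := by
  rw [volH_integral]
  apply setIntegral_eq_integral_of_forall_compl_eq_zero
  intro p hp; rw [izt fun h => hp (hU h)]; simp
lemma int_chiGt {P Q : Rp → ℝ} (h1 : Cd P UHP) (h2 : Cd Q UHP) (lam : ℝ)
    {χ : Rp → ℝ} (hχ : Continuous χ) (hc : Hc χ) (hU : tsupport χ ⊆ UHP) :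
    Integrable (fun p => χ p ^ 2 * Gt (intenB P Q p) lam) volH := by
  refine ((int_chi hχ hc hU).mul_const (lam ^ 2 / 4)).mono' ?_ (evf fun p => ?_)
  · exact (hχ.pow 2).aestronglyMeasurable.mul ((Gt_meas lam).comp_aemeasurable (aem_H h1 h2)).aestronglyMeasurable
  · rw [nea, abs_mul, abs_of_nonneg (sq_nonneg (χ p)), abs_of_nonneg (Gt_nonneg (b := intenB P Q p) (abs_nonneg _))]
    exact mll (Gt_le _ _) (sq_nonneg _)
lemma prod2 {u v τ : ℝ} (hu : 0 ≤ u) (hv : 0 ≤ v) (hτ : 0 ≤ τ) (hτ1 : τ ≤ 1) : (1 + u * τ) * (1 + v * τ) ≤ 1 + (u + v + u * v) * τ := by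
  nlinarith [mul_nonneg (mul_nonneg (mul_nonneg hu hv) hτ) (sub_nonneg.2 hτ1)]
lemma Gt_eqn {b lam : ℝ} (hb : 0 < b) : Gt b lam = nn b lam * b * (lam - nn b lam * b) := by rw [Gt, nu, if_neg hb.ne']; ring
lemma tile_up_lo {P Q : Rp → ℝ} (h1 : Cd P UHP) (h2 : Cd Q UHP) {C₀ : ℝ} (hC : 0 < C₀) (hH : H2 C₀ P Q)
    {a X Y τ D lam' : ℝ} (ha : 0 < a) (hY : 0 < Y) (hc : 12 * a * C₀ ≤ 1) (hτ : 0 < τ) (hτ1 : τ < 1) {χ : Rp → ℝ}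
    (hχ : Sm χ) (hs : tsupport χ ⊆ Tl a X Y) (hχc : Hc χ)
    (hD : D ≤ (1 - τ) * lam' - τ⁻¹ * (2 * ((36 * C₀ + 19) * a ^ 2 * (intenB P Q (X, Y) + 1)) ^ 2)) (hD0 : 0 ≤ D)
    {N : ℕ} {e : Fin N → Rp → ℂ} (he : ∀ i, IsTestOn UHP (e i))
    (ho : ∀ i j, wi (e i) (e j) = if i = j then 1 else 0) :
    ∑ j, (D * wn (fun p => (χ p : ℂ) * e j p) - ∫ p, dens P Q (fun p => (χ p : ℂ) * e j p) p) ≤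
      1 / (2 * π) * ((1 + 3 * a) ^ 4 * Gt (intenB P Q (X, Y) + a) lam' * ∫ p, χ p ^ 2 ∂volH) := by
  obtain ⟨φ, B, hφ, hBa, hB, hg⟩ := tile_gauge h1 h2 hC hH (X := X) ha hY hc
  set b := intenB P Q (X, Y) with hb
  have hb0 : 0 ≤ b := abs_nonneg _
  have hb' : 0 < b + a := by linarith
  have hU : tsupport χ ⊆ UHP := hs.trans (Tl_UHP hY)
  have hin : ∀ p, χ p ≠ 0 → p ∈ Tl a X Y := fun p hp => hs (subset_tsupport _ hp)
  set K := nn (b + a) lam' with hK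
  have hY2 : 0 < Y ^ 2 := by positivity
  have := tile_up h1.continuousOn h2.continuousOn hφ hχ hχc (L := lam' / Y ^ 2) (ε := (36 * C₀ + 19) * a ^ 2 * (b + 1) / Y) hB hτ hτ1 (K := K)
    (by rw [hBa, ← mul_div_assoc]; exact div_le_div_of_nonneg_right (nn_le hb') hY2.le)
    (fun k hk => by rw [hBa, ← mul_div_assoc]; exact div_le_div_of_nonneg_right ((nn_lt hb' k).1 hk).le hY2.le)
    (fun p hp => hg p (hin p hp)) he ho
  refine le_trans (Finset.sum_le_sum fun j _ => ?_) (this.trans ?_)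
  · have hwn : Y ^ 2 * wn (fun p => (χ p : ℂ) * e j p) ≤ ∫ p, ‖(χ p : ℂ) * e j p‖ ^ 2 := by
      have ht := rmul_test hχ (he j)
      rw [wn, ← icm]
      refine integral_mono ((wn_int ht).const_mul _) (nint ht.1.continuous ht.2.1) fun p => ?_
      by_cases hp : χ p = 0
      · simp [hp]
      · have : Y ≤ p.2 := (hin p hp).2.1
        have h0 : 0 < p.2 := by linarith
        rw [← mul_assoc, ← div_eq_mul_inv]
        refine mul_le_of_le_one_left (by positivity) ?_
        rw [div_le_one (by positivity)]; gcongr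
    have e1 : ((1 - τ) * (lam' / Y ^ 2) - τ⁻¹ * (2 * ((36 * C₀ + 19) * a ^ 2 * (b + 1) / Y) ^ 2)) =
      ((1 - τ) * lam' - τ⁻¹ * (2 * ((36 * C₀ + 19) * a ^ 2 * (b + 1)) ^ 2)) / Y ^ 2 := by grind
    rw [e1]
    refine sub_le_sub_right ?_ _
    calc D * wn (fun p => (χ p : ℂ) * e j p) = D / Y ^ 2 * (Y ^ 2 * wn (fun p => (χ p : ℂ) * e j p)) := by field_simp
      _ ≤ D / Y ^ 2 * ∫ p, ‖(χ p : ℂ) * e j p‖ ^ 2 := by gcongr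
      _ ≤ _ := by gcongr
  · have hG := Gt_nonneg (lam := lam') hb'.le
    have e1 : (1 - τ) * (K * |B| * (lam' / Y ^ 2 - K * |B|)) / (2 * π) = (1 - τ) * (1 / (2 * π) * Gt (b + a) lam' / Y ^ 4) := by
      rw [Gt_eqn hb', hBa, ← hK]; field_simp
    have hcs := hχc.comp_left (g := fun t : ℝ => t ^ 2) (by simp)
    have i2 : Integrable (fun p : Rp => p.2 ^ 2 * χ p ^ 2) :=
      (((continuous_snd.pow 2).mul (hχ.continuous.pow 2)).integrable_of_hasCompactSupport hcs.mul_left)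
    have h3 : ∫ p, p.2 ^ 2 * χ p ^ 2 ≤ (1 + 3 * a) ^ 4 * Y ^ 4 * ∫ p, χ p ^ 2 ∂volH := by
      rw [volH_chi hU, ← icm]
      refine integral_mono i2 ((int_cut (A := fun p : Rp => (p.2 ^ 2)⁻¹) ?_ (hχ.continuous.pow 2) hcs (sq_ts hU)).const_mul _) fun p => ?_
      · exact (continuousOn_snd.pow 2).inv₀ fun p hp => pow_ne_zero _ (ne_of_gt hp)
      · simp only
        by_cases hp : χ p = 0
        · simp [hp]
        · have r1 : Y ≤ p.2 := (hin p hp).2.1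
          have r2 := (hin p hp).2.2
          have h0 : 0 < p.2 := by linarith
          rw [← mul_assoc]
          refine mlr ?_ (sq_nonneg _)
          rw [← div_eq_mul_inv, le_div_iff₀ (by positivity), ← pow_add, ← mul_pow]
          exact pow_le_pow_left₀ h0.le (by linarith) 4
    calc _ = (1 - τ) * ((1 / (2 * π) * Gt (b + a) lam' / Y ^ 4) * ∫ p, p.2 ^ 2 * χ p ^ 2) := by rw [e1]; ring
      _ ≤ 1 * ((1 / (2 * π) * Gt (b + a) lam' / Y ^ 4) * ∫ p, p.2 ^ 2 * χ p ^ 2) := by gcongr; linarith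
      _ ≤ (1 / (2 * π) * Gt (b + a) lam' / Y ^ 4) * ((1 + 3 * a) ^ 4 * Y ^ 4 * ∫ p, χ p ^ 2 ∂volH) := by rw [one_mul]; gcongr
      _ = _ := by field_simp
lemma tile_up_hi {P Q : Rp → ℝ} (h1 : Cd P UHP) (h2 : Cd Q UHP) {C₀ : ℝ} (hC : 0 < C₀) (hH : H2 C₀ P Q)
    {a X Y D : ℝ} (ha : 0 < a) (hY : 0 < Y) (hc : 12 * a * C₀ ≤ 1) {χ : Rp → ℝ}
    (hχ : Sm χ) (hs : tsupport χ ⊆ Tl a X Y)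
    (hD : D ≤ intenB P Q (X, Y) - 12 * a * C₀ * (intenB P Q (X, Y) + 1))
    {u : Rp → ℂ} (hu : IsTestOn UHP u) :
    D * wn (fun p => (χ p : ℂ) * u p) ≤ ∫ p, dens P Q (fun p => (χ p : ℂ) * u p) p := by
  set b := intenB P Q (X, Y) with hb
  obtain ⟨σ, hσ, hσ1, hσb⟩ : ∃ σ : ℝ, σ ^ 2 = 1 ∧ |σ| = 1 ∧ σ * fieldB P Q (X, Y) = b := by
    rcases le_total 0 (fieldB P Q (X, Y)) with h | h
    · exact ⟨1, by simp, by simp, by rw [hb, intenB, abs_of_nonneg h]; ring⟩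
    · exact ⟨-1, by simp, by simp, by rw [hb, intenB, abs_of_nonpos h]; ring⟩
  refine mag_lower h1 h2 (rmul_test hχ hu) hσ fun p hp => ?_
  have hpT : p ∈ Tl a X Y := hs (subset_tsupport _ fun h => hp (by simp [h]))
  have hv := fieldB_var h1 h2 hC hH ha hY hc hpT (Tl_corner ha hY)
  have h3 : |σ * (fieldB P Q p - fieldB P Q (X, Y))| ≤ 12 * a * C₀ * (b + 1) := by rw [abs_mul, hσ1, one_mul]; exact hv
  have := (abs_le.1 h3).1
  rw [mul_sub] at this; linarith
lemma ar_e {c τ lam b : ℝ} (hτ : 0 < τ) (hl : lam * τ ^ 5 = 1) (hb : 0 ≤ b) (hbl : b + 1 ≤ 3 * lam) :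
    τ⁻¹ * (2 * (c * (τ ^ 2) ^ 2 * (b + 1)) ^ 2) ≤ 18 * c ^ 2 * (τ ^ 2 * lam) := by
  have e : τ⁻¹ * (2 * (c * (τ ^ 2) ^ 2 * (b + 1)) ^ 2) = 2 * c ^ 2 * τ ^ 7 * (b + 1) ^ 2 := by grind
  rw [e]
  calc 2 * c ^ 2 * τ ^ 7 * (b + 1) ^ 2 ≤ 2 * c ^ 2 * τ ^ 7 * (3 * lam) ^ 2 := by gcongr
    _ = 18 * c ^ 2 * (τ ^ 2 * lam) * (lam * τ ^ 5) := by ring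
    _ = _ := by rw [hl, mul_one]
lemma ar_lam {τ lam : ℝ} (hτ : 0 < τ) (hτ1 : τ ≤ 1) (hl : lam * τ ^ 5 = 1) : 1 ≤ lam ∧ 1 ≤ lam * τ ∧ 1 / (τ ^ 2) ^ 2 = lam * τ := by
  have hl0 : 0 < lam := by by_contra h; nlinarith [pow_pos hτ 5]
  have h4 : τ ^ 4 ≤ 1 := pow_le_one₀ hτ.le hτ1
  have h2 : 1 ≤ lam * τ := by
    have : lam * τ ^ 5 = (lam * τ) * τ ^ 4 := by ring
    nlinarith [mul_pos hl0 hτ]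
  refine ⟨by nlinarith, h2, ?_⟩
  grind
lemma ar_D {C1 c τ lam : ℝ} (hC1 : 0 < C1) (hτ : 0 < τ) (hτ1 : τ ≤ 1 / 2) (hl : 1 ≤ lam) :
    lam * (1 + C1 * τ) ≤ (1 - τ) * (lam * (1 + 2 * (C1 + 18 * c ^ 2 + 1) * τ)) - 18 * c ^ 2 * (τ ^ 2 * lam) := by
  have h2 : 0 ≤ 1 - 2 * τ := by linarith
  have h3 : 0 ≤ 1 - τ := by linarith
  have : 0 ≤ lam * τ * (C1 * (1 - 2 * τ) + 18 * c ^ 2 * (1 - 2 * τ) + 18 * c ^ 2 * (1 - τ) + (1 - 2 * τ)) := by positivity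
  linarith
lemma ar_p4 {a : ℝ} (ha : 0 ≤ a) (ha1 : a ≤ 1) : (1 + 3 * a) ^ 4 ≤ 1 + 255 * a := by
  have h2 : a ^ 2 ≤ a := by nlinarith
  nlinarith
lemma ar_C {u w τ : ℝ} (hu : 0 ≤ u) (hw : 0 ≤ w) (hτ : 0 < τ) (hτ1 : τ ≤ 1) :
    (1 + u * τ ^ 2) * ((1 + 3 * τ ^ 2) ^ 4 * (1 + w * τ)) ≤ 1 + ((1 + u) * (256 * (1 + w))) * τ - τ := by
  have ht : τ ^ 2 ≤ τ := by nlinarith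
  have h1 : (1 + 3 * τ ^ 2) ^ 4 ≤ 1 + 255 * τ := (ar_p4 (by positivity) (by nlinarith)).trans (by linarith)
  have h2 : (1 + 3 * τ ^ 2) ^ 4 * (1 + w * τ) ≤ 1 + (255 + w + 255 * w) * τ :=
    (mlr h1 (by positivity)).trans (prod2 (by norm_num) hw hτ.le hτ1)
  calc (1 + u * τ ^ 2) * ((1 + 3 * τ ^ 2) ^ 4 * (1 + w * τ)) ≤ (1 + u * τ) * (1 + (255 + w + 255 * w) * τ) := by gcongr
    _ ≤ 1 + (u + (255 + w + 255 * w) + u * (255 + w + 255 * w)) * τ := prod2 hu (by positivity) hτ.le hτ1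
    _ = _ := by ring
lemma ar_v {a C b q : ℝ} (ha : 0 < a) (hC : 0 < C) (hb : 0 ≤ b) (h : -(12 * a * C * (b + 1)) ≤ q - b ∧ q - b ≤ 12 * a * C * (b + 1)) :
    |b + a - q| ≤ (12 * C + 1) * a * (b + a + 1) := by
  have e : (12 * C + 1) * a * (b + a + 1) = 12 * a * C * (b + 1) + a + (a * b + (12 * C + 1) * a ^ 2) := by ring
  have : 0 ≤ a * b + (12 * C + 1) * a ^ 2 := by positivity
  grind
lemma ar_sq {x y : ℝ} (hx : 0 ≤ x) (h : x + 5 ≤ y) : x ^ 2 + 4 ≤ y ^ 2 := by nlinarith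
lemma ar_hi {lam C1 τ b a C : ℝ} (hl : 1 ≤ lam) (h1 : C1 * τ ≤ 1 / 2) (hb : 2 * lam < b) (hac : 12 * a * C ≤ 1 / 8) :
    lam * (1 + C1 * τ) ≤ b - 12 * a * C * (b + 1) := by
  have := mll h1 (by linarith : 0 ≤ lam)
  have := mlr hac (by linarith : 0 ≤ b + 1)
  linarith
lemma ar_m {k x l t : ℝ} (hk : 0 ≤ k) (hx : 0 ≤ x) (h : (1 + k) * x + 5 * t ≤ l) (ht : 1 ≤ t) : x + 5 ≤ l := by
  have := mul_nonneg hk hx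
  linarith
lemma ar_a {a τ K : ℝ} (h : a ≤ τ) (hK : 0 ≤ K) (h1 : τ * (96 * (K + 1)) ≤ 1) : 96 * a * (K + 1) ≤ 1 := by
  have := mlr h (by positivity : 0 ≤ 96 * (K + 1))
  linarith
theorem R_up {P Q : Rp → ℝ} (h1 : Cd P UHP) (h2 : Cd Q UHP) (hH1 : H1 P Q) {C₀ : ℝ} (hC : 0 < C₀) (hH : H2 C₀ P Q) :
    ∃ C > 0, ∃ τ0 > 0, ∀ τ lam : ℝ, 0 < τ → τ ≤ τ0 → lam * τ ^ 5 = 1 → ∀ (N : ℕ) (e : Fin N → Rp → ℂ), (∀ i, IsTestOn UHP (e i)) →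
      (∀ i j, wi (e i) (e j) = if i = j then 1 else 0) →
      ∑ j, (lam - qA P Q (e j)) ≤ 1 / (2 * π) * ∫ p, Gt (intenB P Q p) (lam * (1 + C * τ)) ∂volH := by
  obtain ⟨C1, hC1, hP⟩ := part_exists
  set c := 36 * C₀ + 19 with hc
  set w := 2 * (C1 + 18 * c ^ 2 + 1) with hw
  have hw0 : 0 ≤ w := by positivity
  set u := 4 * (12 * C₀ + 1) with hu
  have hu0 : 0 ≤ u := by positivity
  refine ⟨(1 + u) * (256 * (1 + w)) + 4, by positivity, 1 / (96 * (C₀ + 1) + 2 * C1), by positivity, ?_⟩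
  intro τ lam hτ hτ0 hl N e he ho
  rw [le_div_iff₀ (by positivity)] at hτ0
  have hτ96 : τ * (96 * (C₀ + 1)) ≤ 1 := by nlinarith [mul_pos hτ hC1]
  have hτC1 : C1 * τ ≤ 1 / 2 := by nlinarith [mul_pos hτ hC]
  have hτh : τ ≤ 1 / 96 := by nlinarith [mul_pos hτ hC]
  obtain ⟨hl1, hlt, hlt4⟩ := ar_lam hτ (by linarith) hl
  set a := τ ^ 2 with ha
  have ha0 : 0 < a := by positivity
  have haτ : a ≤ τ := by rw [ha]; nlinarith
  have hac : 96 * a * (C₀ + 1) ≤ 1 := ar_a haτ hC.le hτ96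
  have hac' : 12 * a * C₀ ≤ 1 / 8 := by linarith
  set C := (1 + u) * (256 * (1 + w)) + 4 with hCd
  set lam2 := lam * (1 + C * τ) with hlam2
  have hC0 : 0 < C := by positivity
  have hlam2p : 0 ≤ lam2 := by positivity
  obtain ⟨R, hR, hRb⟩ := cpt_R (K := ⋃ j, tsupport (e j)) (isCompact_iUnion fun j => (he j).2.1) (Set.iUnion_subset fun j => (he j).2.2)
  have hRe : ∀ j, ∀ p ∈ tsupport (e j), |p.1| < R ∧ R⁻¹ < p.2 ∧ p.2 < R := fun j p hp => hRb p (Set.mem_iUnion.2 ⟨j, hp⟩)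
  obtain ⟨s, X, Y, χ, H⟩ := hP a R ha0 (by linarith) hR
  have hs : ∀ i, tsupport (χ i) ⊆ Tl a (X i) (Y i) := H.sup
  have hχc : ∀ i, Hc (χ i) := fun i => IsCompact.of_isClosed_subset (isCompact_Icc.prod isCompact_Icc) (isClosed_tsupport _) (hs i)
  have hU : ∀ i, tsupport (χ i) ⊆ UHP := fun i => (hs i).trans (Tl_UHP (H.pos i))
  set D := lam * (1 + C1 * τ) with hD
  have hDe : D = lam + C1 / a ^ 2 := by rw [div_eq_mul_one_div, hlt4, hD]; ring
  have step : ∀ j, lam - qA P Q (e j) ≤ ∑ i ∈ s, (D * wn (fun p => (χ i p : ℂ) * e j p) - ∫ p, dens P Q (fun p => (χ i p : ℂ) * e j p) p) := by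
    intro j
    have w1 := wi_self (by rw [ho j j, if_pos rfl])
    have i1 := PUn_ims h1.continuousOn h2.continuousOn ha0 H (he j) (hRe j)
    rw [Finset.sum_sub_distrib, ← Finset.mul_sum, PUn_wn H (he j) (hRe j), w1]
    rw [w1] at i1
    linarith
  refine (Finset.sum_le_sum fun j _ => step j).trans ?_
  rw [Finset.sum_comm]
  have tile : ∀ i ∈ s, ∑ j, (D * wn (fun p => (χ i p : ℂ) * e j p) - ∫ p, dens P Q (fun p => (χ i p : ℂ) * e j p) p) ≤
      1 / (2 * π) * ∫ p, χ i p ^ 2 * Gt (intenB P Q p) lam2 ∂volH := by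
    intro i _
    have hY := H.pos i
    set b := intenB P Q (X i, Y i) with hb
    have hb0 : 0 ≤ b := abs_nonneg _
    rcases le_or_gt b (2 * lam) with hbl | hbl
    · have hDD := (ar_D (c := c) hC1 hτ (by linarith) hl1)
      have hee := ar_e (c := c) hτ hl hb0 (by linarith)
      refine (tile_up_lo (D := D) (lam' := lam * (1 + w * τ)) h1 h2 hC hH ha0 hY (by linarith) hτ (by linarith) (H.sm i) (hs i) (hχc i) (by rw [← hc, ← hb]; linarith) (by positivity) he ho).trans ?_
      rw [← icm]
      refine mll ?_ (by positivity)
      refine integral_mono ((int_chi (H.sm i).continuous (hχc i) (hU i)).const_mul _) (int_chiGt h1 h2 _ (H.sm i).continuous (hχc i) (hU i)) fun p => ?_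
      rw [mul_comm (χ i p ^ 2)]
      by_cases hp : χ i p = 0
      · simp [hp]
      refine mlr ?_ (sq_nonneg _)
      have hpT := hs i (subset_tsupport _ hp)
      refine (Gt_scale (by positivity) (one_le_pow₀ (by linarith only [ha0]))).trans ?_
      have hv := abs_le.1 (intenB_var h1 h2 hC hH ha0 hY (by linarith) hpT (Tl_corner ha0 hY))
      have hCC := mll (ar_C (u := u) (w := w) hu0 hw0 hτ (by linarith)) (by linarith : 0 ≤ lam)
      have hm1 : (1 + 4 * ((12 * C₀ + 1) * a)) * ((1 + 3 * a) ^ 4 * (lam * (1 + w * τ))) + 5 * (lam * τ) ≤ lam2 := by linarith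
      have hX0 : 0 ≤ (1 + 3 * a) ^ 4 * (lam * (1 + w * τ)) := by positivity
      refine Gt_cmp (κ := (12 * C₀ + 1) * a) (by positivity) (abs_nonneg _) (by positivity) (by linarith) ?_ hX0 (by linarith) ?_
      · exact ar_v ha0 hC hb0 hv
      · have : (1 + 3 * a) ^ 4 * (lam * (1 + w * τ)) + 5 ≤ lam2 := by
          exact ar_m (by positivity) hX0 hm1 hlt
        exact ar_sq hX0 this
    · refine (Finset.sum_nonpos fun j _ => ?_).trans ?_
      · have := tile_up_hi (D := D) h1 h2 hC hH ha0 hY (by linarith) (H.sm i) (hs i) (ar_hi hl1 hτC1 hbl hac') (he j)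
        linarith
      · refine mul_nonneg (by positivity) (integral_nonneg fun p => mul_nonneg (sq_nonneg _) (Gt_nonneg (abs_nonneg _)))
  refine (Finset.sum_le_sum tile).trans ?_
  rw [← Finset.mul_sum, ← integral_finsetSum _ fun i _ => int_chiGt h1 h2 _ (H.sm i).continuous (hχc i) (hU i)]
  refine mll ?_ (by positivity)
  refine integral_mono (integrable_finsetSum _ fun i _ => int_chiGt h1 h2 _ (H.sm i).continuous (hχc i) (hU i)) (int_Gt h1 h2 hH1 hlam2p) fun p => ?_
  rw [← Finset.sum_mul]
  exact mul_le_of_le_one_left (Gt_nonneg (abs_nonneg _)) (H.le1 p)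
def sH' (β c : ℝ) (k : ℕ) (y : ℝ) : ℝ := √(√β) * √β * hF' k (√β * (y - c))
lemma sH_deriv (β c : ℝ) (k : ℕ) (y : ℝ) : HasDerivAt (sH β c k) (sH' β c k y) y := by
  have h0 : HasDerivAt (fun y => √β * (y - c)) √β y := by
    simpa using ((hasDerivAt_id y).sub_const c).const_mul (√β)
  have := ((hF_deriv k (√β * (y - c))).comp y h0).const_mul (√(√β))
  exact this.congr_deriv (by simp only [sH']; ring)
lemma sH'_deriv {β : ℝ} (hβ : 0 ≤ β) (c : ℝ) (k : ℕ) (y : ℝ) :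
    HasDerivAt (sH' β c k) ((β ^ 2 * (y - c) ^ 2 - (2 * k + 1) * β) * sH β c k y) y := by
  have h0 : HasDerivAt (fun y => √β * (y - c)) √β y := by
    simpa using ((hasDerivAt_id y).sub_const c).const_mul (√β)
  have := ((hF'_deriv k (√β * (y - c))).comp y h0).const_mul (√(√β) * √β)
  refine this.congr_deriv ?_
  have e := Real.sq_sqrt hβ
  simp only [sH]
  grind
lemma sH'_cont (β c : ℝ) (k : ℕ) : Continuous (sH' β c k) := by
  unfold sH'
  have := hF'_cont k
  fun_prop
lemma sH_smooth (β c : ℝ) (k : ℕ) : Sm (sH β c k) := by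
  exact contDiff_const.mul ((hF_smooth k).comp (contDiff_const.mul (contDiff_id.sub contDiff_const)))
lemma lF_smooth (B ζ : ℝ) (k : ℕ) : Sm (lF B ζ k) := by
  refine ContDiff.mul ?_ (Complex.ofRealCLM.contDiff.comp ((sH_smooth _ _ k).comp contDiff_snd))
  exact ((Complex.ofRealCLM.contDiff.comp ((contDiff_const.mul contDiff_fst).mul contDiff_const)).mul contDiff_const).cexp
lemma lF_hasF (B ζ : ℝ) (k : ℕ) (p : Rp) :
    dX (lF B ζ k) p = (Ii * (2 * π * ζ : ℝ)) * lF B ζ k p ∧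
    dY (lF B ζ k) p = Complex.exp (↑(2 * π * p.1 * ζ) * Ii) * (sH' |B| (-(2 * π * ζ) / B) k p.2 : ℂ) := by
  have e : lF B ζ k = fun p => cE (fun p => 2 * π * p.1 * ζ) p * (fun p : Rp => (sH |B| (-(2 * π * ζ) / B) k p.2 : ℂ)) p := rfl
  have h1 : HasFDerivAt (fun p : Rp => 2 * π * p.1 * ζ) ((2 * π * ζ) • ContinuousLinearMap.fst ℝ ℝ ℝ) p := by
    have := ((hasFDerivAt_fst (𝕜 := ℝ) (p := p)).const_mul (2 * π)).mul_const ζ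
    exact this.congr_fderiv (by ext <;> simp; ring)
  have h2 : HasFDerivAt (fun p : Rp => (sH |B| (-(2 * π * ζ) / B) k p.2 : ℂ)) _ p :=
    ((sH_deriv |B| (-(2 * π * ζ) / B) k p.2).ofReal_comp.hasFDerivAt).comp p (hasFDerivAt_snd (𝕜 := ℝ) (p := p))
  simp only [dX, dY]
  rw [e, fd_emul h1.differentiableAt h2.differentiableAt, fd_emul h1.differentiableAt h2.differentiableAt, h1.fderiv, h2.fderiv]
  constructor
  · simp; ring
  · simp [cE]
lemma lF_energy_pt {B : ℝ} (hB : B ≠ 0) (ζ : ℝ) (k : ℕ) {χ : Rp → ℝ} (hχ : Sm χ) (p : Rp) :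
    dens (fun p => -(B * p.2)) (fun _ => 0) (fun p => (χ p : ℂ) * lF B ζ k p) p =
    ((dXr χ p) ^ 2 + (dYr χ p) ^ 2 + (2 * k + 1) * |B| * χ p ^ 2) * ‖lF B ζ k p‖ ^ 2 +
     (χ p ^ 2 * (sH' |B| (-(2 * π * ζ) / B) k p.2 ^ 2 + sH |B| (-(2 * π * ζ) / B) k p.2 * ((|B| ^ 2 * (p.2 - (-(2 * π * ζ) / B)) ^ 2 - (2 * k + 1) * |B|) * sH |B| (-(2 * π * ζ) / B) k p.2)) +
      2 * χ p * dYr χ p * (sH |B| (-(2 * π * ζ) / B) k p.2 * sH' |B| (-(2 * π * ζ) / B) k p.2)) := by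
  have hd := sm_diff hχ p
  have hl := sm_diff (lF_smooth B ζ k) p
  obtain ⟨x1, x2⟩ := lF_hasF B ζ k p
  simp only [dens, dX, dY, fd_rmul hd hl]
  rw [ims_one, ims_one]
  change χ p ^ 2 * ‖-Ii * dX (lF B ζ k) p - _‖ ^ 2 + dXr χ p ^ 2 * _ + χ p * dXr χ p * (2 * ((dX (lF B ζ k) p).re * _ + (dX (lF B ζ k) p).im * _)) + 
    (χ p ^ 2 * ‖-Ii * dY (lF B ζ k) p - _‖ ^ 2 + dYr χ p ^ 2 * _ + χ p * dYr χ p * (2 * ((dY (lF B ζ k) p).re * _ + (dY (lF B ζ k) p).im * _))) = _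
  rw [x1, x2]
  have e1 : -Ii * (Ii * (2 * π * ζ : ℝ) * lF B ζ k p) - ((-(B * p.2) : ℝ) : ℂ) * lF B ζ k p = ((2 * π * ζ + B * p.2 : ℝ) : ℂ) * lF B ζ k p := by
    push_cast; linear_combination (-2 * π * ζ * lF B ζ k p) * Complex.I_sq
  rw [e1, norm_mul, mul_pow, Complex.norm_real, nea, sq_abs]
  have e2 : (Ii * (2 * π * ζ : ℝ) * lF B ζ k p).re * (lF B ζ k p).re + (Ii * (2 * π * ζ : ℝ) * lF B ζ k p).im * (lF B ζ k p).im = 0 := by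
    simp ; ring
  rw [e2, lF_norm]
  have e3 : ‖-Ii * (Complex.exp (↑(2 * π * p.1 * ζ) * Ii) * (sH' |B| (-(2 * π * ζ) / B) k p.2 : ℂ)) - ((0 : ℝ) : ℂ) * lF B ζ k p‖ ^ 2 = sH' |B| (-(2 * π * ζ) / B) k p.2 ^ 2 := by
    simp only [Complex.ofReal_zero, zero_mul, sub_zero]
    rw [norm_mul, norm_mul, Complex.norm_exp_ofReal_mul_I]; simp
  rw [e3]
  have e4 : ∀ (E : ℂ) (s t : ℝ), ‖E‖ = 1 → (E * (t : ℂ)).re * (E * (s : ℂ)).re + (E * (t : ℂ)).im * (E * (s : ℂ)).im = s * t := by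
    intro E s t h
    have h2 : E.re * E.re + E.im * E.im = 1 := by
      rw [← Complex.normSq_apply, Complex.normSq_eq_norm_sq, h]; norm_num
    simp; grind
  rw [show (lF B ζ k p) = Complex.exp (↑(2 * π * p.1 * ζ) * Ii) * (sH |B| (-(2 * π * ζ) / B) k p.2 : ℂ) from rfl, e4 _ _ _ (Complex.norm_exp_ofReal_mul_I _)]
  grind
lemma lF_energy {B : ℝ} (hB : B ≠ 0) (ζ : ℝ) (k : ℕ) {χ : Rp → ℝ} (hχ : Sm χ) (hc : Hc χ) :
    ∫ p, dens (fun p => -(B * p.2)) (fun _ => 0) (fun p => (χ p : ℂ) * lF B ζ k p) p =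
    ∫ p, ((dXr χ p) ^ 2 + (dYr χ p) ^ 2 + (2 * k + 1) * |B| * χ p ^ 2) * ‖lF B ζ k p‖ ^ 2 := by
  simp only [lF_energy_pt hB ζ k hχ]
  set c := -(2 * π * ζ) / B
  set s := sH |B| c k
  set s' := sH' |B| c k
  set D := fun p : Rp => s' p.2 ^ 2 + s p.2 * ((|B| ^ 2 * (p.2 - c) ^ 2 - (2 * k + 1) * |B|) * s p.2)
  have cs : Continuous s := sH_cont' _ _ _
  have cs' : Continuous s' := sH'_cont _ _ _
  have cX : Continuous (dXr χ) := (sm_fd hχ (1, 0)).continuous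
  have cY : Continuous (dYr χ) := (sm_fd hχ (0, 1)).continuous
  have hX := cs_fd hc (1, 0)
  have hY := cs_fd hc (0, 1)
  have clF := lF_cont' B ζ k
  have hc2 := hc.comp_left (g := fun t : ℝ => t ^ 2) (by simp)
  have hG : ∀ p : Rp, HasFDerivAt (fun p : Rp => s p.2 * s' p.2) ((D p) • ContinuousLinearMap.snd ℝ ℝ ℝ) p := by
    intro p
    have := ((sH_deriv |B| c k p.2).mul (sH'_deriv (abs_nonneg B) c k p.2)).hasFDerivAt.comp p (hasFDerivAt_snd (𝕜 := ℝ) (p := p))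
    exact this.congr_fderiv (by ext <;> simp [D, s]; ring)
  have hχ2 : ∀ p : Rp, HasFDerivAt (fun p => χ p ^ 2) ((2 * χ p ^ 1) • fderiv ℝ χ p) p := by
    intro p
    simpa using (sm_diff hχ p).hasFDerivAt.pow 2
  have i1 : Integrable (fun p => χ p ^ 2 * D p) := icc (by fun_prop) hc2.mul_right
  have i2 : Integrable (fun p => 2 * χ p * dYr χ p * (s p.2 * s' p.2)) :=
    icc (by fun_prop) (hY.mul_left.mul_right)
  have i3 : Integrable (fun p => χ p ^ 2 * (s p.2 * s' p.2)) := icc (by fun_prop) hc2.mul_right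
  have z := integral_mul_fderiv_eq_neg_fderiv_mul_of_integrable (μ := (volume : Measure (Rp))) (f := fun p => χ p ^ 2) (g := fun p => s p.2 * s' p.2) (v := (0, 1))
    (by convert i2 using 1; funext p; rw [(hχ2 p).fderiv]; simp [dYr])
    (by convert i1 using 1; funext p; rw [(hG p).fderiv]; simp) i3 (fun x _ => (hχ2 x).differentiableAt) (fun x _ => (hG x).differentiableAt)
  have ei : ∫ p, (χ p ^ 2 * D p + 2 * χ p * dYr χ p * (s p.2 * s' p.2)) = 0 := by
    rw [integral_add i1 i2]
    have a1 : ∀ p, (fderiv ℝ (fun p : Rp => s p.2 * s' p.2) p) (0, 1) = D p := by intro p; rw [(hG p).fderiv]; simp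
    have a2 : ∀ p, (fderiv ℝ (fun p => χ p ^ 2) p) (0, 1) = 2 * χ p * dYr χ p := by intro p; rw [(hχ2 p).fderiv]; simp [dYr]
    simp only [a1, a2] at z
    rw [z]; ring
  have i4 : Integrable (fun p => ((dXr χ p) ^ 2 + (dYr χ p) ^ 2 + (2 * k + 1) * |B| * χ p ^ 2) * ‖lF B ζ k p‖ ^ 2) := by
    refine icc (by fun_prop) (HasCompactSupport.mul_right ?_)
    exact ((hX.comp_left (g := fun t : ℝ => t ^ 2) (by simp)).add (hY.comp_left (g := fun t : ℝ => t ^ 2) (by simp))).add hc2.mul_left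
  exact (integral_add i4 (i1.add i2)).trans (by rw [show ∫ p, ((fun p => χ p ^ 2 * D p) + fun p => 2 * χ p * dYr χ p * (s p.2 * s' p.2)) p = 0 from ei, add_zero])
lemma exp_orth (X : ℝ) {L : ℝ} (hL : 0 < L) (t : ℝ) (l l' : ℕ) :
    ∫ x in Set.Icc X (X + L), starRingEnd ℂ (Complex.exp (↑(2 * π * x * ((t + l) / L)) * Ii)) * Complex.exp (↑(2 * π * x * ((t + l') / L)) * Ii)
      = if l = l' then (L : ℂ) else 0 := by
  have hL' : (L : ℂ) ≠ 0 := by exact_mod_cast hL.ne'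
  have e : ∀ x : ℝ, starRingEnd ℂ (Complex.exp (↑(2 * π * x * ((t + l) / L)) * Ii)) * Complex.exp (↑(2 * π * x * ((t + l') / L)) * Ii)
      = Complex.exp ((((l' : ℤ) - (l : ℤ) : ℤ) : ℂ) * (2 * π * Ii) / L * x) := by
    intro x
    rw [← Complex.exp_conj, ← Complex.exp_add]
    congr 1
    simp only [map_mul, Complex.conj_ofReal, Complex.conj_I]
    push_cast; field_simp; ring
  simp only [e]
  rw [integral_Icc_eq_integral_Ioc, ← intervalIntegral.integral_of_le (by linarith)]
  split_ifs with h
  · subst h; simp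
  · have hc : ((((l' : ℤ) - (l : ℤ) : ℤ) : ℂ) * (2 * π * Ii) / L) ≠ 0 := by
      refine div_ne_zero (mul_ne_zero ?_ Complex.two_pi_I_ne_zero) hL'
      exact_mod_cast (by omega : ((l' : ℤ) - (l : ℤ) : ℤ) ≠ 0)
    rw [integral_exp_mul_complex hc]
    have : Complex.exp ((((l' : ℤ) - (l : ℤ) : ℤ) : ℂ) * (2 * π * Ii) / L * ((X + L : ℝ) : ℂ)) =
       Complex.exp ((((l' : ℤ) - (l : ℤ) : ℤ) : ℂ) * (2 * π * Ii) / L * X) := by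
      have : (((l' : ℤ) - (l : ℤ) : ℤ) : ℂ) * (2 * π * Ii) / L * ((X + L : ℝ) : ℂ) =
        (((l' : ℤ) - (l : ℤ) : ℤ) : ℂ) * (2 * π * Ii) / L * X + (((l' : ℤ) - (l : ℤ) : ℤ) : ℂ) * (2 * π * Ii) := by
        push_cast; field_simp
      rw [this, Complex.exp_add, Complex.exp_int_mul_two_pi_mul_I, mul_one]
    rw [this]; simp
lemma lF_orth {B : ℝ} (hB : B ≠ 0) (X : ℝ) {L : ℝ} (hL : 0 < L) (t : ℝ) (j j' : ℕ × ℕ) :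
    ∫ p, starRingEnd ℂ (lF B ((t + j.2) / L) j.1 p) * lF B ((t + j'.2) / L) j'.1 p ∂((volume.restrict (Set.Icc X (X + L))).prod volume)
      = if j = j' then (L : ℂ) else 0 := by
  have e : ∀ p : Rp, starRingEnd ℂ (lF B ((t + j.2) / L) j.1 p) * lF B ((t + j'.2) / L) j'.1 p =
     (fun x : ℝ => starRingEnd ℂ (Complex.exp (↑(2 * π * x * ((t + j.2) / L)) * Ii)) * Complex.exp (↑(2 * π * x * ((t + j'.2) / L)) * Ii)) p.1 *
     (fun y : ℝ => ((sH |B| (-(2 * π * ((t + j.2) / L)) / B) j.1 y * sH |B| (-(2 * π * ((t + j'.2) / L)) / B) j'.1 y : ℝ) : ℂ)) p.2 := by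
    intro p
    simp only [lF, map_mul, Complex.conj_ofReal]
    push_cast; ring
  have q := integral_prod_mul (L := ℂ) (μ := volume.restrict (Set.Icc X (X + L))) (ν := (volume : Measure ℝ)) 
     (fun x : ℝ => starRingEnd ℂ (Complex.exp (↑(2 * π * x * ((t + j.2) / L)) * Ii)) * Complex.exp (↑(2 * π * x * ((t + j'.2) / L)) * Ii))
     (fun y : ℝ => ((sH |B| (-(2 * π * ((t + j.2) / L)) / B) j.1 y * sH |B| (-(2 * π * ((t + j'.2) / L)) / B) j'.1 y : ℝ) : ℂ))
  refine (integral_congr_ae (evf e)).trans (q.trans ?_)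
  rw [exp_orth X hL]
  by_cases h : j.2 = j'.2
  · rw [if_pos h, integral_complex_ofReal, h, (sH_orth (abs_pos.2 hB) _ _ _).2]
    by_cases h' : j.1 = j'.1
    · rw [if_pos h', if_pos (Prod.ext h' h)]; simp
    · rw [if_neg h', if_neg fun q => h' (by rw [q])]; simp
  · rw [if_neg h, if_neg fun q => h (by rw [q])]; simp
lemma lF_memLp {B : ℝ} (hB : B ≠ 0) (X L ζ : ℝ) (k : ℕ) :
    MemLp (lF B ζ k) 2 ((volume.restrict (Set.Icc X (X + L))).prod volume) := by
  rw [memLp_two_iff_integrable_sq_norm (lF_cont' B ζ k).aestronglyMeasurable]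
  simp only [lF_norm]
  have := Integrable.mul_prod (f := fun _ : ℝ => (1 : ℝ)) (μ := volume.restrict (Set.Icc X (X + L))) (ν := volume) (by simp) (sH_orth (abs_pos.2 hB) (-(2 * π * ζ) / B) k k).1
  grind
lemma tile_bessel {B : ℝ} (hB : B ≠ 0) (X : ℝ) {L : ℝ} (hL : 0 < L) (t : ℝ) (S : Finset (ℕ × ℕ)) {g : Rp → ℂ}
    (hg : Continuous g) (hgc : Hc g) (hs : ∀ p, g p ≠ 0 → p.1 ∈ Set.Icc X (X + L)) :
    ∑ j ∈ S, ‖∫ p, starRingEnd ℂ (lF B ((t + j.2) / L) j.1 p) * g p‖ ^ 2 ≤ L * ∫ p, ‖g p‖ ^ 2 := by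
  set μ := ((volume.restrict (Set.Icc X (X + L))).prod (volume : Measure ℝ))
  have hμ : μ = (volume : Measure (Rp)).restrict (Set.Icc X (X + L) ×ˢ Set.univ) := by
    rw [Measure.volume_eq_prod, ← Measure.prod_restrict, Measure.restrict_univ]
  have hgm : MemLp g 2 μ := by rw [hμ]; exact (memLp_cs hg hgc).restrict _
  have hl : (L : ℂ) = ((√L : ℝ) : ℂ) * ((√L : ℝ) : ℂ) := by rw [← Complex.ofReal_mul, Real.mul_self_sqrt hL.le]
  have hs0 : ((√L : ℝ) : ℂ) ≠ 0 := by exact_mod_cast (Real.sqrt_pos.2 hL).ne'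
  have ho : Orthonormal ℂ (fun j : ℕ × ℕ => ((√L : ℝ) : ℂ)⁻¹ • (lF_memLp hB X L ((t + j.2) / L) j.1).toLp _) := by
    rw [orthonormal_iff_ite]; intro j j'
    rw [inner_smul_left, inner_smul_right, l2_inner, lF_orth hB X hL t j j']
    split_ifs
    · rw [hl]; simp; field_simp
    · simp
  have := ho.sum_inner_products_le (s := S) (hgm.toLp _)
  rw [l2_norm_sq] at this
  have r : ∀ f : Rp → ℂ, (∀ p, f p ≠ 0 → g p ≠ 0) → ∫ p, f p ∂μ = ∫ p, f p := by
    intro f hf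
    rw [hμ]
    exact setIntegral_eq_integral_of_forall_compl_eq_zero fun p hp => by
      by_contra h; exact hp ⟨hs p (hf p h), trivial⟩
  have r2 : ∫ p, ‖g p‖ ^ 2 ∂μ = ∫ p, ‖g p‖ ^ 2 := by
    rw [hμ]
    exact setIntegral_eq_integral_of_forall_compl_eq_zero fun p hp => by
      by_contra h; exact hp ⟨hs p (by rintro h0; apply h; simp [h0]), trivial⟩
  rw [r2] at this
  refine le_trans (le_of_eq ?_) (mll this hL.le)
  rw [Finset.mul_sum]
  refine Finset.sum_congr rfl fun j _ => ?_
  rw [inner_smul_left, l2_inner, r _ (fun p h h0 => h (by simp [h0])), norm_mul, mul_pow]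
  have : ‖(starRingEnd ℂ) ((√L : ℝ) : ℂ)⁻¹‖ ^ 2 = L⁻¹ := by
    rw [RCLike.norm_conj, norm_inv, Complex.norm_real, inv_pow, nea, sq_abs, Real.sq_sqrt hL.le]
  rw [this, ← mul_assoc, mul_inv_cancel₀ hL.ne', one_mul]
lemma avg {G : ℝ → ℝ} (hG : Integrable G) {X0 : ℝ} (h : ∀ (t : ℝ) (M : ℕ), ∑ l ∈ Finset.range (2 * M), G (t - M + l) ≤ X0) :
    ∫ t, G t ≤ X0 := by
  have lim := intervalIntegral_tendsto_integral hG (a := fun M : ℕ => -(M : ℝ)) (b := fun M : ℕ => (M : ℝ)) (l := atTop)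
    (tendsto_neg_atTop_atBot.comp tendsto_natCast_atTop_atTop) tendsto_natCast_atTop_atTop
  refine le_of_tendsto' lim fun M => ?_
  have ii : ∀ a b, IntervalIntegrable G volume a b := fun a b => hG.intervalIntegrable
  have e := intervalIntegral.sum_integral_adjacent_intervals (f := G) (μ := volume) (a := fun l : ℕ => -(M : ℝ) + l) (n := 2 * M) (fun k _ => ii _ _)
  have e2 : ∀ l : ℕ, ∫ t in (-(M : ℝ) + l)..(-(M : ℝ) + (l + 1 : ℕ)), G t = ∫ t in (0 : ℝ)..1, G (t - M + l) := by
    intro l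
    have := intervalIntegral.integral_comp_add_right (f := G) (a := 0) (b := 1) (-(M : ℝ) + l)
    grind
  simp only [e2] at e
  rw [show -(M : ℝ) + (0 : ℕ) = -M by simp, show -(M : ℝ) + (2 * M : ℕ) = M by push_cast; ring] at e
  have ii2 : ∀ l : ℕ, IntervalIntegrable (fun t : ℝ => G (t - M + l)) volume 0 1 := fun l => by
    have := hG.comp_add_right (-(M : ℝ) + l)
    refine Integrable.intervalIntegrable ?_
    grind
  rw [← e, ← intervalIntegral.integral_finsetSum fun l _ => ii2 l]
  have := intervalIntegral.integral_mono_on (μ := volume) (zero_le_one (α := ℝ)) (IntervalIntegrable.sum (Finset.range (2 * M)) fun l _ => ii2 l) (g := fun _ => X0) (by simp) fun t _ => by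
    simpa using h t M
  simpa using this
def tF (φ χ : Rp → ℝ) (B ζ : ℝ) (k : ℕ) (p : Rp) : ℂ := cE φ p * ((χ p : ℂ) * lF B ζ k p)
lemma tF_test {φ χ : Rp → ℝ} (hφ : Sm φ) (hχ : Sm χ) (hc : Hc χ) (hU : tsupport χ ⊆ UHP)
    (B ζ : ℝ) (k : ℕ) : IsTestOn UHP (tF φ χ B ζ k) := by
  have h1 := hc.comp_left (g := fun t : ℝ => (t : ℂ)) (by simp)
  have h2 := closure_mono (Function.support_comp_subset (g := fun t : ℝ => (t : ℂ)) (by simp) χ)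
  refine ⟨(cE_smooth hφ).mul ((Complex.ofRealCLM.contDiff.comp hχ).mul (lF_smooth B ζ k)), (h1.mul_right).mul_left, ?_⟩
  exact (tsupport_mul_subset_right).trans ((tsupport_mul_subset_left).trans (h2.trans hU))
lemma tF_nsq (φ χ : Rp → ℝ) (B ζ : ℝ) (k : ℕ) (p : Rp) : ‖tF φ χ B ζ k p‖ ^ 2 = χ p ^ 2 * ‖lF B ζ k p‖ ^ 2 := by
  rw [tF, norm_mul, norm_mul, cE_norm, Complex.norm_real, nea, one_mul, mul_pow, sq_abs]
def Wk (χ : Rp → ℝ) (m τ : ℝ) (p : Rp) : ℝ := m * χ p ^ 2 - (1 + τ) * (dXr χ p ^ 2 + dYr χ p ^ 2)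
lemma Wk_cont {χ : Rp → ℝ} (hχ : Sm χ) (hc : Hc χ) (m τ : ℝ) :
    Continuous (Wk χ m τ) ∧ Hc (Wk χ m τ) := by
  have cX : Continuous (dXr χ) := (sm_fd hχ (1, 0)).continuous
  have cY : Continuous (dYr χ) := (sm_fd hχ (0, 1)).continuous
  have hX := cs_fd hc (1, 0)
  have hY := cs_fd hc (0, 1)
  have hc2 := hc.comp_left (g := fun t : ℝ => t ^ 2) (by simp)
  constructor
  · unfold Wk; fun_prop
  · exact hc2.mul_left.sub ((hX.comp_left (g := fun t : ℝ => t ^ 2) (by simp)).add (hY.comp_left (g := fun t : ℝ => t ^ 2) (by simp))).mul_left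
lemma tF_low {P Q φ χ : Rp → ℝ} (h1 : ContinuousOn P UHP) (h2 : ContinuousOn Q UHP)
    (hφ : Sm φ) (hχ : Sm χ) (hc : Hc χ) (hU : tsupport χ ⊆ UHP)
    {B ε τ lam m : ℝ} (hB : B ≠ 0) (hτ : 0 < τ) (ζ : ℝ) (k : ℕ)
    (hε : ∀ p, χ p ≠ 0 → |P p - dXr φ p + B * p.2| ≤ ε ∧ |Q p - dYr φ p| ≤ ε ∧ m ≤ lam * (p.2 ^ 2)⁻¹) :
    ∫ p, Wk χ (m - (1 + τ) * ((2 * k + 1) * |B|) - (1 + τ⁻¹) * (2 * ε ^ 2)) τ p * ‖lF B ζ k p‖ ^ 2 ≤ lam * wn (tF φ χ B ζ k) - qA P Q (tF φ χ B ζ k) := by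
  have ht := tF_test hφ hχ hc hU B ζ k
  have clF := lF_cont' B ζ k
  have cX : Continuous (dXr χ) := (sm_fd hχ (1, 0)).continuous
  have cY : Continuous (dYr χ) := (sm_fd hχ (0, 1)).continuous
  have hX := cs_fd hc (1, 0)
  have hY := cs_fd hc (0, 1)
  have hc2 := hc.comp_left (g := fun t : ℝ => t ^ 2) (by simp)
  let v : Rp → ℂ := fun p => (χ p : ℂ) * lF B ζ k p
  have hv : Sm v := (Complex.ofRealCLM.contDiff.comp hχ).mul (lF_smooth B ζ k)
  have h1c := hc.comp_left (g := fun t : ℝ => (t : ℂ)) (by simp)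
  have hvc : Hc v := h1c.mul_right
  have hvt : IsTestOn UHP v := by
    have := tF_test (φ := fun _ => 0) contDiff_const hχ hc hU B ζ k
    convert this using 1
    funext p; simp [tF, cE, v]
  have hvn : ∀ p, ‖v p‖ ^ 2 = χ p ^ 2 * ‖lF B ζ k p‖ ^ 2 := fun p => by
    simp only [v]; rw [norm_mul, Complex.norm_real, nea, mul_pow, sq_abs]
  have i1 := dens_int h1 h2 ht
  have i2 : Integrable (dens (fun p => -(B * p.2)) (fun _ => 0) v) := dens_int (by fun_prop) (by fun_prop) hvt
  have i3 := nint hv.continuous hvc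
  have i5 := wn_int ht
  have i4 : Integrable (fun p => ((dXr χ p) ^ 2 + (dYr χ p) ^ 2 + (2 * k + 1) * |B| * χ p ^ 2) * ‖lF B ζ k p‖ ^ 2) := by
    refine icc (by fun_prop) (HasCompactSupport.mul_right ?_)
    exact ((hX.comp_left (g := fun t : ℝ => t ^ 2) (by simp)).add (hY.comp_left (g := fun t : ℝ => t ^ 2) (by simp))).add hc2.mul_left
  have pw : ∀ p, dens P Q (tF φ χ B ζ k) p ≤ (1 + τ) * dens (fun p => -(B * p.2)) (fun _ => 0) v p + (1 + τ⁻¹) * (2 * ε ^ 2) * ‖v p‖ ^ 2 := by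
    intro p
    change dens P Q (fun p => cE φ p * v p) p ≤ _
    rw [dens_gauge (sm_diff hφ p) (sm_diff hv p)]
    refine (dens_pert hτ fun h => ?_).2
    have hc0 : χ p ≠ 0 := by rintro h0; apply h; simp [v, h0]
    grind
  have s1 := integral_mono i1 ((i2.const_mul (1 + τ)).add (i3.const_mul ((1 + τ⁻¹) * (2 * ε ^ 2)))) pw
  simp at s1
  rw [integral_add (i2.const_mul _) (i3.const_mul _), icm, icm, lF_energy hB ζ k hχ hc] at s1
  have s2 : m * (∫ p, ‖v p‖ ^ 2) ≤ lam * wn (tF φ χ B ζ k) := by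
    rw [wn, ← icm, ← icm]
    refine integral_mono (i3.const_mul _) (i5.const_mul _) fun p => ?_
    rw [tF_nsq, hvn]
    by_cases h0 : χ p = 0
    · simp [h0]
    · rw [← mul_assoc lam]; exact mlr (hε p h0).2.2 (by positivity)
  rw [qA_eq ht]
  have s3 : ∫ p, Wk χ (m - (1 + τ) * ((2 * k + 1) * |B|) - (1 + τ⁻¹) * (2 * ε ^ 2)) τ p * ‖lF B ζ k p‖ ^ 2 =
     (m - (1 + τ⁻¹) * (2 * ε ^ 2)) * (∫ p, ‖v p‖ ^ 2) - (1 + τ) * ∫ p, ((dXr χ p) ^ 2 + (dYr χ p) ^ 2 + (2 * k + 1) * |B| * χ p ^ 2) * ‖lF B ζ k p‖ ^ 2 := by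
    rw [← icm, ← icm, ← integral_sub (i3.const_mul _) (i4.const_mul _)]
    congr 1; funext p; rw [hvn, Wk]; ring
  linarith
lemma Wk_scale {χ : Rp → ℝ} (hχ : Sm χ) (c m τ : ℝ) (p : Rp) :
    Wk (fun p => c * χ p) m τ p = c ^ 2 * Wk χ m τ p := by
  have e := fderiv_const_mul (sm_diff hχ p) c
  simp only [Wk, dXr, dYr, e]
  simp; ring
lemma bessel_one {φ χ : Rp → ℝ} (hφ : Sm φ) (hχ : Sm χ) {B : ℝ} (hB : B ≠ 0)
    {X Y a : ℝ} (ha : 0 < a) (hY : 0 < Y) (hs : tsupport χ ⊆ Tl a X Y) (t : ℝ) (S : Finset (ℕ × ℕ)) {u : Rp → ℂ} (hu : IsTestOn UHP u) :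
    ∑ j ∈ S, ‖wi (tF φ (fun p => Y / √(3 * a * Y) * χ p) B ((t + j.2) / (3 * a * Y)) j.1) u‖ ^ 2 ≤ ∫ p, (p.2 ^ 2)⁻¹ * ‖(χ p : ℂ) * u p‖ ^ 2 := by
  have hL : 0 < 3 * a * Y := by positivity
  have hq := rmul_test hχ hu
  have hc0 : Y / √(3 * a * Y) * (Y / √(3 * a * Y)) = Y ^ 2 / (3 * a * Y) := by grind
  set c := Y / √(3 * a * Y) with hc
  let g : Rp → ℂ := fun p => cE (fun p => -φ p) p * (c * ((((p.2 ^ 2)⁻¹ : ℝ) : ℂ) * ((χ p : ℂ) * u p)))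
  have ic : ContinuousOn (fun p : Rp => (p.2 ^ 2)⁻¹) UHP := by
    exact (inv_cont.pow 2).congr fun p _ => by simp
  have gc0 := cont_mulr ic hq.1.continuous hq.2.2
  have gc : Continuous g := (cE_smooth hφ.neg).continuous.mul (continuous_const.mul gc0)
  have ghc : Hc g := ((hq.2.1.mul_left).mul_left).mul_left
  have gs : ∀ p, g p ≠ 0 → p ∈ Tl a X Y := fun p hp => hs (subset_tsupport _ (by rintro h; apply hp; simp [g, h]))
  have b := tile_bessel hB X hL t S gc ghc (fun p hp => (gs p hp).1)
  refine le_trans (le_of_eq ?_) (b.trans ?_)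
  · refine Finset.sum_congr rfl fun j _ => ?_
    rw [wi]; congr 3; funext p
    simp only [g, tF, cE, map_mul, ← Complex.exp_conj, Complex.conj_ofReal, Complex.conj_I]
    push_cast; ring_nf
  · rw [← icm]
    refine integral_mono ((nint gc ghc).const_mul _) (wn_int hq) fun p => ?_
    by_cases h0 : g p = 0
    · rw [h0]; simp; positivity
    have hp := gs p h0
    have hy := hp.2.1
    have e : ‖g p‖ ^ 2 = Y ^ 2 / (3 * a * Y) * (((p.2 ^ 2)⁻¹) ^ 2 * ‖(χ p : ℂ) * u p‖ ^ 2) := by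
      rw [norm_mul, cE_norm, one_mul, norm_mul, norm_mul (((p.2 ^ 2)⁻¹ : ℝ) : ℂ), Complex.norm_real, Complex.norm_real, mul_pow, mul_pow, nea, nea, sq_abs, sq_abs, sq c, hc0]
    rw [e]
    have e2 : 3 * a * Y * (Y ^ 2 / (3 * a * Y) * (((p.2 ^ 2)⁻¹) ^ 2 * ‖(χ p : ℂ) * u p‖ ^ 2)) = (Y ^ 2 / p.2 ^ 2) * ((p.2 ^ 2)⁻¹ * ‖(χ p : ℂ) * u p‖ ^ 2) := by grind
    rw [e2]
    refine mul_le_of_le_one_left (by positivity) ?_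
    rw [div_le_one (by have := hY.trans_le hy; positivity)]; gcongr
lemma low_core {P Q : Rp → ℝ} (h1 : ContinuousOn P UHP) (h2 : ContinuousOn Q UHP) {s : Finset (ℕ × ℕ)} {φ χ : ℕ × ℕ → Rp → ℝ}
    {X Y B ε m : ℕ × ℕ → ℝ} {K : ℕ × ℕ → ℕ} {a τ lam X0 : ℝ} (ha : 0 < a) (hτ : 0 < τ) (hφ : ∀ i, Sm (φ i)) (hχ : ∀ i, Sm (χ i))
    (hY : ∀ i, 0 < Y i) (hB : ∀ i, B i ≠ 0) (hs : ∀ i, tsupport (χ i) ⊆ Tl a (X i) (Y i)) (hle : ∀ p, ∑ i ∈ s, χ i p ^ 2 ≤ 1)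
    (hε : ∀ i p, χ i p ≠ 0 → |P p - dXr (φ i) p + B i * p.2| ≤ ε i ∧ |Q p - dYr (φ i) p| ≤ ε i ∧ m i ≤ lam * (p.2 ^ 2)⁻¹)
    (hX0 : ∀ (t : Finset (Σ _ : ℕ × ℕ, ℕ × ℕ)) (f : (Σ _ : ℕ × ℕ, ℕ × ℕ) → Rp → ℂ), (∀ j, IsTestOn UHP (f j)) →
      (∀ u, IsTestOn UHP u → ∑ j ∈ t, ‖wi (f j) u‖ ^ 2 ≤ wn u) → ∑ j ∈ t, (lam * wn (f j) - qA P Q (f j)) ≤ X0) :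
    ∑ i ∈ s, Y i ^ 2 * |B i| / (2 * π) * ∑ k ∈ Finset.range (K i), ∫ p, Wk (χ i) (m i - (1 + τ) * ((2 * k + 1) * |B i|) - (1 + τ⁻¹) * (2 * ε i ^ 2)) τ p ≤ X0 := by
  set L : ℕ × ℕ → ℝ := fun i => 3 * a * Y i
  have hL : ∀ i, 0 < L i := fun i => by have := hY i; positivity
  set c : ℕ × ℕ → ℝ := fun i => Y i / √(L i)
  have hc : ∀ i, c i ^ 2 * L i = Y i ^ 2 := fun i => by
    simp only [c]; rw [div_pow, Real.sq_sqrt (hL i).le, div_mul_cancel₀ _ (hL i).ne']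
  have hcs := fun i => HasCompactSupport.intro' (isCompact_Icc.prod isCompact_Icc) (isClosed_Icc.prod isClosed_Icc) fun p hp => by
    by_contra h; exact hp (hs i (subset_tsupport _ h))
  have hU : ∀ i, tsupport (χ i) ⊆ UHP := fun i p hp => (hY i).trans_le (hs i hp).2.1
  let χ' : ℕ × ℕ → Rp → ℝ := fun i p => c i * χ i p
  have hχ' : ∀ i, Sm (χ' i) := fun i => contDiff_const.mul (hχ i)
  have hcs' : ∀ i, Hc (χ' i) := fun i => (hcs i).mul_left
  have hU' : ∀ i, tsupport (χ' i) ⊆ UHP := fun i => (tsupport_mul_subset_right).trans (hU i)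
  let M' : ℕ × ℕ → ℕ → ℝ := fun i k => m i - (1 + τ) * ((2 * k + 1) * |B i|) - (1 + τ⁻¹) * (2 * ε i ^ 2)
  let g : ℕ × ℕ → ℕ → ℝ → ℝ := fun i k ζ => ∫ p, Wk (χ' i) (M' i k) τ p * ‖lF (B i) ζ k p‖ ^ 2
  have hg : ∀ i k, Integrable (g i k) ∧ ∫ ζ, g i k ζ = |B i| / (2 * π) * ∫ p, Wk (χ' i) (M' i k) τ p := fun i k =>
    lF_fub (hB i) k (Wk_cont (hχ' i) (hcs' i) _ τ).1 (Wk_cont (hχ' i) (hcs' i) _ τ).2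
  have hgi := fun i k => (hg i k).1.comp_div (hL i).ne'
  have hGi : ∀ i, Integrable (fun t => ∑ k ∈ Finset.range (K i), g i k (t / L i)) := fun i => integrable_finsetSum _ fun k _ => hgi i k
  have key := avg (G := fun t => ∑ i ∈ s, ∑ k ∈ Finset.range (K i), g i k (t / L i)) (integrable_finsetSum _ fun i _ => hGi i) (X0 := X0) ?_
  · rw [integral_finsetSum _ fun i _ => hGi i] at key
    refine le_trans (le_of_eq ?_) key
    refine Finset.sum_congr rfl fun i _ => ?_
    rw [integral_finsetSum _ fun k _ => hgi i k, Finset.mul_sum]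
    refine Finset.sum_congr rfl fun k _ => ?_
    rw [Measure.integral_comp_div (g i k), (hg i k).2, abs_of_pos (hL i), smul_eq_mul]
    have : ∫ p, Wk (χ' i) (M' i k) τ p = c i ^ 2 * ∫ p, Wk (χ i) (M' i k) τ p := by
      rw [← icm]; congr 1; funext p; exact Wk_scale (hχ i) _ _ _ _
    rw [this, ← hc i]; ring
  · intro t M
    let S : ℕ × ℕ → Finset (ℕ × ℕ) := fun i => Finset.range (K i) ×ˢ Finset.range (2 * M)
    let f : (Σ _ : ℕ × ℕ, ℕ × ℕ) → Rp → ℂ := fun j => tF (φ j.1) (χ' j.1) (B j.1) ((t - M + j.2.2) / L j.1) j.2.1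
    have hf : ∀ j, IsTestOn UHP (f j) := fun j => tF_test (hφ _) (hχ' _) (hcs' _) (hU' _) _ _ _
    refine le_trans ?_ (hX0 (s.sigma S) f hf ?_)
    · rw [Finset.sum_comm, Finset.sum_sigma]
      refine Finset.sum_le_sum fun i _ => ?_
      rw [Finset.sum_comm, Finset.sum_product]
      refine Finset.sum_le_sum fun k _ => Finset.sum_le_sum fun l _ => ?_
      exact tF_low h1 h2 (hφ i) (hχ' i) (hcs' i) (hU' i) (hB i) hτ _ k (fun p hp => hε i p (by rintro h; apply hp; simp [χ', h]))
    · intro u hu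
      rw [Finset.sum_sigma]
      refine (Finset.sum_le_sum fun i _ => bessel_one (hφ i) (hχ i) (hB i) ha (hY i) (hs i) (t - M) (S i) hu).trans ?_
      rw [← integral_finsetSum _ fun i _ => wn_int (rmul_test (hχ i) hu), wn]
      refine integral_mono (integrable_finsetSum _ fun i _ => wn_int (rmul_test (hχ i) hu)) (wn_int hu) fun p => ?_
      have : ∀ i, (p.2 ^ 2)⁻¹ * ‖(χ i p : ℂ) * u p‖ ^ 2 = χ i p ^ 2 * ((p.2 ^ 2)⁻¹ * ‖u p‖ ^ 2) := fun i => by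
        rw [norm_mul, Complex.norm_real, nea, mul_pow, sq_abs]; ring
      simp only [this]
      rw [← Finset.sum_mul]
      exact mul_le_of_le_one_left (by positivity) (hle p)
lemma ar_l1 {a τ lam : ℝ} (ha : 0 < a) (haτ : a ≤ τ) (hl : 0 ≤ lam) : lam * (1 - 6 * τ) ≤ lam * ((1 + 3 * a) ^ 2)⁻¹ := by
  refine mll ?_ hl
  rw [← one_div, le_div_iff₀ (by positivity)]
  rcases le_or_gt (1 - 6 * τ) 0 with h | h
  · nlinarith 
  · have h6 : 1 - 6 * τ ≤ 1 - 6 * a := by linarith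
    nlinarith [mul_pos ha ha]
lemma ar_l2 {C c τ lam k e A b' : ℝ} (hτ : 0 < τ) (hτ1 : τ ≤ 1) (hl : 0 ≤ lam) (hk : k * b' ≤ lam) (hC : 0 < C)
    (hA : lam * (1 - 6 * τ) ≤ A) (he : τ⁻¹ * e ≤ 18 * c ^ 2 * (τ ^ 2 * lam)) (he0 : 0 ≤ e) :
    lam * (1 - (7 + 36 * c ^ 2 + 72 * C) * τ) - k * b' ≤ A - (1 + τ) * (k * b') - (1 + τ⁻¹) * e - (1 + τ) * (36 * C * (lam * τ)) := by
  have h1 := le_mul_of_one_le_left he0 ((one_le_inv₀ hτ).2 hτ1)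
  have h4 : τ * (36 * C * (lam * τ)) ≤ 1 * (36 * C * (lam * τ)) := mlr hτ1 (by positivity)
  nlinarith
lemma grad_int {C a R : ℝ} (ha : 0 < a) (hC : 0 < C) {s : Finset (ℕ × ℕ)} {X Y : ℕ × ℕ → ℝ} {χ : ℕ × ℕ → Rp → ℝ} (H : PUn C a R s X Y χ) {i : ℕ × ℕ} (hi : i ∈ s) :
    ∫ p, (dXr (χ i) p ^ 2 + dYr (χ i) p ^ 2) ≤ 36 * C / (a * Y i) ^ 2 * ∫ p, χ i p ^ 2 := by
  have hY := H.pos i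
  have hm : MeasurableSet (Tl a (X i) (Y i)) := measurableSet_Icc.prod measurableSet_Icc
  have v : volume (Tl a (X i) (Y i)) = ENNReal.ofReal ((3 * a * Y i) ^ 2) := by
    rw [Tl, Measure.volume_eq_prod, Measure.prod_prod, Real.volume_Icc, Real.volume_Icc, ← ENNReal.ofReal_mul (by simp; positivity)]
    congr 1; ring
  have hii : Integrable ((Tl a (X i) (Y i)).indicator fun _ => C / (a * Y i) ^ 2) :=
    (integrable_indicator_iff hm).2 (integrableOn_const (by rw [v]; exact ENNReal.ofReal_ne_top) (by simp))
  have pw : ∀ p, dXr (χ i) p ^ 2 + dYr (χ i) p ^ 2 ≤ (Tl a (X i) (Y i)).indicator (fun _ => C / (a * Y i) ^ 2) p := by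
    intro p
    by_cases hp : p ∈ Tl a (X i) (Y i)
    · rw [Set.indicator_of_mem hp]
      have hy := hp.2.1
      have hp2 := hY.trans_le hy
      refine (Finset.single_le_sum (f := fun i => dXr (χ i) p ^ 2 + dYr (χ i) p ^ 2) (fun _ _ => by positivity) hi).trans ((H.grad p hp2).trans ?_)
      gcongr
    · rw [Set.indicator_of_notMem hp]
      have := izt fun h => hp (H.sup i (tsupport_fderiv_subset ℝ h))
      simp [dXr, dYr, this]
  have := integral_mono_of_nonneg (evf fun p => by positivity) hii (evf pw)
  refine this.trans ?_
  rw [integral_indicator hm, setIntegral_const, Measure.real, v, ENNReal.toReal_ofReal (by positivity), smul_eq_mul]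
  have e : (3 * a * Y i) ^ 2 * (C / (a * Y i) ^ 2) = 36 * C / (a * Y i) ^ 2 * ((a * Y i) ^ 2 / 4) := by grind
  rw [e]
  exact mll (H.mass i) (by positivity)
lemma sum_odd (K : ℕ) (l b : ℝ) : ∑ k ∈ Finset.range K, (l - (2 * k + 1) * b) = K * (l - K * b) := by
  induction K with
  | zero => simp
  | succ n ih => rw [Finset.sum_range_succ, ih]; grind
lemma ar_id (lam a τ t c b C Y I K : ℝ) : (lam * ((Y * (1 + 3 * a)) ^ 2)⁻¹ - (1 + τ) * (K * ((b + a) / Y ^ 2)) - (1 + t) * (2 * (c * a ^ 2 * (b + 1) / Y) ^ 2)) * I - (1 + τ) * (36 * C / (a * Y) ^ 2 * I)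
       = (lam * ((1 + 3 * a) ^ 2)⁻¹ - (1 + τ) * (K * (b + a)) - (1 + t) * (2 * (c * a ^ 2 * (b + 1)) ^ 2) - (1 + τ) * (36 * C * (a ^ 2)⁻¹)) * ((Y ^ 2)⁻¹ * I) := by
  rw [mul_pow Y, mul_inv]; ring
lemma fd_int {χ : Rp → ℝ} (h : Sm χ) (hc : Hc χ) (v : Rp) : Integrable (fun p => (fderiv ℝ χ p v) ^ 2) :=
  icc (((sm_fd h v).continuous).pow 2) ((cs_fd hc v).comp_left (g := fun t : ℝ => t ^ 2) (by simp))
lemma sq_int {χ : Rp → ℝ} (h : Continuous χ) (hc : Hc χ) : Integrable (fun p => χ p ^ 2) :=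
  icc (h.pow 2) (hc.comp_left (g := fun t : ℝ => t ^ 2) (by simp))
lemma tile_lo {C a R τ lam c b : ℝ} (ha : 0 < a) (hC : 0 < C) {s : Finset (ℕ × ℕ)} {X Y : ℕ × ℕ → ℝ} {χ : ℕ × ℕ → Rp → ℝ} (H : PUn C a R s X Y χ) {i : ℕ × ℕ} (hi : i ∈ s)
    (hτ : 0 < τ) (hτ1 : τ ≤ 1) (haτ : a = τ ^ 2) (hl : lam * τ ^ 5 = 1) (hb : 0 ≤ b) (hbl : b ≤ 2 * lam) {B : ℝ} (hB : |B| = (b + a) / Y i ^ 2) :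
    1 / (2 * π) * (Gt (b + a) (lam * (1 - (7 + 36 * c ^ 2 + 72 * C) * τ)) * ∫ p, χ i p ^ 2 ∂volH) ≤
     Y i ^ 2 * |B| / (2 * π) * ∑ k ∈ Finset.range (nn (b + a) (lam * (1 - (7 + 36 * c ^ 2 + 72 * C) * τ))), ∫ p, Wk (χ i) (lam * ((Y i * (1 + 3 * a)) ^ 2)⁻¹ - (1 + τ) * ((2 * k + 1) * |B|) - (1 + τ⁻¹) * (2 * (c * a ^ 2 * (b + 1) / Y i) ^ 2)) τ p := by
  have hY := H.pos i
  obtain ⟨hl1, hlt, hlt4⟩ := ar_lam hτ hτ1 hl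
  set l2 := lam * (1 - (7 + 36 * c ^ 2 + 72 * C) * τ) with hl2
  have hχc : Hc (χ i) := IsCompact.of_isClosed_subset (isCompact_Icc.prod isCompact_Icc) (isClosed_tsupport _) (H.sup i)
  have hU : tsupport (χ i) ⊆ UHP := (H.sup i).trans (Tl_UHP hY)
  set I := ∫ p, χ i p ^ 2 with hI
  have hI0 : 0 ≤ I := integral_nonneg fun p => by positivity
  have i1 : Integrable (fun p => χ i p ^ 2) := sq_int (H.sm i).continuous hχc
  have i2 : Integrable (fun p => dXr (χ i) p ^ 2 + dYr (χ i) p ^ 2) := by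
    refine Integrable.add (f := fun p => dXr (χ i) p ^ 2) (g := fun p => dYr (χ i) p ^ 2) ?_ ?_
    · exact fd_int (H.sm i) hχc (1, 0)
    · exact fd_int (H.sm i) hχc (0, 1)
  have hba : 0 < b + a := by positivity
  have wk : ∀ k ∈ Finset.range (nn (b + a) l2), (l2 - (2 * k + 1) * (b + a)) * ((Y i ^ 2)⁻¹ * I) ≤
      ∫ p, Wk (χ i) (lam * ((Y i * (1 + 3 * a)) ^ 2)⁻¹ - (1 + τ) * ((2 * k + 1) * |B|) - (1 + τ⁻¹) * (2 * (c * a ^ 2 * (b + 1) / Y i) ^ 2)) τ p := by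
    intro k hk
    have hk' := (nn_lt hba k).1 (Finset.mem_range.1 hk)
    simp only [Wk]
    rw [integral_sub (i1.const_mul _) (i2.const_mul _), icm, icm]
    have g := mll (grad_int ha hC H hi) (by linarith : 0 ≤ 1 + τ)
    refine le_trans ?_ (sub_le_sub_left g _)
    have e : (lam * ((Y i * (1 + 3 * a)) ^ 2)⁻¹ - (1 + τ) * ((2 * k + 1) * |B|) - (1 + τ⁻¹) * (2 * (c * a ^ 2 * (b + 1) / Y i) ^ 2)) * I - (1 + τ) * (36 * C / (a * Y i) ^ 2 * I)
       = (lam * ((1 + 3 * a) ^ 2)⁻¹ - (1 + τ) * ((2 * k + 1) * (b + a)) - (1 + τ⁻¹) * (2 * (c * a ^ 2 * (b + 1)) ^ 2) - (1 + τ) * (36 * C * (lam * τ))) * ((Y i ^ 2)⁻¹ * I) := by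
      rw [← hlt4, ← haτ, hB, one_div]; exact ar_id ..
    rw [← hI, e]
    refine mlr ?_ (by positivity)
    refine ar_l2 hτ hτ1 (by linarith) ?_ hC (ar_l1 ha (by rw [haτ]; nlinarith) (by linarith)) (by rw [haτ]; exact ar_e hτ hl hb (by linarith)) (by positivity)
    refine hk'.le.trans ?_
    refine mul_le_of_le_one_right (by linarith) ?_
    have : 0 ≤ (7 + 36 * c ^ 2 + 72 * C) * τ := by positivity
    linarith
  have hs := Finset.sum_le_sum wk
  rw [← Finset.sum_mul, sum_odd] at hs
  have e1 : Y i ^ 2 * |B| / (2 * π) = 1 / (2 * π) * (b + a) := by grind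
  rw [e1, mul_assoc (1 / (2 * π))]
  refine mll ?_ (by positivity)
  refine le_trans ?_ (mll hs hba.le)
  have e2 : (b + a) * (nn (b + a) l2 * (l2 - nn (b + a) l2 * (b + a)) * ((Y i ^ 2)⁻¹ * I)) = Gt (b + a) l2 * ((Y i ^ 2)⁻¹ * I) := by
    rw [Gt_eqn hba]; ring
  rw [e2]
  refine mll ?_ (Gt_nonneg hba.le)
  rw [volH_chi hU, hI, ← icm]
  have i3 : Integrable (fun p : Rp => (p.2 ^ 2)⁻¹ * χ i p ^ 2) := by
    refine ((i1.const_mul (Y i ^ 2)⁻¹)).mono' ?_ (evf fun p => ?_)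
    · exact ((measurable_snd.pow_const 2).inv.mul ((H.sm i).continuous.measurable.pow_const 2)).aestronglyMeasurable
    · rw [Real.norm_of_nonneg (by positivity)]
      by_cases h : χ i p = 0
      · simp [h]
      have := (H.sup i (subset_tsupport _ h)).2.1
      gcongr
  refine integral_mono i3 (i1.const_mul _) fun p => ?_
  by_cases h : χ i p = 0
  · simp [h]
  have := (H.sup i (subset_tsupport _ h)).2.1
  simp only; gcongr
lemma ar_r1 {u w τ lam : ℝ} (hu : 0 ≤ u) (hw : 0 ≤ w) (hτ : 0 < τ) (hτ1 : τ ≤ 1) (hl : 0 ≤ lam) :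
    (1 + u * τ ^ 2) * (lam * (1 - (u + w + 5) * τ)) + 5 * (lam * τ) ≤ lam * (1 - w * τ) := by
  have h1 : u * τ ^ 2 ≤ u * τ := mll (by nlinarith) hu
  have h2 : 0 ≤ u * τ ^ 2 * ((u + w + 5) * τ) := by positivity
  have := mll (show (1 + u * τ ^ 2) * (1 - (u + w + 5) * τ) + 5 * τ ≤ 1 - w * τ by linarith) hl
  linarith
lemma ar_r2 {lam C τ b b' c : ℝ} (hl : 1 ≤ lam) (hC : 0 ≤ C * τ) (hc : c ≤ 1 / 8) (hb : 2 * lam < b) (hb' : 0 ≤ b') (h : b - b' ≤ c * (b' + 1)) : lam * (1 - C * τ) ≤ b' := by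
  have := mlr hc (by linarith)
  have := mul_nonneg (by linarith : 0 ≤ lam) hC
  linarith
theorem R_low {P Q : Rp → ℝ} (h1 : Cd P UHP) (h2 : Cd Q UHP) (hH1 : H1 P Q) {C₀ : ℝ} (hC : 0 < C₀) (hH : H2 C₀ P Q) :
    ∃ C > 0, ∃ τ0 > 0, ∀ τ lam : ℝ, 0 < τ → τ ≤ τ0 → lam * τ ^ 5 = 1 → ∀ X0 : ℝ,
      (∀ (t : Finset (Σ _ : ℕ × ℕ, ℕ × ℕ)) (f : (Σ _ : ℕ × ℕ, ℕ × ℕ) → Rp → ℂ), (∀ j, IsTestOn UHP (f j)) →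
      (∀ u, IsTestOn UHP u → ∑ j ∈ t, ‖wi (f j) u‖ ^ 2 ≤ wn u) → ∑ j ∈ t, (lam * wn (f j) - qA P Q (f j)) ≤ X0) →
      1 / (2 * π) * ∫ p, Gt (intenB P Q p) (lam * (1 - C * τ)) ∂volH ≤ X0 := by
  obtain ⟨C1, hC1, hP⟩ := part_exists
  obtain ⟨c, hc⟩ : ∃ c, c = 36 * C₀ + 19 := ⟨_, rfl⟩
  obtain ⟨w, hw⟩ : ∃ w, w = 7 + 36 * c ^ 2 + 72 * C1 := ⟨_, rfl⟩
  have hw0 : 0 ≤ w := by rw [hw]; positivity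
  obtain ⟨u, hu⟩ : ∃ u, u = 4 * (12 * C₀ + 1) := ⟨_, rfl⟩
  have hu0 : 0 ≤ u := by rw [hu]; positivity
  refine ⟨u + w + 5, by positivity, 1 / (96 * (C₀ + 1) + 2 * (u + w + 5)), by positivity, ?_⟩
  intro τ lam hτ hτ0 hl X0 hX0
  rw [le_div_iff₀ (by positivity)] at hτ0
  have hCτ : 0 ≤ (u + w + 5) * τ := by positivity
  have hτ96 : τ * (96 * (C₀ + 1)) ≤ 1 := by linarith
  have hτC : (u + w + 5) * τ ≤ 1 / 2 := by nlinarith [mul_pos hτ hC]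
  have hτh : τ ≤ 1 / 96 := by nlinarith [mul_pos hτ hC]
  have hτ1 : τ ≤ 1 := by linarith
  obtain ⟨hl1, hlt, -⟩ := ar_lam hτ hτ1 hl
  obtain ⟨a, ha⟩ : ∃ a, a = τ ^ 2 := ⟨_, rfl⟩
  have ha0 : 0 < a := by rw [ha]; positivity
  have haτ : a ≤ τ := by rw [ha]; nlinarith
  have hac : 96 * a * (C₀ + 1) ≤ 1 := ar_a haτ hC.le hτ96
  have hac' : 12 * a * C₀ ≤ 1 / 8 := by linarith
  obtain ⟨R, hR, hbox⟩ := box_ex hH1 lam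
  obtain ⟨s, X, Y, χ, H⟩ := hP a R ha0 (by linarith) hR
  have hs : ∀ i, tsupport (χ i) ⊆ Tl a (X i) (Y i) := H.sup
  have hχc : ∀ i, Hc (χ i) := fun i => IsCompact.of_isClosed_subset (isCompact_Icc.prod isCompact_Icc) (isClosed_tsupport _) (hs i)
  have hU : ∀ i, tsupport (χ i) ⊆ UHP := fun i => (hs i).trans (Tl_UHP (H.pos i))
  choose φ B hφ hB hB0 hg using fun i => tile_gauge (X := X i) h1 h2 hC hH ha0 (H.pos i) (by linarith)
  obtain ⟨m1, hm1⟩ : ∃ m1, m1 = lam * (1 - (u + w + 5) * τ) := ⟨_, rfl⟩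
  have hm0 : 0 ≤ m1 := by rw [hm1]; exact mul_nonneg (by linarith) (by linarith)
  have hml : m1 ≤ lam := by rw [hm1]; exact mul_le_of_le_one_right (by linarith) (by linarith)
  rw [← hm1]
  set S := s.filter (fun i => intenB P Q (X i, Y i) ≤ 2 * lam) with hS
  have core := low_core (s := S) (ε := fun i => c * a ^ 2 * (intenB P Q (X i, Y i) + 1) / Y i) (m := fun i => lam * ((Y i * (1 + 3 * a)) ^ 2)⁻¹)
    (K := fun i => nn (intenB P Q (X i, Y i) + a) (lam * (1 - (7 + 36 * c ^ 2 + 72 * C1) * τ))) (lam := lam)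
    h1.continuousOn h2.continuousOn ha0 hτ hφ H.sm H.pos hB0 hs
    (fun p => (Finset.sum_le_sum_of_subset_of_nonneg (Finset.filter_subset _ _) fun _ _ _ => sq_nonneg _).trans (H.le1 p))
    (fun i p hp => by
      have hpT := hs i (subset_tsupport _ hp)
      have hp2 : p.2 ≤ Y i * (1 + 3 * a) := by have := hpT.2.2; linarith
      have hp0 : 0 < p.2 := (H.pos i).trans_le hpT.2.1
      refine ⟨by rw [hc]; exact (hg i p hpT).1, by rw [hc]; exact (hg i p hpT).2, ?_⟩
      gcongr) hX0
  refine le_trans ?_ core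
  have hGi : ∀ i, Integrable (fun p => χ i p ^ 2 * Gt (intenB P Q p) m1) volH := fun i => int_chiGt h1 h2 _ (H.sm i).continuous (hχc i) (hU i)
  have e1 : ∫ p, Gt (intenB P Q p) m1 ∂volH = ∑ i ∈ s, ∫ p, χ i p ^ 2 * Gt (intenB P Q p) m1 ∂volH := by
    rw [← integral_finsetSum _ fun i _ => hGi i]
    refine integral_congr_ae (volH_ae fun p hp => ?_)
    simp only
    rw [← Finset.sum_mul]
    rcases le_or_gt (intenB P Q p) lam with h | h
    · have hpb := hbox p hp h
      rw [H.eq1 p (abs_le.2 ⟨hpb.1.1, hpb.1.2⟩) hpb.2.1 hpb.2.2, one_mul]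
    · rw [Gt_zero (by linarith) (by linarith), mul_zero]
  have hv : ∀ i p, χ i p ≠ 0 → |intenB P Q (X i, Y i) - intenB P Q p| ≤ 12 * a * C₀ * (intenB P Q p + 1) := fun i p hp =>
    intenB_var h1 h2 hC hH ha0 (H.pos i) (by linarith) (Tl_corner ha0 (H.pos i)) (hs i (subset_tsupport _ hp))
  rw [e1, ← Finset.sum_filter_add_sum_filter_not s (fun i => intenB P Q (X i, Y i) ≤ 2 * lam), ← hS]
  have z : ∑ i ∈ s.filter (fun i => ¬ intenB P Q (X i, Y i) ≤ 2 * lam), ∫ p, χ i p ^ 2 * Gt (intenB P Q p) m1 ∂volH = 0 := by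
    refine Finset.sum_eq_zero fun i hi => ?_
    have hi' := not_le.1 (Finset.mem_filter.1 hi).2
    have : ∀ p, χ i p ^ 2 * Gt (intenB P Q p) m1 = 0 := by
      intro p
      by_cases hp : χ i p = 0
      · simp [hp]
      have h := (abs_le.1 (hv i p hp)).2
      have h0 : 0 ≤ intenB P Q p := abs_nonneg _
      have h5 := ar_r2 hl1 hCτ hac' hi' h0 h
      rw [← hm1] at h5
      rw [Gt_zero ?_ h5, mul_zero]
      have := mlr hac' (by linarith : 0 ≤ intenB P Q p + 1)
      linarith
    simp [this]
  rw [z, add_zero, Finset.mul_sum]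
  refine Finset.sum_le_sum fun i hi => ?_
  obtain ⟨his, hib⟩ := Finset.mem_filter.1 hi
  have hb0 : 0 ≤ intenB P Q (X i, Y i) := abs_nonneg _
  refine le_trans ?_ (tile_lo ha0 hC1 H his hτ hτ1 ha hl hb0 hib (hB i))
  refine mll ?_ (by positivity)
  rw [← icm, ← hw]
  refine integral_mono (hGi i) ((int_chi (H.sm i).continuous (hχc i) (hU i)).const_mul _) fun p => ?_
  simp only
  rw [mul_comm (χ i p ^ 2)]
  by_cases hp : χ i p = 0
  · simp [hp]
  refine mlr ?_ (sq_nonneg _)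
  have hr := ar_r1 hu0 hw0 hτ hτ1 (by linarith : 0 ≤ lam)
  rw [← hm1, ← ha] at hr
  have hua : 4 * ((12 * C₀ + 1) * a) = u * a := by rw [hu]; ring
  have hbp : 0 ≤ intenB P Q p := abs_nonneg _
  refine Gt_cmp (κ := (12 * C₀ + 1) * a) hbp (by positivity) (by positivity) (by linarith) ?_ hm0 (by rw [hua]; linarith) (ar_sq hm0 ?_)
  · obtain ⟨h3, h4⟩ := abs_le.1 (hv i p hp)
    have := mul_nonneg ha0.le hbp
    rw [abs_le]; constructor <;> linarith
  · exact ar_m (by positivity) hm0 hr hlt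
def Sn (P Q : Rp → ℝ) (lam : ℝ) : Set ℕ := {n : ℕ | ∃ V : Submodule ℂ (Rp → ℂ), (V : Set (Rp → ℂ)) ⊆ {f | IsTestOn UHP f} ∧
    Module.finrank ℂ V = n ∧ ∀ u ∈ V, u ≠ 0 → qA P Q u < lam * ∫ p, ‖u p‖ ^ 2 ∂volH}
def Nm (P Q : Rp → ℝ) (lam : ℝ) : ℝ := 1 / (2 * π) * ∫ p, nu (intenB P Q p) lam ∂volH
def Gm (P Q : Rp → ℝ) (lam : ℝ) : ℝ := 1 / (2 * π) * ∫ p, Gt (intenB P Q p) lam ∂volH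
lemma zero_Sn (P Q : Rp → ℝ) (lam : ℝ) : 0 ∈ Sn P Q lam :=
  ⟨⊥, by intro x hx; rw [(Submodule.mem_bot ℂ).1 hx]; exact TS.zero_mem, by simp, by simp⟩
lemma Sn_mono (P Q : Rp → ℝ) {l1 l2 : ℝ} (h : l1 ≤ l2) : Sn P Q l1 ⊆ Sn P Q l2 := by
  rintro n ⟨V, hV, hn, hq⟩
  exact ⟨V, hV, hn, fun u hu h0 => (hq u hu h0).trans_le (mlr h (integral_nonneg fun _ => by positivity))⟩
lemma int_nu {P Q : Rp → ℝ} (h1 : Cd P UHP) (h2 : Cd Q UHP) (hH : H1 P Q) {lam : ℝ} (hl : 0 ≤ lam) :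
    Integrable (fun p => nu (intenB P Q p) lam) volH :=
  int_H h1 h2 hH (F := fun b => nu b lam) (nu_meas lam) (M := lam) (Lm := lam)
    (fun b hb => by rw [abs_of_nonneg (nu_nonneg hb hl)]; exact nu_le hb hl) (fun b hb h => nu_zero (by linarith) h.le)
lemma Nm_mono {P Q : Rp → ℝ} (h1 : Cd P UHP) (h2 : Cd Q UHP) (hH : H1 P Q) {l1 l2 : ℝ} (hl : 0 ≤ l1) (h : l1 ≤ l2) :
    Nm P Q l1 ≤ Nm P Q l2 :=
  mll (integral_mono (int_nu h1 h2 hH hl) (int_nu h1 h2 hH (hl.trans h)) fun _ => nu_mono (abs_nonneg _) h) (by positivity)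
lemma Nm_nonneg (P Q : Rp → ℝ) {l : ℝ} (hl : 0 ≤ l) : 0 ≤ Nm P Q l :=
  mul_nonneg (by positivity) (integral_nonneg fun _ => nu_nonneg (abs_nonneg _) hl)
lemma Gm_sub {P Q : Rp → ℝ} (h1 : Cd P UHP) (h2 : Cd Q UHP) (hH : H1 P Q) {l1 l2 : ℝ} (hl1 : 0 ≤ l1) (hl2 : 0 ≤ l2) :
    Gm P Q l2 - Gm P Q l1 ≤ (l2 - l1) * Nm P Q l2 := by
  rw [Gm, Gm, Nm, ← mul_sub, mul_left_comm, ← integral_sub (int_Gt h1 h2 hH hl2) (int_Gt h1 h2 hH hl1)]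
  refine mll ?_ (by positivity)
  rw [← icm]
  exact integral_mono ((int_Gt h1 h2 hH hl2).sub (int_Gt h1 h2 hH hl1)) ((int_nu h1 h2 hH hl2).const_mul _) fun _ => Gt_sub_le (abs_nonneg _) _ _
lemma ex_tau {lam : ℝ} (hl : 0 < lam) : ∃ τ : ℝ, 0 < τ ∧ lam * τ ^ 5 = 1 := by
  refine ⟨lam ^ (-(1 / 5) : ℝ), by positivity, ?_⟩
  rw [← Real.rpow_natCast, ← Real.rpow_mul hl.le]
  norm_num [Real.rpow_neg_one]
  grind
lemma tau_cmp {l1 l2 t1 t2 k : ℝ} (hk : 1 ≤ k) (ht1 : 0 < t1) (ht2 : 0 < t2) (h1 : l1 * t1 ^ 5 = 1) (h2 : l2 * t2 ^ 5 = 1) (h : l2 ≤ k * l1) : t1 ≤ k * t2 := by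
  have h6 := pow_pos ht2 5
  refine le_of_pow_le_pow_left₀ (n := 5) (by norm_num) (by positivity) ?_
  have hl2 : 0 < l2 := by by_contra h; nlinarith
  have hl1 : 0 < l1 := by by_contra h; nlinarith
  have e1 : t1 ^ 5 = l1⁻¹ := by grind
  have e2 : t2 ^ 5 = l2⁻¹ := by grind
  have hk5 : k ≤ k ^ 5 := le_self_pow₀ hk (by norm_num)
  rw [mul_pow, e1, e2, ← div_eq_mul_inv, le_div_iff₀ hl2, inv_mul_eq_div, div_le_iff₀ hl1]
  exact h.trans (mlr hk5 hl1.le)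
lemma ar_t1 {lam x τ τ' r Cu Cl : ℝ} (hl : 0 ≤ lam) (hx : x ≤ 1) (hCu : 0 < Cu) (hCl : 0 < Cl) (h' : τ' ≤ τ) (hr : τ ≤ x * r) (ht : 0 < τ') :
    (lam + lam * x) * (1 + Cu * τ') - lam * (1 - Cl * τ) ≤ lam * x * (1 + (2 * Cu + Cl) * r) := by
  have h1 := mll (h'.trans hr) hCu.le
  have h2 := mll hr hCl.le
  have h3 : x * (Cu * τ') ≤ 1 * (Cu * τ') := mlr hx (by positivity)
  have := mll (show x + Cu * τ' + x * (Cu * τ') + Cl * τ ≤ x * (1 + (2 * Cu + Cl) * r) by linarith) hl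
  linarith
lemma ar_t2 {lam x τ τ' r Cu : ℝ} (hl : 0 ≤ lam) (hx0 : 0 < x) (hx : x ≤ 1) (hCu : 0 < Cu) (h' : τ' ≤ τ) (hr : τ ≤ x * r) (hr1 : r ≤ 1) (ht : 0 < τ') :
    (lam + lam * x) * (1 + Cu * τ') ≤ lam * (1 + (1 + 2 * Cu) * x) := by
  have h0 := mll hr1 hx0.le
  have h1 : Cu * τ' ≤ Cu * x := mll (by linarith) hCu.le
  have h3 : x * (Cu * τ') ≤ 1 * (Cu * τ') := mlr hx (by positivity)
  have := mll (show x + Cu * τ' + x * (Cu * τ') ≤ (1 + 2 * Cu) * x by linarith) hl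
  linarith
lemma ar_t3 {lam x τ τ' r Cu Cl : ℝ} (hl : 0 ≤ lam) (hx0 : 0 < x) (hCu : 0 < Cu) (hCl : 0 < Cl) (h' : τ' ≤ 2 * τ) (hr : τ ≤ x * r) (ht : 0 < τ') :
    lam * x * (1 - (2 * Cu + Cl) * r) ≤ lam * (1 - Cl * τ) - (lam - lam * x) * (1 + Cu * τ') := by
  have h1 : Cu * τ' ≤ Cu * (2 * (x * r)) := mll (by linarith) hCu.le
  have h2 := mll hr hCl.le
  have h3 : 0 ≤ x * (Cu * τ') := by positivity
  have := mll (show x * (1 - (2 * Cu + Cl) * r) ≤ x - Cu * τ' + x * (Cu * τ') - Cl * τ by linarith) hl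
  linarith
theorem taub {P Q : Rp → ℝ} (h1 : Cd P UHP) (h2 : Cd Q UHP) (hH1 : H1 P Q) {C₀ : ℝ} (hC : 0 < C₀) (hH : H2 C₀ P Q) :
    ∃ C > 0, ∃ τ0 > 0, ∀ lam x τ r : ℝ, 0 < τ → τ ≤ τ0 → lam * τ ^ 5 = 1 → 0 < x → x ≤ 1 / 2 → τ ≤ x * r → r ≤ 1 → C * r ≤ 1 →
      BddAbove (Sn P Q lam) ∧ (NH P Q lam : ℝ) ≤ (1 + C * r) * Nm P Q (lam * (1 + C * x)) ∧ (1 - C * r) * Nm P Q (lam * (1 - x)) ≤ NH P Q lam := by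
  obtain ⟨Cu, hCu, τu, hτu, HU⟩ := R_up h1 h2 hH1 hC hH
  obtain ⟨Cl, hCl, τl, hτl, HL⟩ := R_low h1 h2 hH1 hC hH
  refine ⟨1 + 2 * Cu + Cl, by positivity, min (τu / 2) (min τl (1 / (Cl + 1))), by positivity, ?_⟩
  intro lam x τ r hτ hτ0 hl hx hx2 hr hr1 hCr
  obtain ⟨hτ2, hτ3⟩ := le_min_iff.1 hτ0
  obtain ⟨hτ3, hτ4⟩ := le_min_iff.1 hτ3
  have hCτ : Cl * τ ≤ 1 := by rw [le_div_iff₀ (by positivity)] at hτ4; linarith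
  have hl0 : 0 < lam := by by_contra h; nlinarith [pow_pos hτ 5]
  have hr0 : 0 ≤ r := by by_contra h; nlinarith
  have hlx : 0 < lam * x := by positivity
  have hl1 : 0 ≤ lam * (1 - Cl * τ) := mul_nonneg hl0.le (by linarith)
  obtain ⟨τ1, ht1, hlt1⟩ := ex_tau (lam := lam + lam * x) (by positivity)
  have ht1' : τ1 ≤ τ := by have := tau_cmp le_rfl ht1 hτ hlt1 hl (by linarith); linarith
  have hl2 : 0 ≤ (lam + lam * x) * (1 + Cu * τ1) := by positivity
  have up : ∀ n ∈ Sn P Q lam, lam * x * n ≤ Gm P Q ((lam + lam * x) * (1 + Cu * τ1)) - Gm P Q (lam * (1 - Cl * τ)) := by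
    rintro n ⟨V, hV, rfl, hq⟩
    rw [le_sub_comm]
    refine HL τ lam hτ hτ3 hl _ fun t f hf hB => ?_
    obtain ⟨N, e, he, ho, hN, -, -, hs⟩ := spec_family h1.continuousOn h2.continuousOn lam V hV hq t f hf hB
    have hu := HU τ1 _ ht1 (by linarith) hlt1 N e he ho
    have e1 : ∑ j, (lam + lam * x - qA P Q (e j)) = ∑ j, (lam - qA P Q (e j)) + lam * x * N := by
      rw [Finset.sum_sub_distrib, Finset.sum_sub_distrib]; simp; ring
    have e2 : lam * x * (Module.finrank ℂ V : ℝ) ≤ lam * x * N := mll (by exact_mod_cast hN) hlx.le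
    rw [Gm]; linarith
  have bdd : BddAbove (Sn P Q lam) := by
    refine ⟨⌈(Gm P Q ((lam + lam * x) * (1 + Cu * τ1)) - Gm P Q (lam * (1 - Cl * τ))) / (lam * x)⌉₊, fun n hn => ?_⟩
    have := (le_div_iff₀' hlx).2 (up n hn)
    exact_mod_cast this.trans (Nat.le_ceil _)
  refine ⟨bdd, ?_, ?_⟩
  · have hN := up _ (Nat.sSup_mem ⟨0, zero_Sn P Q lam⟩ bdd)
    have hN' := hN.trans (Gm_sub h1 h2 hH1 hl1 hl2)
    have m1 := Nm_mono h1 h2 hH1 hl2 ((ar_t2 hl0.le hx (by linarith) hCu ht1' hr hr1 ht1).trans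
      (mll (by nlinarith : 1 + (1 + 2 * Cu) * x ≤ 1 + (1 + 2 * Cu + Cl) * x) hl0.le))
    have m2 := Nm_nonneg P Q hl2
    have m3 := ar_t1 hl0.le (by linarith) hCu hCl ht1' hr ht1
    have m4 : lam * x * (NH P Q lam : ℝ) ≤ lam * x * ((1 + (1 + 2 * Cu + Cl) * r) * Nm P Q (lam * (1 + (1 + 2 * Cu + Cl) * x))) := by
      refine hN'.trans ((mlr m3 m2).trans ?_)
      rw [mul_assoc (lam * x)]
      refine mll (mul_le_mul (by linarith) m1 m2 (by positivity)) hlx.le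
    exact le_of_mul_le_mul_left m4 hlx
  · have hlm : 0 < lam - lam * x := by nlinarith
    obtain ⟨τ2, ht2, hlt2⟩ := ex_tau hlm
    have ht2' : τ2 ≤ 2 * τ := tau_cmp (by norm_num) ht2 hτ hlt2 hl (by nlinarith)
    have hl3 : 0 ≤ (lam - lam * x) * (1 + Cu * τ2) := by positivity
    have lo : Gm P Q (lam * (1 - Cl * τ)) ≤ Gm P Q ((lam - lam * x) * (1 + Cu * τ2)) + lam * x * NH P Q lam := by
      refine HL τ lam hτ hτ3 hl _ fun t f hf hB => ?_
      obtain ⟨N, e, he, ho, -, -, ⟨U, hU⟩, hs⟩ := spec_family h1.continuousOn h2.continuousOn lam ⊥ (by intro x hx; rw [(Submodule.mem_bot ℂ).1 hx]; exact TS.zero_mem) (by simp) t f hf hB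
      have hN := le_csSup bdd ⟨U, hU⟩
      have hu := HU τ2 _ ht2 (by linarith) hlt2 N e he ho
      have e1 : ∑ j, (lam - lam * x - qA P Q (e j)) = ∑ j, (lam - qA P Q (e j)) - lam * x * N := by
        rw [Finset.sum_sub_distrib, Finset.sum_sub_distrib]; simp; ring
      have e2 : lam * x * (N : ℝ) ≤ lam * x * NH P Q lam := mll (by exact_mod_cast hN) hlx.le
      rw [Gm]; linarith
    have s := Gm_sub h1 h2 hH1 hl1 hl3
    have m3 := ar_t3 hl0.le hx hCu hCl ht2' hr ht2
    have m1 := Nm_mono h1 h2 hH1 hlm.le (le_mul_of_one_le_right hlm.le (by have := mul_pos hCu ht2; linarith : 1 ≤ 1 + Cu * τ2))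
    have m2 := Nm_nonneg P Q hlm.le
    have m5 : lam * x * ((1 - (1 + 2 * Cu + Cl) * r) * Nm P Q (lam * (1 - x))) ≤ lam * x * NH P Q lam := by
      rw [mul_sub lam, mul_one]
      have a1 : lam * x * (1 - (1 + 2 * Cu + Cl) * r) ≤ lam * x * (1 - (2 * Cu + Cl) * r) := mll (by linarith) hlx.le
      have a0 : 0 ≤ lam * x * (1 - (1 + 2 * Cu + Cl) * r) := mul_nonneg hlx.le (by linarith)
      have := mul_le_mul (a1.trans m3) m1 m2 (a0.trans (a1.trans m3))
      linarith
    exact le_of_mul_le_mul_left m5 hlx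
theorem taub2 {P Q : Rp → ℝ} (h1 : Cd P UHP) (h2 : Cd Q UHP) (hH1 : H1 P Q) {C₀ : ℝ} (hC : 0 < C₀) (hH : H2 C₀ P Q)
    {δ : ℝ} (hδ1 : 1 / 3 < δ) (hδ2 : δ < 2 / 5) :
    ∃ C > 0, ∃ L ≥ 1, ∀ lam : ℝ, L ≤ lam → lam ^ (1 - 3 * δ) ≤ 1 / 2 ∧ C * lam ^ (-((2 - 5 * δ) / 2)) ≤ 1 ∧
      BddAbove (Sn P Q lam) ∧ (NH P Q lam : ℝ) ≤ (1 + C * lam ^ (-((2 - 5 * δ) / 2))) * Nm P Q (lam * (1 + C * lam ^ (1 - 3 * δ))) ∧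
      (1 - C * lam ^ (-((2 - 5 * δ) / 2))) * Nm P Q (lam * (1 - lam ^ (1 - 3 * δ))) ≤ NH P Q lam := by
  obtain ⟨C, hC0, τ0, hτ0, H⟩ := taub h1 h2 hH1 hC hH
  have t1 : ∀ᶠ lam : ℝ in atTop, lam ^ (-(1 / 5) : ℝ) < τ0 := (tendsto_rpow_neg_atTop (by norm_num)).eventually_lt_const hτ0
  have t2 : ∀ᶠ lam : ℝ in atTop, lam ^ (-(3 * δ - 1)) < 1 / 2 := (tendsto_rpow_neg_atTop (by linarith)).eventually_lt_const (by norm_num)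
  have t3 : ∀ᶠ lam : ℝ in atTop, lam ^ (-((2 - 5 * δ) / 2)) < 1 / C := (tendsto_rpow_neg_atTop (by linarith)).eventually_lt_const (by positivity)
  obtain ⟨L, hL⟩ := eventually_atTop.1 (t1.and (t2.and t3))
  refine ⟨C, hC0, max L 1, le_max_right _ _, fun lam hlam => ?_⟩
  obtain ⟨hl, hl1⟩ := max_le_iff.1 hlam
  obtain ⟨a1, a2, a3⟩ := hL lam hl
  have e : -(3 * δ - 1) = 1 - 3 * δ := by ring
  rw [e] at a2
  rw [lt_div_iff₀' hC0] at a3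
  have hl0 : 0 < lam := by linarith
  refine ⟨a2.le, a3.le, H lam _ _ _ (Real.rpow_pos_of_pos hl0 _) a1.le ?_ (Real.rpow_pos_of_pos hl0 _) a2.le ?_ ?_ a3.le⟩
  · rw [← Real.rpow_natCast, ← Real.rpow_mul hl0.le]
    norm_num [Real.rpow_neg_one]
    exact mul_inv_cancel₀ hl0.ne'
  · rw [← Real.rpow_add hl0]
    exact Real.rpow_le_rpow_of_exponent_le hl1 (by linarith)
  · exact Real.rpow_le_one_of_one_le_of_nonpos hl1 (by linarith)
def nz (b lam : ℝ) : ℝ := if b = 0 then 0 else nu b lam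
lemma nz_eq {b : ℝ} (hb : 0 ≤ b) (t : ℝ) : b * ∑' k : ℕ, heav (t - (2 * (k : ℝ) + 1) * b) = nz b t := by
  rw [nz]; split_ifs with h
  · grind
  · exact tsum_heav (lt_of_le_of_ne hb (Ne.symm h))
lemma nz_meas (t : ℝ) : Measurable fun b => nz b t := Measurable.ite (measurableSet_singleton 0) measurable_const (nu_meas t)
lemma nz_nonneg {b t : ℝ} (hb : 0 ≤ b) (ht : 0 ≤ t) : 0 ≤ nz b t := by
  unfold nz; split_ifs
  exacts [le_rfl, nu_nonneg hb ht]
lemma nz_le {b t : ℝ} (hb : 0 ≤ b) (ht : 0 ≤ t) : nz b t ≤ t := by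
  unfold nz; split_ifs
  exacts [ht, nu_le hb ht]
lemma nz_zero {b t : ℝ} (hb : 0 ≤ b) (h : t ≤ b) : nz b t = 0 := by
  unfold nz; split_ifs with h0
  exacts [rfl, nu_zero (lt_of_le_of_ne hb (Ne.symm h0)) h]
lemma ex_v {P Q : Rp → ℝ} (h1 : Cd P UHP) (h2 : Cd Q UHP) (hH1 : H1 P Q) :
    ∃ b1 > 0, 0 < ∫ p, (Set.Ioo 0 b1).indicator (fun _ => (1 : ℝ)) (intenB P Q p) ∂volH := by
  obtain ⟨R, hR, hb⟩ := box_ex hH1 1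
  have hp0 : ((R + 1, 1) : Rp) ∈ UHP := by simp [UHP]
  have hb0 : 1 < intenB P Q (R + 1, 1) := by
    by_contra h
    have := (hb _ hp0 (not_lt.1 h)).1.2
    linarith
  refine ⟨intenB P Q (R + 1, 1) + 1, by linarith, ?_⟩
  set b1 := intenB P Q (R + 1, 1) + 1 with hb1
  rw [integral_pos_iff_support_of_nonneg (fun p => Set.indicator_nonneg (fun _ _ => zero_le_one) _)
    (int_H h1 h2 hH1 (F := (Set.Ioo 0 b1).indicator (fun _ => (1 : ℝ))) (measurable_const.indicator measurableSet_Ioo) (M := 1) (Lm := b1)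
    (fun b _ => by by_cases h : b ∈ Set.Ioo 0 b1 <;> simp [h]) (fun b _ h => Set.indicator_of_notMem (fun h' => by linarith [h'.2]) _))]
  rw [pos_iff_ne_zero]
  intro h0
  rw [volH, withDensity_apply_eq_zero (by fun_prop)] at h0
  have ho : IsOpen (UHP ∩ intenB P Q ⁻¹' Set.Ioo 0 b1) := (intenB_cont h1 h2).isOpen_inter_preimage UHP_open isOpen_Ioo
  refine (ho.measure_pos volume ⟨_, hp0, show _ ∈ Set.Ioo 0 b1 from ⟨by linarith, by linarith⟩⟩).ne' ?_
  rw [Measure.restrict_apply₀' UHP_meas.nullMeasurableSet] at h0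
  refine measure_mono_null ?_ h0
  rintro p ⟨hp, hp2⟩
  have hp' : 0 < p.2 := hp
  refine ⟨⟨?_, ?_⟩, hp⟩
  · simp; positivity
  · simp only [Function.mem_support]
    rw [Set.indicator_of_mem (show intenB P Q p ∈ Set.Ioo 0 b1 from hp2)]; linarith
lemma ar_p1 {C C3 α : ℝ} (h3 : 0 < C3) (hα : α ≤ 1 / 2) (h : 8 * C3 ^ 2 + 2 ≤ C) : 2 * C3 * (2 + C) ^ α ≤ C := by
  have hC : 2 ≤ C := by nlinarith 
  have h1 : (2 + C) ^ α ≤ √(2 + C) := by rw [Real.sqrt_eq_rpow]; exact Real.rpow_le_rpow_of_exponent_le (by linarith) hα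
  refine (mll h1 (by positivity)).trans ?_
  refine abs_le_of_sq_le_sq' ?_ (by linarith) |>.2
  rw [mul_pow, Real.sq_sqrt (by linarith)]
  nlinarith [sq_nonneg C3]
lemma pt_up {C C3 D v b b1 lam x α t : ℝ} (hα : 0 < α) (hα2 : α ≤ 1 / 2) (hC3 : 0 < C3) (hD : 0 ≤ D) (hv : 0 < v) (hb1 : 0 < b1) (hl : 1 < lam) (hx0 : 0 < x) (hx : x ≤ 1) (hlx : 1 ≤ lam * x)
    (c1 : 8 * C3 ^ 2 + 2 ≤ C) (c2 : b1 + 1 ≤ C) (c3 : 4 * (b1 + 1) * (D / v) ≤ C) (c4 : C3 + 1 ≤ C) (hb : 0 ≤ b) (ht : t = lam * (1 + C * x) - 1 / 4) :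
    (1 + C3 * lam ^ (-α)) * nz b (lam * (1 + C3 * x)) + D * lam / v * (Set.Ioo 0 b1).indicator (fun _ => (1 : ℝ)) b ≤ (1 + C / (b + 1) ^ α) * nz b t := by
  have hC0 : 0 ≤ C := by linarith
  have g1 : C * 1 ≤ C * (lam * x) := mll hlx (by linarith)
  have g2 : (C - C3) * 1 ≤ (C - C3) * (lam * x) := mll hlx (by linarith)
  have hmt : lam * (1 + C3 * x) ≤ t := by linarith
  rcases hb.eq_or_lt with h | h
  · subst h; simp [nz]
  rcases le_or_gt t b with hbt | hbt
  · rw [nz_zero hb hbt, nz_zero hb (hmt.trans hbt), Set.indicator_of_notMem (fun h' => ?_)]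
    · simp
    · grind
  have hn : nz b (lam * (1 + C3 * x)) ≤ nz b t := by simp only [nz, if_neg h.ne']; exact nu_mono hb hmt
  have hn0 : 0 ≤ nz b (lam * (1 + C3 * x)) := nz_nonneg hb (by positivity)
  have g3 : C3 * lam ^ (-α) ≤ C / (b + 1) ^ α / 2 := by
    have hb2 : b + 1 ≤ (2 + C) * lam := by
      have : C * (lam * x) ≤ C * lam := mll (by nlinarith) (by linarith)
      linarith
    have h5 : (b + 1) ^ α ≤ (2 + C) ^ α * lam ^ α := by
      rw [← Real.mul_rpow (by linarith) (by linarith)]; exact Real.rpow_le_rpow (by linarith) hb2 hα.le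
    have h6 := ar_p1 hC3 hα2 c1
    rw [div_div, le_div_iff₀ (by positivity), Real.rpow_neg (by linarith)]
    have := mll h5 (by positivity : 0 ≤ C3 * (lam ^ α)⁻¹ * 2)
    refine le_trans (by linarith) (this.trans ?_)
    have e : C3 * (lam ^ α)⁻¹ * 2 * ((2 + C) ^ α * lam ^ α) = 2 * C3 * (2 + C) ^ α := by field_simp
    linarith
  have g4 : D * lam / v * (Set.Ioo 0 b1).indicator (fun _ => (1 : ℝ)) b ≤ C / (b + 1) ^ α / 2 * nz b t := by
    have hz := hn0.trans hn
    by_cases hbb : b < b1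
    · rw [Set.indicator_of_mem (Set.mem_Ioo.2 ⟨h, hbb⟩), mul_one]
      have k1 : lam / 2 ≤ nz b t := by
        rw [nz, if_neg h.ne']
        refine le_trans ?_ (le_nu hb)
        linarith
      have k2 : (b + 1) ^ α ≤ b1 + 1 := by
        refine (Real.rpow_le_rpow_of_exponent_le (by linarith) (by linarith : α ≤ 1)).trans ?_
        rw [Real.rpow_one]; linarith
      have k3 : 2 * (D / v) ≤ C / (b + 1) ^ α / 2 := by
        rw [div_div, le_div_iff₀ (by positivity)]
        have := mll k2 (by positivity : 0 ≤ D / v)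
        linarith
      have k4 := mul_le_mul k3 k1 (by linarith) (by positivity)
      grind
    · rw [Set.indicator_of_notMem (fun h' => hbb h'.2), mul_zero]
      positivity
  have g5 := mul_le_mul (show 1 + C3 * lam ^ (-α) ≤ 1 + C / (b + 1) ^ α / 2 by linarith) hn hn0 (by positivity)
  linarith
lemma pt_lo {C C3 b lam x α t : ℝ} (hα : 0 < α) (hα1 : α ≤ 1) (hC3 : 0 < C3) (hl : 1 < lam) (hx0 : 0 < x) (hx : x ≤ 1) (hr : C3 * lam ^ (-α) ≤ 1)
    (c1 : 2 * C3 ≤ C) (c2 : 1 ≤ C) (hb : 0 ≤ b) (ht : t = lam * (1 - C * x) - 1 / 4) :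
    (1 - C / (b + 1) ^ α) * nz b t ≤ (1 - C3 * lam ^ (-α)) * nu b (lam * (1 - x)) := by
  have r0 : 0 ≤ (1 - C3 * lam ^ (-α)) * nu b (lam * (1 - x)) := mul_nonneg (by linarith) (nu_nonneg hb (mul_nonneg (by linarith) (by linarith)))
  rcases hb.eq_or_lt with h | h
  · subst h; simpa [nz] using r0
  rcases le_or_gt t b with hbt | hbt
  · rw [nz_zero hb hbt, mul_zero]; exact r0
  have hlx : 0 < lam * x := by positivity
  have htl : t ≤ lam * (1 - x) := by rw [ht]; nlinarith
  have hz : 0 ≤ nz b t := nz_nonneg hb (by linarith)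
  have hz2 : nz b t ≤ nu b (lam * (1 - x)) := by rw [nz, if_neg h.ne']; exact nu_mono hb htl
  have g3 : C3 * lam ^ (-α) ≤ C / (b + 1) ^ α := by
    have h5 : (b + 1) ^ α ≤ 2 * lam ^ α := by
      refine (Real.rpow_le_rpow (by linarith) (by nlinarith : b + 1 ≤ 2 * lam) hα.le).trans ?_
      rw [Real.mul_rpow (by norm_num) (by linarith)]
      refine mlr ?_ (by positivity)
      simpa using Real.rpow_le_rpow_of_exponent_le (by norm_num) hα1
    rw [le_div_iff₀ (by positivity), Real.rpow_neg (by linarith)]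
    refine (mll h5 (by positivity)).trans ?_
    have e : C3 * (lam ^ α)⁻¹ * (2 * lam ^ α) = 2 * C3 := by field_simp
    linarith
  exact (mlr (by linarith) hz).trans (mll hz2 (by linarith))
lemma up_all {P Q : Rp → ℝ} (h1 : Cd P UHP) (h2 : Cd Q UHP) (hH : H1 P Q) {C3 lam x r Z : ℝ} (hC3 : 0 < C3) (hl : 0 < lam) (hx0 : 0 < x) (hx : x ≤ 1) (hr0 : 0 ≤ r) (hr : C3 * r ≤ 1)
    (hZ : Z = ∫ p, ({0} : Set ℝ).indicator (fun _ => (1 : ℝ)) (intenB P Q p) ∂volH) :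
    2 * π * ((1 + C3 * r) * Nm P Q (lam * (1 + C3 * x))) ≤ (1 + C3 * r) * (∫ p, nz (intenB P Q p) (lam * (1 + C3 * x)) ∂volH) + (1 + C3) * Z * lam := by
  set l := lam * (1 + C3 * x) with hll
  have hl0 : 0 ≤ l := by positivity
  have i1 := int_H h1 h2 hH (F := fun b => nz b l) (nz_meas l) (M := l) (Lm := l)
    (fun b hb => by rw [abs_of_nonneg (nz_nonneg hb hl0)]; exact nz_le hb hl0) (fun b hb h => nz_zero hb h.le)
  have i2 : Integrable (fun p => ({0} : Set ℝ).indicator (fun _ => (1 : ℝ)) (intenB P Q p)) volH :=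
    int_H h1 h2 hH (F := ({0} : Set ℝ).indicator (fun _ => (1 : ℝ))) (measurable_const.indicator (measurableSet_singleton 0)) (M := 1) (Lm := 0)
    (fun b _ => by by_cases h : b = 0 <;> simp [h]) (fun b _ h => Set.indicator_of_notMem (s := {0}) (fun h' => h.ne' h') _)
  have e : ∫ p, nu (intenB P Q p) l ∂volH = (∫ p, nz (intenB P Q p) l ∂volH) + l / 2 * Z := by
    rw [hZ, ← icm, ← integral_add i1 (i2.const_mul _)]
    refine integral_congr_ae (evf fun p => ?_)
    by_cases h : intenB P Q p = 0 <;> simp [h, nz, nu]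
  have hZ0 : 0 ≤ Z := by rw [hZ]; exact integral_nonneg fun p => Set.indicator_nonneg (fun _ _ => zero_le_one) _
  have e2 : 2 * π * ((1 + C3 * r) * Nm P Q l) = (1 + C3 * r) * ∫ p, nu (intenB P Q p) l ∂volH := by
    rw [Nm]; field_simp
  rw [e2, e, mul_add]
  have k1 : l ≤ (1 + C3) * lam := by rw [hll, mul_comm lam]; exact mlr (by nlinarith) hl.le
  have k2 : (1 + C3 * r) * (l / 2) ≤ (1 + C3) * lam := by nlinarith
  have := mlr k2 hZ0
  linarith

/-- two-sided spectral asymptotics for the magnetic bottle. -/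
theorem counting_two_sided_bound
    (A₁ A₂ : ℝ × ℝ → ℝ) (hA₁ : ContDiffOn ℝ 2 A₁ UHP) (hA₂ : ContDiffOn ℝ 2 A₂ UHP)
    (h1 : H1 A₁ A₂) (h2 : ∃ C₀ > 0, H2 C₀ A₁ A₂)
    (δ : ℝ) (hδ1 : 1/3 < δ) (hδ2 : δ < 2/5) :
    ∃ C > 0, ∀ lam : ℝ, 1 < lam →
      (1 / (2 * π)) * (∫ p, (1 - C / (intenB A₁ A₂ p + 1) ^ ((2 - 5 * δ) / 2)) *
          intenB A₁ A₂ p *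
          ∑' k : ℕ, heav (lam * (1 - C * lam ^ (1 - 3 * δ)) - 1/4
            - (2 * (k : ℝ) + 1) * intenB A₁ A₂ p) ∂volH)
        ≤ (NH A₁ A₂ lam : ℝ) ∧
      (NH A₁ A₂ lam : ℝ) ≤
        (1 / (2 * π)) * (∫ p, (1 + C / (intenB A₁ A₂ p + 1) ^ ((2 - 5 * δ) / 2)) *
          intenB A₁ A₂ p *
          ∑' k : ℕ, heav (lam * (1 + C * lam ^ (1 - 3 * δ)) - 1/4
            - (2 * (k : ℝ) + 1) * intenB A₁ A₂ p) ∂volH) := by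
  obtain ⟨C₀, hC₀, hH2⟩ := h2
  obtain ⟨C3, hC3, L, hL1, HT⟩ := taub2 hA₁ hA₂ h1 hC₀ hH2 hδ1 hδ2
  obtain ⟨b1, hb1, hv⟩ := ex_v hA₁ hA₂ h1
  set v := ∫ p, (Set.Ioo 0 b1).indicator (fun _ => (1 : ℝ)) (intenB A₁ A₂ p) ∂volH with hv_def
  set α := (2 - 5 * δ) / 2 with hα_def
  have hα : 0 < α := by rw [hα_def]; linarith
  have hα2 : α ≤ 1 / 2 := by rw [hα_def]; linarith
  obtain ⟨Z, hZ⟩ : ∃ Z, Z = ∫ p, ({0} : Set ℝ).indicator (fun _ => (1 : ℝ)) (intenB A₁ A₂ p) ∂volH := ⟨_, rfl⟩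
  have hZ0 : 0 ≤ Z := by rw [hZ]; exact integral_nonneg fun p => Set.indicator_nonneg (fun _ _ => zero_le_one) _
  have hb0 : ∀ p, 0 ≤ intenB A₁ A₂ p := fun p => abs_nonneg _
  have eq1 : ∀ (t c : ℝ) p, c * intenB A₁ A₂ p * ∑' k : ℕ, heav (t - (2 * (k : ℝ) + 1) * intenB A₁ A₂ p) = c * nz (intenB A₁ A₂ p) t := by
    intro t c p; rw [mul_assoc, nz_eq (hb0 p)]
  simp only [eq1]
  obtain ⟨D, hD⟩ : ∃ D, D = (1 + C3) * Z + 2 * π * NH A₁ A₂ L := ⟨_, rfl⟩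
  have hD0 : 0 ≤ D := by rw [hD]; positivity
  have hLp : 0 < L ^ (3 * δ - 1) := Real.rpow_pos_of_pos (by linarith) _
  have hDv : 0 ≤ 4 * (b1 + 1) * (D / v) := by positivity
  obtain ⟨C, hC⟩ : ∃ C, C = 8 * C3 ^ 2 + 2 + (b1 + 1) + 4 * (b1 + 1) * (D / v) + (2 * C3 + 1) + L ^ (3 * δ - 1) := ⟨_, rfl⟩
  have hsq := sq_nonneg C3
  have hC0 : 0 < C := by rw [hC]; linarith
  refine ⟨C, hC0, fun lam hlam => ?_⟩
  have hl0 : 0 < lam := by linarith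
  set x := lam ^ (1 - 3 * δ) with hx_def
  have hx0 : 0 < x := Real.rpow_pos_of_pos hl0 _
  have hx1 : x ≤ 1 := Real.rpow_le_one_of_one_le_of_nonpos hlam.le (by linarith)
  have hlx : 1 ≤ lam * x := by
    rw [hx_def, ← Real.rpow_one_add' hl0.le (by linarith)]
    exact Real.one_le_rpow hlam.le (by linarith)
  have hr0 : 0 < lam ^ (-α) := Real.rpow_pos_of_pos hl0 _
  have hpi := Real.pi_pos
  constructor
  · rw [div_mul_eq_mul_div, one_mul, div_le_iff₀ (by positivity)]
    by_cases hLl : L ≤ lam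
    · obtain ⟨a1, a2, -, -, a5⟩ := HT lam hLl
      by_cases hi : Integrable (fun p => (1 - C / (intenB A₁ A₂ p + 1) ^ α) * nz (intenB A₁ A₂ p) (lam * (1 - C * x) - 1 / 4)) volH
      · have := integral_mono hi ((int_nu hA₁ hA₂ h1 (mul_nonneg hl0.le (by linarith : 0 ≤ 1 - x))).const_mul (1 - C3 * lam ^ (-α)))
          fun p => pt_lo hα (by linarith) hC3 hlam hx0 hx1 a2 (by rw [hC]; linarith) (by rw [hC]; linarith) (hb0 p) rfl
        refine this.trans ?_
        rw [integral_const_mul]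
        have k := mul_le_mul_of_nonneg_right a5 (by positivity : 0 ≤ 2 * π)
        refine le_trans (le_of_eq ?_) k
        rw [Nm, ← hx_def]; field_simp
      · rw [integral_undef hi]; positivity
    · have hle : lam ≤ L := (not_le.1 hLl).le
      have hCx : 1 ≤ C * x := by
        have e : lam ^ (3 * δ - 1) * x = 1 := by
          rw [hx_def, ← Real.rpow_add hl0]; simp
        have k := Real.rpow_le_rpow hl0.le hle (by linarith : 0 ≤ 3 * δ - 1)
        rw [← e]
        exact mul_le_mul_of_nonneg_right (by rw [hC]; linarith) hx0.le
      have ht : lam * (1 - C * x) - 1 / 4 ≤ 0 := by nlinarith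
      have : ∀ p, nz (intenB A₁ A₂ p) (lam * (1 - C * x) - 1 / 4) = 0 := fun p => nz_zero (hb0 p) (ht.trans (hb0 p))
      simp only [this, mul_zero, integral_zero]
      positivity
  · rw [div_mul_eq_mul_div, one_mul, le_div_iff₀ (by positivity)]
    obtain ⟨t, ht⟩ : ∃ t, t = lam * (1 + C * x) - 1 / 4 := ⟨_, rfl⟩
    have ht0 : 0 ≤ t := by rw [ht]; nlinarith [mul_pos hl0 (mul_pos hC0 hx0)]
    rw [← ht]
    have hl3 : 0 ≤ lam * (1 + C3 * x) := by positivity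
    have i0 : Integrable (fun p => nz (intenB A₁ A₂ p) (lam * (1 + C3 * x))) volH := int_H hA₁ hA₂ h1 (F := fun b => nz b (lam * (1 + C3 * x))) (nz_meas _) (M := lam * (1 + C3 * x)) (Lm := lam * (1 + C3 * x))
      (fun b hb => by rw [abs_of_nonneg (nz_nonneg hb hl3)]; exact nz_le hb hl3) (fun b hb h => nz_zero hb h.le)
    have i1 : Integrable (fun p => (Set.Ioo 0 b1).indicator (fun _ => (1 : ℝ)) (intenB A₁ A₂ p)) volH :=
      Integrable.of_integral_ne_zero (hv_def ▸ hv.ne')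
    have i2 : Integrable (fun p => (1 + C / (intenB A₁ A₂ p + 1) ^ α) * nz (intenB A₁ A₂ p) t) volH := by
      refine int_H hA₁ hA₂ h1 (F := fun b => (1 + C / (b + 1) ^ α) * nz b t) (Measurable.mul (by fun_prop) (nz_meas t)) (M := (1 + C) * t) (Lm := t) (fun b hb => ?_)
        (fun b hb h => by simp only [nz_zero hb h.le, mul_zero])
      have k0 : 0 ≤ nz b t := nz_nonneg hb ht0
      have k1 : C / (b + 1) ^ α ≤ C := div_le_self hC0.le (Real.one_le_rpow (by linarith) hα.le)
      have k2 : 0 ≤ C / (b + 1) ^ α := by positivity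
      rw [abs_of_nonneg (by positivity)]
      exact mul_le_mul (by linarith) (nz_le hb ht0) k0 (by linarith)
    have key := integral_mono ((i0.const_mul (1 + C3 * lam ^ (-α))).add (i1.const_mul (D * lam / v))) i2
      fun p => pt_up hα hα2 hC3 hD0 hv hb1 hlam hx0 hx1 hlx (by rw [hC]; linarith) (by rw [hC]; linarith) (by rw [hC]; linarith) (by rw [hC]; linarith) (hb0 p) ht
    refine le_trans ?_ key
    have e : ∫ p, ((fun p => (1 + C3 * lam ^ (-α)) * nz (intenB A₁ A₂ p) (lam * (1 + C3 * x))) + fun p => D * lam / v * (Set.Ioo 0 b1).indicator (fun _ => (1 : ℝ)) (intenB A₁ A₂ p)) p ∂volH =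
        (1 + C3 * lam ^ (-α)) * (∫ p, nz (intenB A₁ A₂ p) (lam * (1 + C3 * x)) ∂volH) + D * lam := by
      rw [integral_add' (i0.const_mul _) (i1.const_mul _), integral_const_mul, integral_const_mul, ← hv_def]
      field_simp
    rw [e]
    have hI : 0 ≤ ∫ p, nz (intenB A₁ A₂ p) (lam * (1 + C3 * x)) ∂volH := integral_nonneg fun p => nz_nonneg (hb0 p) hl3
    by_cases hLl : L ≤ lam
    · obtain ⟨a1, a2, -, a4, -⟩ := HT lam hLl
      have k := up_all hA₁ hA₂ h1 hC3 hl0 hx0 hx1 hr0.le a2 hZ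
      have k2 := mul_le_mul_of_nonneg_left a4 (by positivity : 0 ≤ 2 * π)
      have k3 : 0 ≤ 2 * π * (NH A₁ A₂ L : ℝ) * lam := by positivity
      rw [hD]; linarith
    · have hbd := (HT L le_rfl).2.2.1
      have hN : NH A₁ A₂ lam ≤ NH A₁ A₂ L := csSup_le_csSup hbd ⟨0, zero_Sn A₁ A₂ lam⟩ (Sn_mono A₁ A₂ (not_le.1 hLl).le)
      have hN' : (NH A₁ A₂ lam : ℝ) ≤ NH A₁ A₂ L := by exact_mod_cast hN
      have k1 : 0 ≤ (1 + C3 * lam ^ (-α)) * ∫ p, nz (intenB A₁ A₂ p) (lam * (1 + C3 * x)) ∂volH := by positivity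
      have k2 : 2 * π * (NH A₁ A₂ lam : ℝ) ≤ D := by
        rw [hD]; have : 0 ≤ (1 + C3) * Z := by positivity
        nlinarith
      have k3 : D * 1 ≤ D * lam := mul_le_mul_of_nonneg_left hlam.le hD0
      linarith
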